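/- arXiv:math/0404069 — 9 statements merged into one kernel-verified Lean document; each statement's English description precedes it below -/
import Mathlib

section
/- Let ℓ be a prime and let f(x) ∈ ℚ[x] be a polynomial of degree ℓ that is irreducible over ℚ. Then there exist infinitely many primes p such that f is irreducible over the field ℚ_p of p-adic numbers. -/
open NumberField Filter Topology UniqueFactorizationMonoid

open scoped ENNReal Pointwise

noncomputable section

/-- The term `N(I)⁻ˢ` of the Dedekind zeta series, in `ℝ≥0∞`. -/
def idealTerm (K : Type*) [Field K] [NumberField K] (s : ℝ) (I : Ideal (𝓞 K)) : ℝ≥0∞ :=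
  ENNReal.ofReal ((Ideal.absNorm I : ℝ) ^ (-s))

/-- The nonzero ideals that are divisible by no member of `T`. -/
def idealsPrimeTo (K : Type*) [Field K] [NumberField K] (T : Set (Ideal (𝓞 K))) :
    Set (Ideal (𝓞 K)) :=
  {I | I ≠ ⊥ ∧ ∀ q ∈ T, ¬ q ∣ I}

lemma idealTerm_mul {K : Type*} [Field K] [NumberField K] (s : ℝ) (I J : Ideal (𝓞 K)) :
    idealTerm K s (I * J) = idealTerm K s I * idealTerm K s J := by
  unfold idealTerm
  rw [← ENNReal.ofReal_mul (by positivity), map_mul, Nat.cast_mul,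
    Real.mul_rpow (by positivity) (by positivity)]

lemma two_mul_idealTerm_le_one {K : Type*} [Field K] [NumberField K] {s : ℝ} (hs : 1 ≤ s)
    {q : Ideal (𝓞 K)} (hq : q ≠ ⊤) : 2 * idealTerm K s q ≤ 1 := by
  have key : (Ideal.absNorm q : ℝ) ^ (-s) ≤ 1 / 2 := by
    by_cases h0 : Ideal.absNorm q = 0
    · rw [h0, Nat.cast_zero, Real.zero_rpow (by linarith)]
      norm_num
    · have h1 : Ideal.absNorm q ≠ 1 := by rwa [Ne, Ideal.absNorm_eq_one_iff]
      have h2 : (2 : ℝ) ≤ Ideal.absNorm q := by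
        exact_mod_cast (by omega : 2 ≤ Ideal.absNorm q)
      calc (Ideal.absNorm q : ℝ) ^ (-s) ≤ (Ideal.absNorm q : ℝ) ^ (-1 : ℝ) :=
            Real.rpow_le_rpow_of_exponent_le (by linarith) (by linarith)
        _ = (Ideal.absNorm q : ℝ)⁻¹ := Real.rpow_neg_one _
        _ ≤ 1 / 2 := by rw [one_div]; gcongr
  calc 2 * idealTerm K s q ≤ 2 * ENNReal.ofReal (1 / 2) := by unfold idealTerm; gcongr
    _ = 1 := by
      rw [show (2 : ℝ≥0∞) = ENNReal.ofReal 2 by simp, ← ENNReal.ofReal_mul (by norm_num)]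
      simp

lemma tsum_idealTerm_le_of_insert {K : Type*} [Field K] [NumberField K] {s : ℝ} (hs : 1 ≤ s)
    (hfin : ∑' I : Ideal (𝓞 K), idealTerm K s I ≠ ∞) (T : Set (Ideal (𝓞 K)))
    {q : Ideal (𝓞 K)} (hq : Prime q) :
    ∑' I : idealsPrimeTo K T, idealTerm K s I ≤
      2 * ∑' I : idealsPrimeTo K (insert q T), idealTerm K s I := by
  set D := idealsPrimeTo K T
  set D' := idealsPrimeTo K (insert q T)
  set Z := ∑' I : D, idealTerm K s I with hZ
  have hZfin : Z ≠ ∞ := ne_top_of_le_ne_top hfin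
    (ENNReal.tsum_comp_le_tsum_of_injective Subtype.val_injective _)
  have hsplit : D ⊆ D' ∪ (q * ·) '' D := by
    intro I hI
    by_cases hqI : q ∣ I
    · right
      obtain ⟨J, rfl⟩ := hqI
      refine ⟨J, ⟨?_, fun r hr hrJ => hI.2 r hr (hrJ.mul_left _)⟩, rfl⟩
      rintro rfl
      exact hI.1 (by simp)
    · left
      refine ⟨hI.1, ?_⟩
      rintro r (rfl | hr)
      · exact hqI
      · exact hI.2 r hr
  have hle : Z ≤ ∑' I : D', idealTerm K s I + idealTerm K s q * Z := by
    calc Z ≤ ∑' I : ↑(D' ∪ (q * ·) '' D), idealTerm K s I := ENNReal.tsum_mono_subtype _ hsplit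
      _ ≤ ∑' I : D', idealTerm K s I + ∑' I : ↑((q * ·) '' D), idealTerm K s I :=
        ENNReal.tsum_union_le _ _ _
      _ = _ := by
        congr 1
        rw [tsum_image (idealTerm K s)
          ((mul_right_injective₀ hq.ne_zero).injOn), hZ, ← ENNReal.tsum_mul_left]
        simp_rw [idealTerm_mul]
  have hq' : q ≠ ⊤ := fun h => hq.not_isUnit (by rw [h, ← Ideal.one_eq_top]; exact isUnit_one)
  have h2 : 2 * Z ≤ 2 * ∑' I : D', idealTerm K s I + Z := by
    calc 2 * Z ≤ 2 * (∑' I : D', idealTerm K s I + idealTerm K s q * Z) := by gcongr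
      _ = 2 * ∑' I : D', idealTerm K s I + (2 * idealTerm K s q) * Z := by ring
      _ ≤ 2 * ∑' I : D', idealTerm K s I + 1 * Z := by
        gcongr; exact two_mul_idealTerm_le_one hs hq'
      _ = _ := by rw [one_mul]
  rw [two_mul Z] at h2
  exact (ENNReal.add_le_add_iff_right hZfin).1 h2

lemma tsum_idealTerm_le_of_finset {K : Type*} [Field K] [NumberField K] {s : ℝ} (hs : 1 ≤ s)
    (hfin : ∑' I : Ideal (𝓞 K), idealTerm K s I ≠ ∞) (T : Finset (Ideal (𝓞 K)))
    (hT : ∀ q ∈ T, Prime q) :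
    ∑' I : Ideal (𝓞 K), idealTerm K s I ≤
      2 ^ T.card * ∑' I : idealsPrimeTo K (T : Set (Ideal (𝓞 K))), idealTerm K s I := by
  classical
  induction T using Finset.induction_on with
  | empty =>
    simp only [Finset.card_empty, pow_zero, one_mul]
    rw [tsum_subtype]
    refine ENNReal.tsum_le_tsum fun I => ?_
    by_cases hI : I = ⊥
    · subst hI
      simp [idealTerm, Real.zero_rpow (by linarith : -s ≠ 0)]
    · rw [Set.indicator_of_mem]
      exact ⟨hI, by simp⟩
  | insert q T hq ih =>
    rw [Finset.card_insert_of_notMem hq, pow_succ, mul_assoc, Finset.coe_insert]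
    refine (ih fun r hr => hT r (Finset.mem_insert_of_mem hr)).trans ?_
    gcongr
    exact tsum_idealTerm_le_of_insert hs hfin _ (hT q (Finset.mem_insert_self _ _))

/-- Near `1` from the right, the `ℝ≥0∞`-valued ideal sum is the Dedekind zeta function. -/
lemma eventually_tsum_idealTerm_eq (K : Type*) [Field K] [NumberField K] :
    ∀ᶠ s : ℝ in 𝓝[>] 1, ∑' I : Ideal (𝓞 K), idealTerm K s I =
      ENNReal.ofReal (dedekindZeta K s).re := by
  have hne : ∀ᶠ s : ℝ in 𝓝[>] 1, (s - 1) * dedekindZeta K s ≠ 0 :=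
    (tendsto_sub_one_mul_dedekindZeta_nhdsGT K).eventually_ne
      (Complex.ofReal_ne_zero.2 (dedekindZeta_residue_ne_zero K))
  filter_upwards [hne, self_mem_nhdsWithin] with s hs hs1
  have hs0 : s ≠ 0 := by have := Set.mem_Ioi.1 hs1; linarith
  set c : ℕ → ℕ := fun n => Nat.card {I : Ideal (𝓞 K) // Ideal.absNorm I = n}
  have hterm : ∀ n, LSeries.term (fun n ↦ (c n : ℂ)) s n = ((c n * (n : ℝ) ^ (-s) : ℝ) : ℂ) := by
    intro n
    rcases eq_or_ne n 0 with rfl | hn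
    · simp [Real.zero_rpow (neg_ne_zero.2 hs0)]
    · rw [LSeries.term_of_ne_zero hn, Real.rpow_neg (by positivity), div_eq_mul_inv]
      push_cast
      rw [Complex.ofReal_cpow (by positivity)]
      simp
  have hsum : Summable fun n : ℕ => ((c n * (n : ℝ) ^ (-s) : ℝ) : ℂ) := by
    by_contra h
    refine (mul_ne_zero_iff.1 hs).2 ?_
    rw [dedekindZeta, LSeries]
    refine tsum_eq_zero_of_not_summable ?_
    rwa [summable_congr hterm]
  have hz : dedekindZeta K s = ((∑' n : ℕ, c n * (n : ℝ) ^ (-s) : ℝ) : ℂ) := by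
    rw [dedekindZeta, LSeries, Complex.ofReal_tsum]
    exact tsum_congr hterm
  rw [hz, Complex.ofReal_re, ENNReal.ofReal_tsum_of_nonneg (fun n => by positivity)
    (Complex.summable_ofReal.1 hsum),
    ← (Equiv.sigmaFiberEquiv (Ideal.absNorm : Ideal (𝓞 K) → ℕ)).tsum_eq, ENNReal.tsum_sigma']
  refine tsum_congr fun n => ?_
  have hfinite : Finite {I : Ideal (𝓞 K) // Ideal.absNorm I = n} :=
    Ideal.finite_setOfPred_absNorm_eq n
  have : ∀ I : {I : Ideal (𝓞 K) // Ideal.absNorm I = n},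
      idealTerm K s (Equiv.sigmaFiberEquiv (Ideal.absNorm : Ideal (𝓞 K) → ℕ) ⟨n, I⟩) =
        ENNReal.ofReal ((n : ℝ) ^ (-s)) := by
    rintro ⟨I, rfl⟩
    rfl
  rw [tsum_congr this, ENNReal.tsum_const, ENNReal.ofReal_mul (by positivity),
    ENNReal.ofReal_natCast, ENat.card_eq_coe_natCard]
  rfl

section

variable {R S : Type*} [CommRing R] [IsDedekindDomain R] [CommRing S] [IsDedekindDomain S]

/-- The multiplicative extension to ideals of a function on prime ideals. -/
def extendPrimes (a : Ideal R → Ideal S) (I : Ideal R) : Ideal S :=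
  ((normalizedFactors I).map a).prod

lemma normalizedFactors_extendPrimes {a : Ideal R → Ideal S} {I : Ideal R}
    (ha : ∀ q ∈ normalizedFactors I, Prime (a q)) :
    normalizedFactors (extendPrimes a I) = (normalizedFactors I).map a := by
  refine normalizedFactors_prod_of_prime fun P hP => ?_
  obtain ⟨q, hq, rfl⟩ := Multiset.mem_map.1 hP
  exact ha q hq

lemma extendPrimes_ne_zero {a : Ideal R → Ideal S} {I : Ideal R}
    (ha : ∀ q ∈ normalizedFactors I, Prime (a q)) : extendPrimes a I ≠ 0 := by
  refine Multiset.prod_ne_zero fun h => ?_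
  obtain ⟨q, hq, h0⟩ := Multiset.mem_map.1 h
  exact (ha q hq).ne_zero h0

lemma injOn_extendPrimes_mul_extendPrimes {a b : Ideal R → Ideal S} {c : Ideal S → Ideal R}
    {D : Set (Ideal R)} (hD : ∀ I ∈ D, I ≠ ⊥)
    (h : ∀ I ∈ D, ∀ q ∈ normalizedFactors I,
      Prime (a q) ∧ Prime (b q) ∧ c (a q) = q ∧ c (b q) = q ∧ a q ≠ b q) :
    Set.InjOn (fun x : Ideal R × Ideal R => extendPrimes a x.1 * extendPrimes b x.2)
      (D ×ˢ D) := by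
  classical
  have hNF : ∀ x ∈ D ×ˢ D, normalizedFactors (extendPrimes a x.1 * extendPrimes b x.2) =
      (normalizedFactors x.1).map a + (normalizedFactors x.2).map b := by
    rintro ⟨I, J⟩ ⟨hI, hJ⟩
    rw [normalizedFactors_mul (extendPrimes_ne_zero fun q hq => (h I hI q hq).1)
      (extendPrimes_ne_zero fun q hq => (h J hJ q hq).2.1),
      normalizedFactors_extendPrimes fun q hq => (h I hI q hq).1,
      normalizedFactors_extendPrimes fun q hq => (h J hJ q hq).2.1]
  have hfilter : ∀ x ∈ D ×ˢ D, ((normalizedFactors x.1).map a + (normalizedFactors x.2).map b).filter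
      (fun P => a (c P) = P) = (normalizedFactors x.1).map a := by
    rintro ⟨I, J⟩ ⟨hI, hJ⟩
    rw [Multiset.filter_add, Multiset.filter_eq_self.2, Multiset.filter_eq_nil.2, add_zero]
    · intro P hP
      obtain ⟨q, hq, rfl⟩ := Multiset.mem_map.1 hP
      rw [(h J hJ q hq).2.2.2.1]
      exact (h J hJ q hq).2.2.2.2
    · intro P hP
      obtain ⟨q, hq, rfl⟩ := Multiset.mem_map.1 hP
      rw [(h I hI q hq).2.2.1]
  have hrec : ∀ I ∈ D, ∀ J ∈ D, normalizedFactors I = normalizedFactors J → I = J := by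
    intro I hI J hJ hIJ
    rw [← Ideal.prod_normalizedFactors_eq_self (hD I hI), hIJ, Ideal.prod_normalizedFactors_eq_self (hD J hJ)]
  have hca : ∀ I ∈ D, ((normalizedFactors I).map a).map c = normalizedFactors I := by
    intro I hI
    rw [Multiset.map_map]
    exact (Multiset.map_congr rfl fun q hq => (h I hI q hq).2.2.1).trans (Multiset.map_id _)
  have hcb : ∀ I ∈ D, ((normalizedFactors I).map b).map c = normalizedFactors I := by
    intro I hI
    rw [Multiset.map_map]
    exact (Multiset.map_congr rfl fun q hq => (h I hI q hq).2.2.2.1).trans (Multiset.map_id _)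
  intro x hx y hy hxy
  have h1 : (normalizedFactors x.1).map a + (normalizedFactors x.2).map b =
      (normalizedFactors y.1).map a + (normalizedFactors y.2).map b := by
    rw [← hNF x hx, ← hNF y hy]
    exact congrArg normalizedFactors hxy
  have h2 : (normalizedFactors x.1).map a = (normalizedFactors y.1).map a := by
    rw [← hfilter x hx, h1, hfilter y hy]
  rw [h2, add_right_inj] at h1
  refine Prod.ext (hrec _ hx.1 _ hy.1 ?_) (hrec _ hx.2 _ hy.2 ?_)
  · rw [← hca _ hx.1, h2, hca _ hy.1]
  · rw [← hcb _ hx.2, h1, hcb _ hy.2]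

end

lemma absNorm_extendPrimes {K L : Type*} [Field K] [NumberField K] [Field L] [NumberField L]
    {a : Ideal (𝓞 K) → Ideal (𝓞 L)} {I : Ideal (𝓞 K)} (hI : I ≠ ⊥)
    (ha : ∀ q ∈ normalizedFactors I, Ideal.absNorm (a q) = Ideal.absNorm q) :
    Ideal.absNorm (extendPrimes a I) = Ideal.absNorm I := by
  conv_rhs => rw [← Ideal.prod_normalizedFactors_eq_self hI]
  rw [extendPrimes, map_multiset_prod, map_multiset_prod, Multiset.map_map]
  exact congrArg _ (Multiset.map_congr rfl ha)

lemma sq_tsum_idealTerm_le {K L : Type*} [Field K] [NumberField K] [Field L] [NumberField L]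
    {a b : Ideal (𝓞 K) → Ideal (𝓞 L)} {c : Ideal (𝓞 L) → Ideal (𝓞 K)} {T : Set (Ideal (𝓞 K))}
    (hne : ∀ q, Prime q → q ∉ T → a q ≠ b q)
    (ha : ∀ q, Prime q → q ∉ T →
      Prime (a q) ∧ c (a q) = q ∧ Ideal.absNorm (a q) = Ideal.absNorm q)
    (hb : ∀ q, Prime q → q ∉ T →
      Prime (b q) ∧ c (b q) = q ∧ Ideal.absNorm (b q) = Ideal.absNorm q) (s : ℝ) :
    (∑' I : idealsPrimeTo K T, idealTerm K s I) ^ 2 ≤ ∑' I : Ideal (𝓞 L), idealTerm L s I := by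
  set D := idealsPrimeTo K T
  have hgood : ∀ I ∈ D, ∀ q ∈ normalizedFactors I, Prime q ∧ q ∉ T := fun I hI q hq =>
    ⟨prime_of_normalized_factor q hq, fun hqT => hI.2 q hqT (dvd_of_mem_normalizedFactors hq)⟩
  have hinj := injOn_extendPrimes_mul_extendPrimes (a := a) (b := b) (c := c) (D := D)
    (fun I hI => hI.1) (fun I hI q hq => by
      obtain ⟨h1, h2⟩ := hgood I hI q hq
      exact ⟨(ha q h1 h2).1, (hb q h1 h2).1, (ha q h1 h2).2.1, (hb q h1 h2).2.1, hne q h1 h2⟩)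
  have hterm : ∀ I J : D, idealTerm L s (extendPrimes a I.1 * extendPrimes b J.1) =
      idealTerm K s I * idealTerm K s J := by
    intro I J
    rw [idealTerm_mul]
    unfold idealTerm
    rw [absNorm_extendPrimes I.2.1 fun q hq =>
        (ha q (hgood I I.2 q hq).1 (hgood I I.2 q hq).2).2.2,
      absNorm_extendPrimes J.2.1 fun q hq =>
        (hb q (hgood J J.2 q hq).1 (hgood J J.2 q hq).2).2.2]
  have hinj' : Function.Injective
      (fun x : D × D => extendPrimes a x.1.1 * extendPrimes b x.2.1) := by
    intro x y hxy
    have key : ((x.1.1, x.2.1) : Ideal (𝓞 K) × Ideal (𝓞 K)) = (y.1.1, y.2.1) :=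
      hinj (Set.mk_mem_prod x.1.2 x.2.2) (Set.mk_mem_prod y.1.2 y.2.2) hxy
    exact Prod.ext (Subtype.ext (congrArg Prod.fst key)) (Subtype.ext (congrArg Prod.snd key))
  calc (∑' I : D, idealTerm K s I) ^ 2
      = ∑' x : D × D, idealTerm L s (extendPrimes a x.1.1 * extendPrimes b x.2.1) := by
        simp_rw [hterm]
        rw [pow_two, ENNReal.tsum_prod (f := fun I J : D => idealTerm K s I * idealTerm K s J),
          ← ENNReal.tsum_mul_right]
        simp_rw [ENNReal.tsum_mul_left]
    _ ≤ _ := ENNReal.tsum_comp_le_tsum_of_injective hinj' (idealTerm L s)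

lemma tendsto_sub_one_mul_re_dedekindZeta (K : Type*) [Field K] [NumberField K] :
    Tendsto (fun s : ℝ => (s - 1) * (dedekindZeta K s).re) (𝓝[>] 1)
      (𝓝 (dedekindZeta_residue K)) := by
  refine ((Complex.continuous_re.tendsto _).comp
    (tendsto_sub_one_mul_dedekindZeta_nhdsGT K)).congr fun s => ?_
  simp [← Complex.ofReal_one, ← Complex.ofReal_sub]

/-- If all but finitely many primes of `K` had two distinct primes of `L` of the same norm
above them, then `ζ_L` would have at least a double pole at `1`. -/
theorem not_forall_exists_two_primes_same_norm {K L : Type*} [Field K] [NumberField K]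
    [Field L] [NumberField L] (c : Ideal (𝓞 L) → Ideal (𝓞 K)) (T : Finset (Ideal (𝓞 K)))
    (hT : ∀ q ∈ T, Prime q) :
    ¬ ∀ q : Ideal (𝓞 K), Prime q → q ∉ (T : Set (Ideal (𝓞 K))) →
      ∃ P P' : Ideal (𝓞 L), P ≠ P' ∧
        (Prime P ∧ c P = q ∧ Ideal.absNorm P = Ideal.absNorm q) ∧
        (Prime P' ∧ c P' = q ∧ Ideal.absNorm P' = Ideal.absNorm q) := by
  intro H
  choose! a b hne ha hb using H
  have hreK := tendsto_sub_one_mul_re_dedekindZeta K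
  have hreL := tendsto_sub_one_mul_re_dedekindZeta L
  have hpos := dedekindZeta_residue_pos K
  set C : ℝ := (2 ^ T.card) ^ 2 with hC
  have hineq : ∀ᶠ s : ℝ in 𝓝[>] 1, ((s - 1) * (dedekindZeta K s).re) ^ 2 ≤
      C * ((s - 1) * ((s - 1) * (dedekindZeta L s).re)) := by
    filter_upwards [eventually_tsum_idealTerm_eq K, eventually_tsum_idealTerm_eq L,
      self_mem_nhdsWithin, hreK.eventually_const_lt hpos,
      hreL.eventually_const_lt (dedekindZeta_residue_pos L)] with s hK hL hs1 hKpos hLpos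
    have hs : 0 < s - 1 := sub_pos.2 hs1
    have hK0 : 0 ≤ (dedekindZeta K s).re := (pos_of_mul_pos_right hKpos hs.le).le
    have hL0 : 0 ≤ (dedekindZeta L s).re := (pos_of_mul_pos_right hLpos hs.le).le
    have hfin : ∑' I : Ideal (𝓞 K), idealTerm K s I ≠ ∞ := by rw [hK]; exact ENNReal.ofReal_ne_top
    have h1 := tsum_idealTerm_le_of_finset (by linarith : 1 ≤ s) hfin T hT
    have h2 : ENNReal.ofReal ((dedekindZeta K s).re ^ 2) ≤
        ENNReal.ofReal (C * (dedekindZeta L s).re) := by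
      rw [ENNReal.ofReal_pow hK0, ENNReal.ofReal_mul (by positivity), ← hK, ← hL]
      calc (∑' I : Ideal (𝓞 K), idealTerm K s I) ^ 2
          ≤ (2 ^ T.card * ∑' I : idealsPrimeTo K (T : Set (Ideal (𝓞 K))), idealTerm K s I) ^ 2 := by
            gcongr
        _ = ENNReal.ofReal C *
            (∑' I : idealsPrimeTo K (T : Set (Ideal (𝓞 K))), idealTerm K s I) ^ 2 := by
            rw [mul_pow, hC, ENNReal.ofReal_pow (by positivity), ENNReal.ofReal_pow (by positivity)]
            simp
        _ ≤ _ := by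
            gcongr
            exact sq_tsum_idealTerm_le hne ha hb s
    have h3 := (ENNReal.ofReal_le_ofReal_iff (by positivity)).1 h2
    nlinarith [mul_le_mul_of_nonneg_left h3 (sq_nonneg (s - 1))]
  have hlim : Tendsto (fun s : ℝ => s - 1) (𝓝[>] 1) (𝓝 0) := by
    have : Tendsto (fun s : ℝ => s - 1) (𝓝 1) (𝓝 (1 - 1)) := tendsto_id.sub_const 1
    rw [sub_self] at this
    exact this.mono_left nhdsWithin_le_nhds
  have := le_of_tendsto_of_tendsto (hreK.pow 2) ((hlim.mul hreL).const_mul C) hineq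
  simp only [zero_mul, mul_zero] at this
  exact absurd this (not_le.2 (by positivity))


lemma Ideal.IsPrime.exists_prime_natCast_mem {R : Type*} [CommRing R] {P : Ideal R}
    (hP : P.IsPrime) {n : ℕ} (hn : n ≠ 0) (hmem : (n : R) ∈ P) :
    ∃ p : ℕ, p.Prime ∧ (p : R) ∈ P := by
  induction n using induction_on_primes with
  | zero => exact absurd rfl hn
  | one => exact absurd (P.eq_top_of_isUnit_mem hmem (by simp)) hP.ne_top
  | prime_mul p a hp ih =>
    rw [Nat.cast_mul] at hmem
    rcases hP.mem_or_mem hmem with h | h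
    · exact ⟨p, hp, h⟩
    · exact ih (right_ne_zero_of_mul hn) h

/-- In a nontrivial Galois extension of number fields, outside any finite set of primes some prime
has a nontrivial decomposition group. -/
theorem exists_prime_smul_eq_self {K L : Type*} [Field K] [NumberField K] [Field L] [NumberField L]
    [Algebra K L] (G : Type*) [Group G] [Finite G] [Nontrivial G] [MulSemiringAction G L]
    [IsGaloisGroup G K L] (T : Finset (Ideal (𝓞 K))) (hT : ∀ q ∈ T, Prime q) :
    ∃ P : Ideal (𝓞 L), P.IsPrime ∧ Prime (P.under (𝓞 K)) ∧ P.under (𝓞 K) ∉ T ∧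
      ∃ g : G, g ≠ 1 ∧ g • P = P := by
  by_contra! H
  refine not_forall_exists_two_primes_same_norm (L := L) (Ideal.under (𝓞 K)) T hT
    fun q hq hqT => ?_
  have hqp : q.IsPrime := Ideal.isPrime_of_prime hq
  have hqm : q.IsMaximal := hqp.isMaximal hq.ne_zero
  have key : ∀ P : Ideal (𝓞 L), P.IsPrime → P.LiesOver q →
      (∀ g : G, g ≠ 1 → g • P ≠ P) ∧
      (Prime P ∧ P.under (𝓞 K) = q ∧ Ideal.absNorm P = Ideal.absNorm q) := by
    intro P hP hPq
    have hu : P.under (𝓞 K) = q := (Ideal.over_def P q).symm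
    have hfree : ∀ g : G, g ≠ 1 → g • P ≠ P := H P hP (hu.symm ▸ hq) (hu.symm ▸ hqT)
    have hP0 : P ≠ ⊥ := Ideal.ne_bot_of_liesOver_of_ne_bot hq.ne_zero P
    have hPm : P.IsMaximal := hP.isMaximal hP0
    refine ⟨hfree, Ideal.prime_of_isPrime hP0 hP, hu, ?_⟩
    have hstab : MulAction.stabilizer G P = ⊥ := by
      rw [eq_bot_iff]
      intro g hg
      by_contra hg1
      exact hfree g hg1 hg
    have hcard := Ideal.card_stabilizer_eq (G := G) q P
    rw [hstab, Subgroup.card_bot, Ideal.inertiaDegIn_eq_inertiaDeg q P G] at hcard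
    have hdeg : P.inertiaDeg (𝓞 K) = 1 := Nat.eq_one_of_mul_eq_one_left hcard.symm
    rw [Ideal.absNorm_eq_pow_inertiaDeg'_of_liesOver P q hqp hq.ne_zero,
      Ideal.inertiaDeg'_eq_inertiaDeg, hdeg, pow_one]
  obtain ⟨⟨P, hP, hPq⟩⟩ := q.nonempty_primesOver (S := 𝓞 L)
  obtain ⟨g, hg⟩ := exists_ne (1 : G)
  exact ⟨P, g • P, ((key P hP hPq).1 g hg).symm, (key P hP hPq).2,
    (key (g • P) inferInstance inferInstance).2⟩

section Local

/-- Comparable unit balls give comparable topologies. -/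
lemma tendsto_zero_of_norm_le_one_imp {L E : Type*} [Field L] [NormedField E] {φ ψ : L →+* E}
    (h : ∀ x, ‖φ x‖ ≤ 1 → ‖ψ x‖ ≤ 1) {ϖ : L} (hϖ : ψ ϖ = φ ϖ) (h0 : ϖ ≠ 0) (h1 : ‖φ ϖ‖ < 1)
    {u : ℕ → L} (hu : Tendsto (fun k => φ (u k)) atTop (𝓝 0)) :
    Tendsto (fun k => ψ (u k)) atTop (𝓝 0) := by
  have hpos : 0 < ‖φ ϖ‖ := by rw [norm_pos_iff]; exact (map_ne_zero φ).2 h0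
  rw [tendsto_zero_iff_norm_tendsto_zero] at hu ⊢
  rw [Metric.tendsto_atTop]
  intro ε hε
  obtain ⟨m, hm⟩ := exists_pow_lt_of_lt_one hε h1
  have hev := (hu.eventually_lt_const (pow_pos hpos m))
  obtain ⟨N, hN⟩ := eventually_atTop.1 hev
  refine ⟨N, fun k hk => ?_⟩
  have hle : ‖φ (u k / ϖ ^ m)‖ ≤ 1 := by
    rw [map_div₀, map_pow, norm_div, norm_pow]
    exact div_le_one_of_le₀ (hN k hk).le (by positivity)
  have := h _ hle
  rw [map_div₀, map_pow, hϖ, norm_div, norm_pow, div_le_one (by positivity)] at this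
  rw [Real.dist_eq, sub_zero, abs_of_nonneg (norm_nonneg _)]
  exact this.trans_lt hm

variable {L : Type*} [Field L] [NumberField L]

lemma norm_le_one_of_smul_eq_self {E : Type*} [NormedField E] (φ : L →+* E)
    (hint : ∀ x : 𝓞 L, ‖φ x‖ ≤ 1) {P : Ideal (𝓞 L)} (hPp : P.IsPrime) (hP0 : P ≠ ⊥)
    (hP : ∀ x : 𝓞 L, x ∈ P ↔ ‖φ x‖ < 1) {σ : Gal(L/ℚ)} (hσ : σ • P = P) {x : L}
    (hx : ‖φ x‖ ≤ 1) : ‖φ (σ x)‖ ≤ 1 := by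
  have hunit : ∀ d : 𝓞 L, d ∉ P → ‖φ d‖ = 1 := fun d hd =>
    le_antisymm (hint d) (not_lt.1 fun h => hd ((hP d).2 h))
  have hσP : ∀ d : 𝓞 L, d ∉ P → σ • d ∉ P := fun d hd h => hd <| by
    rwa [← hσ, Ideal.smul_mem_pointwise_smul_iff] at h
  have hcoe : ∀ d : 𝓞 L, ((σ • d : 𝓞 L) : L) = σ (d : L) := fun _ => rfl
  have hclaim : ∀ n d : 𝓞 L, d ∉ P → x * d = n → ‖φ (σ x)‖ ≤ 1 := by
    intro n d hd hxd
    have h1 := congrArg (fun y => ‖φ (σ y)‖) hxd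
    simp only [map_mul, norm_mul, ← hcoe, hunit _ (hσP d hd), mul_one] at h1
    rw [h1]
    exact hint _
  obtain ⟨n, d, h | h⟩ :=
    IsDedekindDomain.HeightOneSpectrum.exists_primeCompl_mul_eq_or_mul_eq
      (⟨P, hPp, hP0⟩ : IsDedekindDomain.HeightOneSpectrum (𝓞 L)) x
  · exact hclaim n d d.2 h
  · refine hclaim d n (fun hn => ?_) h
    have h1 := congrArg (fun y => ‖φ y‖) h
    have h2 : ‖φ ((d : 𝓞 L) : L)‖ = 1 := hunit _ d.2
    simp only [map_mul, norm_mul] at h1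
    have h3 := (hP n).1 hn
    have h4 : ‖φ x‖ * ‖φ (n : L)‖ < 1 :=
      (mul_le_of_le_one_left (norm_nonneg _) hx).trans_lt h3
    exact h4.ne (h1.trans h2)

variable (p : ℕ) [Fact p.Prime]

lemma PadicAlgCl.norm_le_one_of_isIntegral {x : PadicAlgCl p} (hx : IsIntegral ℤ x) : ‖x‖ ≤ 1 := by
  have h : x ∈ (Valued.v (R := PadicAlgCl p)).integer :=
    (Valuation.integer.integers (Valued.v (R := PadicAlgCl p))).mem_of_integral hx.tower_top
  exact h

/-- For every prime `P` of `L` above `p`, some embedding of `L` in the algebraic closure of `ℚ_p`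
induces `P`. -/
lemma exists_embedding_mem_iff_norm_lt_one [IsGalois ℚ L] {P : Ideal (𝓞 L)} (hP : P.IsPrime)
    (hpP : (p : 𝓞 L) ∈ P) :
    ∃ φ : L →+* PadicAlgCl p, ∀ x : 𝓞 L, x ∈ P ↔ ‖φ x‖ < 1 := by
  let φ₀ : L →ₐ[ℚ] PadicAlgCl p := IsAlgClosed.lift
  have hint : ∀ x : 𝓞 L, ‖φ₀ x‖ ≤ 1 := fun x =>
    PadicAlgCl.norm_le_one_of_isIntegral p ((RingOfIntegers.isIntegral_coe x).map φ₀)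
  have hp1 : ‖(p : PadicAlgCl p)‖ < 1 := by
    have := PadicAlgCl.norm_extends p (p : ℚ_[p])
    rw [map_natCast] at this
    rw [this]
    exact Padic.norm_p_lt_one
  let Q : Ideal (𝓞 L) :=
    { carrier := {x | ‖φ₀ x‖ < 1}
      zero_mem' := by simp
      add_mem' := by
        intro a b ha hb
        simp only [Set.mem_ofPred_eq, map_add] at *
        exact (IsUltrametricDist.norm_add_le_max _ _).trans_lt (max_lt ha hb)
      smul_mem' := by
        intro c x hx
        simp only [Set.mem_ofPred_eq, smul_eq_mul, map_mul, norm_mul] at *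
        exact (mul_le_of_le_one_left (norm_nonneg _) (hint c)).trans_lt hx }
  have hQmem : ∀ x : 𝓞 L, x ∈ Q ↔ ‖φ₀ x‖ < 1 := fun x => Iff.rfl
  have hQ : Q.IsPrime := by
    refine ⟨fun h => ?_, fun {a b} hab => ?_⟩
    · have : (1 : 𝓞 L) ∈ Q := h ▸ Submodule.mem_top
      rw [hQmem] at this
      simp at this
    · by_contra! hcon
      rw [hQmem, hQmem, not_lt, not_lt] at hcon
      rw [hQmem] at hab
      simp only [map_mul, norm_mul] at hab
      exact absurd hab (not_lt.2 (one_le_mul_of_one_le_of_one_le hcon.1 hcon.2))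
  have hpQ : (p : 𝓞 L) ∈ Q := by
    rw [hQmem]
    simpa using hp1
  have hunder : ∀ I : Ideal (𝓞 L), I.IsPrime → (p : 𝓞 L) ∈ I →
      I.under ℤ = Ideal.span {(p : ℤ)} := by
    intro I hI hpI
    have hmax : (Ideal.span {(p : ℤ)}).IsMaximal :=
      PrincipalIdealRing.isMaximal_of_irreducible
        (Nat.prime_iff_prime_int.1 Fact.out).irreducible
    refine (hmax.eq_of_le (Ideal.IsPrime.under ℤ I).ne_top ?_).symm
    rw [Ideal.span_singleton_le_iff_mem, Ideal.under_def, Ideal.mem_comap]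
    simpa using hpI
  obtain ⟨τ, hτ⟩ := Algebra.IsInvariant.exists_smul_of_under_eq ℤ (𝓞 L) Gal(L/ℚ) P Q
    ((hunder P hP hpP).trans (hunder Q hQ hpQ).symm)
  refine ⟨(φ₀ : L →+* PadicAlgCl p).comp (τ : L →+* L), fun x => ?_⟩
  have : τ • x ∈ Q ↔ x ∈ P := by rw [hτ, Ideal.smul_mem_pointwise_smul_iff]
  rw [← this, hQmem]
  rfl

/-- If `φ` is continuous with respect to precomposition by `σ`, then `σ` permutes the roots of any
polynomial over `ℚ_p` that lie in the image of `φ`. -/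
lemma aeval_apply_eq_zero_of_tendsto {E : Type*} [NormedField E] [NormedAlgebra ℚ_[p] E]
    (φ : L →+* E) (σ : Gal(L/ℚ))
    (hσ : ∀ u : ℕ → L, Tendsto (fun k => φ (u k)) atTop (𝓝 0) →
      Tendsto (fun k => φ (σ (u k))) atTop (𝓝 0))
    (g : Polynomial ℚ_[p]) {x : L} (hx : Polynomial.aeval (φ x) g = 0) :
    Polynomial.aeval (φ (σ x)) g = 0 := by
  have hdense : ∀ c : ℚ_[p], ∃ r : ℕ → ℚ, Tendsto (fun k => ((r k : ℚ) : ℚ_[p])) atTop (𝓝 c) := by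
    intro c
    have hpos : ∀ k : ℕ, (0 : ℝ) < 1 / (k + 1) := fun k => by positivity
    choose r hr using fun k : ℕ => Padic.rat_dense p c (hpos k)
    refine ⟨r, ?_⟩
    rw [tendsto_iff_norm_sub_tendsto_zero]
    refine squeeze_zero (fun _ => norm_nonneg _) (fun k => ?_)
      tendsto_one_div_add_atTop_nhds_zero_nat
    rw [norm_sub_rev]
    exact (hr k).le
  choose r hr using hdense
  let u : L → ℕ → L := fun y k =>
    ∑ i ∈ Finset.range (g.natDegree + 1), algebraMap ℚ L (r (g.coeff i) k) * y ^ i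
  have hu : ∀ y : L, Tendsto (fun k => φ (u y k)) atTop (𝓝 (Polynomial.aeval (φ y) g)) := by
    intro y
    rw [Polynomial.aeval_eq_sum_range]
    simp only [u, map_sum, map_mul, map_pow]
    refine tendsto_finsetSum _ fun i _ => ?_
    rw [Algebra.smul_def]
    refine Tendsto.mul_const _ ?_
    have h1 := ((continuous_algebraMap ℚ_[p] E).tendsto (g.coeff i)).comp (hr (g.coeff i))
    refine h1.congr fun k => ?_
    simp
  have hσu : ∀ k, σ (u x k) = u (σ x) k := by
    intro k
    simp only [u, map_sum, map_mul, map_pow, AlgEquiv.commutes]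
  have h1 := hσ (u x) (hx ▸ hu x)
  simp_rw [hσu] at h1
  exact tendsto_nhds_unique (hu (σ x)) h1

/-- If a decomposition group above `p` is transitive on the roots of `f`, then `f` is irreducible
over `ℚ_p`. -/
theorem irreducible_map_padic_of_smul_eq_self [IsGalois ℚ L] {f : Polynomial ℚ}
    (hf : Irreducible f) (hsplit : (f.map (algebraMap ℚ L)).Splits) {σ : Gal(L/ℚ)}
    (htrans : ∀ x ∈ f.rootSet L, ∀ y ∈ f.rootSet L, ∃ n : ℕ, (σ ^ n) x = y)
    {P : Ideal (𝓞 L)} (hP : P.IsPrime) (hpP : (p : 𝓞 L) ∈ P) (hσ : σ • P = P) :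
    Irreducible (f.map (algebraMap ℚ ℚ_[p])) := by
  obtain ⟨φ, hφ⟩ := exists_embedding_mem_iff_norm_lt_one p hP hpP
  have hp0 : (p : L) ≠ 0 := Nat.cast_ne_zero.2 (Fact.out : p.Prime).ne_zero
  have hP0 : P ≠ ⊥ := by
    rintro rfl
    rw [Ideal.mem_bot] at hpP
    exact (Nat.cast_ne_zero (R := 𝓞 L)).2 (Fact.out : p.Prime).ne_zero hpP
  have hint : ∀ x : 𝓞 L, ‖φ x‖ ≤ 1 := fun x =>
    PadicAlgCl.norm_le_one_of_isIntegral p ((RingOfIntegers.isIntegral_coe x).map φ.toIntAlgHom)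
  have hcont : ∀ u : ℕ → L, Tendsto (fun k => φ (u k)) atTop (𝓝 0) →
      Tendsto (fun k => φ (σ (u k))) atTop (𝓝 0) := fun u hu =>
    tendsto_zero_of_norm_le_one_imp (φ := φ) (ψ := φ.comp (σ : L →+* L))
      (fun x hx => norm_le_one_of_smul_eq_self φ hint hP hP0 hφ hσ hx) (ϖ := (p : L))
      (by simp) hp0 (by simpa using (hφ _).1 hpP) hu
  have hpow : ∀ (g : Polynomial ℚ_[p]) (x : L), Polynomial.aeval (φ x) g = 0 →
      ∀ n : ℕ, Polynomial.aeval (φ ((σ ^ n) x)) g = 0 := by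
    intro g x hx n
    induction n with
    | zero => simpa using hx
    | succ n ih =>
      rw [pow_succ']
      exact aeval_apply_eq_zero_of_tendsto p φ σ hcont g ih
  set F := f.map (algebraMap ℚ ℚ_[p]) with hF
  have hF0 : F ≠ 0 := (Polynomial.map_ne_zero_iff (algebraMap ℚ ℚ_[p]).injective).2 hf.ne_zero
  have hFdeg : F.natDegree = f.natDegree := Polynomial.natDegree_map _
  have hroot : ∀ y : PadicAlgCl p, Polynomial.aeval y F = 0 → ∃ x ∈ f.rootSet L, φ x = y := by
    intro y hy
    have h1 : (f.map (algebraMap ℚ L)).eval₂ φ y = 0 := by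
      rw [Polynomial.eval₂_map]
      rw [hF, Polynomial.aeval_def, Polynomial.eval₂_map] at hy
      convert hy using 2
      exact Subsingleton.elim _ _
    have h2 : y ∈ ((f.map (algebraMap ℚ L)).map φ).roots := by
      rw [Polynomial.mem_roots', Polynomial.IsRoot, Polynomial.eval_map]
      exact ⟨Polynomial.map_ne_zero (Polynomial.map_ne_zero hf.ne_zero), h1⟩
    rw [hsplit.roots_map, Multiset.mem_map] at h2
    obtain ⟨x, hx, rfl⟩ := h2
    refine ⟨x, ?_, rfl⟩
    rw [Polynomial.mem_rootSet']
    rw [Polynomial.mem_roots', Polynomial.IsRoot, Polynomial.eval_map] at hx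
    exact hx
  have hdiv : ∀ g : Polynomial ℚ_[p], g ∣ F → ¬ IsUnit g → f.natDegree ≤ g.natDegree := by
    classical
    intro g hg hgu
    have hg0 : g ≠ 0 := ne_zero_of_dvd_ne_zero hF0 hg
    obtain ⟨y, hy⟩ := IsAlgClosed.exists_aeval_eq_zero (PadicAlgCl p) g
      (fun h => hgu (Polynomial.isUnit_iff_degree_eq_zero.2 h))
    obtain ⟨x, hx, rfl⟩ := hroot y (Polynomial.aeval_eq_zero_of_dvd_aeval_eq_zero hg hy)
    rw [← Polynomial.card_rootSet_eq_natDegree hf.separable hsplit, ← Set.toFinset_card]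
    refine le_trans ?_ (Polynomial.card_roots' (g.map (algebraMap ℚ_[p] (PadicAlgCl p)))
      |>.trans_eq (Polynomial.natDegree_map _))
    refine le_trans ?_ (Multiset.toFinset_card_le _)
    refine Finset.card_le_card_of_injOn φ (fun z hz => ?_) φ.injective.injOn
    obtain ⟨n, rfl⟩ := htrans x hx z (Set.mem_toFinset.1 hz)
    rw [Finset.mem_coe, Multiset.mem_toFinset, Polynomial.mem_roots', Polynomial.IsRoot,
      Polynomial.eval_map]
    exact ⟨Polynomial.map_ne_zero hg0, hpow g x hy n⟩
  have hpos : 0 < f.natDegree := hf.natDegree_pos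
  refine ⟨fun h => ?_, fun g h hgh => ?_⟩
  · rw [Polynomial.natDegree_eq_zero_of_isUnit h] at hFdeg
    omega
  · by_contra! hcon
    have h1 := hdiv g ⟨h, hgh⟩ hcon.1
    have h2 := hdiv h ⟨g, by rw [hgh, mul_comm]⟩ hcon.2
    have hmul := hgh ▸ hF0
    have h3 := Polynomial.natDegree_mul (left_ne_zero_of_mul hmul) (right_ne_zero_of_mul hmul)
    rw [← hgh, hFdeg] at h3
    omega

end Local

/-- An automorphism of prime order `deg f` of a splitting field permutes the roots of `f`
cyclically. -/
lemma exists_pow_apply_eq_of_orderOf_eq_natDegree {F L : Type*} [Field F] [Field L] [Algebra F L]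
    {f : Polynomial F} [f.IsSplittingField F L] (hf : f.Separable) (hdeg : f.natDegree.Prime)
    {σ : Gal(L/F)} (hσ : orderOf σ = f.natDegree) :
    ∀ x ∈ f.rootSet L, ∀ y ∈ f.rootSet L, ∃ n : ℕ, (σ ^ n) x = y := by
  classical
  let _ : MulAction Gal(L/F) (f.rootSet L) :=
    { smul := fun τ => Set.MapsTo.restrict τ _ _ (Polynomial.rootSet_mapsTo τ.toAlgHom)
      one_smul := fun _ => rfl
      mul_smul := fun _ _ _ => rfl }
  let Ψ : Gal(L/F) →* Equiv.Perm (f.rootSet L) := MulAction.toPermHom _ _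
  have hinj : Function.Injective Ψ := fun τ τ' h => by
    refine AlgEquiv.coe_toAlgHom_injective (AlgHom.ext_of_adjoin_eq_top
      (Polynomial.IsSplittingField.adjoin_rootSet L f) fun x hx => ?_)
    exact congrArg (fun e : Equiv.Perm (f.rootSet L) => (e ⟨x, hx⟩ : L)) h
  have hcard : Fintype.card (f.rootSet L) = f.natDegree :=
    Polynomial.card_rootSet_eq_natDegree hf (Polynomial.IsSplittingField.splits L f)
  have horder : orderOf (Ψ σ) = Fintype.card (f.rootSet L) := by
    rw [orderOf_injective Ψ hinj, hcard, hσ]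
  have hcyc : (Ψ σ).IsCycle := Equiv.Perm.isCycle_of_prime_order'' (hcard ▸ hdeg) horder
  have hsupp : (Ψ σ).support = Finset.univ := by
    rw [← Finset.card_eq_iff_eq_univ, ← hcyc.orderOf, horder]
  have hmoves : ∀ x, Ψ σ x ≠ x := fun x => by
    rw [← Equiv.Perm.mem_support, hsupp]
    exact Finset.mem_univ x
  intro x hx y hy
  obtain ⟨n, hn⟩ := hcyc.exists_pow_eq (hmoves ⟨x, hx⟩) (hmoves ⟨y, hy⟩)
  refine ⟨n, ?_⟩
  rw [← map_pow] at hn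
  exact congrArg Subtype.val hn

end

/-- If `ℓ` is prime and `f ∈ ℚ[x]` has degree `ℓ` and is irreducible over `ℚ`,
then there are infinitely many primes `p` such that `f` is irreducible over `ℚ_p`. -/
theorem stmt_6 (ℓ : ℕ) (hℓ : ℓ.Prime) (f : Polynomial ℚ)
    (hdeg : f.natDegree = ℓ) (hirr : Irreducible f) :
    {p : ℕ | p.Prime ∧ ∀ [Fact p.Prime], Irreducible (f.map (algebraMap ℚ ℚ_[p]))}.Infinite := by
  classical
  intro hfin
  let L := f.SplittingField
  have : Polynomial.IsSplittingField ℚ L f := by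
    convert Polynomial.IsSplittingField.splittingField f
    exact Subsingleton.elim _ _
  have : IsGalois ℚ L := IsGalois.of_separable_splitting_field hirr.separable
  have : NumberField L := { }
  have : Fact ℓ.Prime := ⟨hℓ⟩
  obtain ⟨σ, hσ⟩ : ∃ σ : Gal(L/ℚ), orderOf σ = ℓ := by
    refine exists_prime_orderOf_dvd_card' ℓ ?_
    obtain ⟨x, hx⟩ := (Polynomial.IsSplittingField.splits L f).exists_eval_eq_zero (by
      rw [Polynomial.degree_map]
      exact (Polynomial.degree_pos_of_irreducible hirr).ne')
    rw [Polynomial.eval_map_algebraMap] at hx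
    have hdvd := minpoly.degree_dvd (Algebra.IsIntegral.isIntegral (R := ℚ) x)
    rwa [← minpoly.eq_of_irreducible hirr hx, Polynomial.natDegree_mul_C
      (inv_ne_zero (Polynomial.leadingCoeff_ne_zero.2 hirr.ne_zero)), hdeg,
      ← IsGalois.card_aut_eq_finrank] at hdvd
  let H := Subgroup.zpowers σ
  let K : IntermediateField ℚ L := FixedPoints.intermediateField H
  have hH : Nat.card H = ℓ := by rw [Nat.card_zpowers, hσ]
  have : Nontrivial H := Finite.one_lt_card_iff_nontrivial.1 (hH ▸ hℓ.one_lt)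
  set N : 𝓞 K := ((∏ p ∈ hfin.toFinset, p : ℕ) : 𝓞 K) with hN
  have hN0 : N ≠ 0 := Nat.cast_ne_zero.2 <| Finset.prod_ne_zero_iff.2 fun p hp =>
    ((Set.Finite.mem_toFinset hfin).1 hp).1.ne_zero
  obtain ⟨P, hP, hq, hqT, g, hg, hgP⟩ := exists_prime_smul_eq_self (K := K) (L := L) H
    (normalizedFactors (Ideal.span {N})).toFinset
    (fun q hq => prime_of_normalized_factor q (Multiset.mem_toFinset.1 hq))
  refine hqT (Multiset.mem_toFinset.2 ?_)
  rw [Ideal.mem_normalizedFactors_iff (by simpa using hN0)]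
  refine ⟨Ideal.isPrime_of_prime hq, ?_⟩
  rw [Ideal.span_singleton_le_iff_mem, Ideal.under_def, Ideal.mem_comap, hN, map_natCast]
  have hP0 : P ≠ ⊥ := by
    rintro rfl
    exact hq.ne_zero (Ideal.under_bot _ _)
  obtain ⟨p, hp, hpP⟩ : ∃ p : ℕ, p.Prime ∧ (p : 𝓞 L) ∈ P := by
    have hmem : ((Ideal.absNorm P : ℕ) : 𝓞 L) ∈ P := Ideal.absNorm_mem P
    have hne : Ideal.absNorm P ≠ 0 := by rwa [Ne, Ideal.absNorm_eq_zero_iff]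
    exact hP.exists_prime_natCast_mem hne hmem
  have hgo : orderOf (g : Gal(L/ℚ)) = f.natDegree := by
    rw [Subgroup.orderOf_coe, hdeg]
    exact orderOf_eq_prime (hH ▸ pow_card_eq_one') hg
  have hmem : p ∈ hfin.toFinset := by
    rw [Set.Finite.mem_toFinset]
    refine ⟨hp, ?_⟩
    intro _
    exact irreducible_map_padic_of_smul_eq_self p hirr (Polynomial.IsSplittingField.splits L f)
      (exists_pow_apply_eq_of_orderOf_eq_natDegree hirr.separable (hdeg ▸ hℓ) hgo) hP hpP hgP
  obtain ⟨c, hc⟩ := Finset.dvd_prod_of_mem (fun p : ℕ => p) hmem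
  rw [hc, Nat.cast_mul]
  exact P.mul_mem_right _ hpP
end

section
/- The polynomial x⁴ + 1 is irreducible over the field ℚ₂ of 2-adic numbers. -/
open Polynomial

/-- The polynomial `(X + 1) ^ 4 + 1` is irreducible over `ℤ₂`, being Eisenstein at `2`. -/
theorem irreducible_X_add_one_pow_four_add_one_padicInt :
    Irreducible (X ^ 4 + C 4 * X ^ 3 + C 6 * X ^ 2 + C 4 * X + C 2 : ℤ_[2][X]) := by
  have h_two : Prime (2 : ℤ_[2]) := mod_cast PadicInt.prime_p (p := 2)
  have h_prime : (Ideal.span {(2 : ℤ_[2])}).IsPrime :=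
    (Ideal.span_singleton_prime h_two.ne_zero).2 h_two
  have h_deg : (X ^ 4 + C 4 * X ^ 3 + C 6 * X ^ 2 + C 4 * X + C 2 : ℤ_[2][X]).natDegree = 4 := by
    compute_degree!
  have h_monic : (X ^ 4 + C 4 * X ^ 3 + C 6 * X ^ 2 + C 4 * X + C 2 : ℤ_[2][X]).Monic := by
    monicity!
  refine IsEisensteinAt.irreducible (𝓟 := Ideal.span {(2 : ℤ_[2])}) ⟨?_, ?_, ?_⟩ h_prime
    h_monic.isPrimitive (by rw [h_deg]; norm_num)
  · rw [h_monic.leadingCoeff]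
    exact fun h => h_prime.ne_top ((Ideal.eq_top_iff_one _).2 h)
  · intro n hn
    rw [h_deg] at hn
    rw [Ideal.mem_span_singleton]
    interval_cases n <;> simp [coeff_X, coeff_C, coeff_X_pow]
    · exact ⟨2, by norm_num⟩
    · exact ⟨3, by norm_num⟩
    · exact ⟨2, by norm_num⟩
  · rw [Ideal.span_singleton_pow, Ideal.mem_span_singleton]
    simp only [coeff_add, coeff_C_mul, coeff_X_pow, coeff_X_zero, coeff_C_zero]
    rintro ⟨c, hc⟩
    refine h_two.not_isUnit (IsUnit.of_mul_eq_one c (mul_left_cancel₀ h_two.ne_zero ?_))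
    norm_num at hc
    linear_combination -hc

/-- The polynomial `x⁴ + 1` is irreducible over the field `ℚ₂` of 2-adic numbers. -/
theorem stmt_7 : Irreducible (X ^ 4 + 1 : Polynomial ℚ_[2]) := by
  have h_monic : (X ^ 4 + C 4 * X ^ 3 + C 6 * X ^ 2 + C 4 * X + C 2 : ℤ_[2][X]).Monic := by
    monicity!
  have h := (h_monic.irreducible_iff_irreducible_map_fraction_map (K := ℚ_[2])).1
    irreducible_X_add_one_pow_four_add_one_padicInt
  rw [← MulEquiv.irreducible_iff (algEquivAevalXAddC (1 : ℚ_[2]))]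
  convert h using 1
  simp only [algEquivAevalXAddC_apply, map_add, map_pow, map_one, aeval_X, Polynomial.map_add,
    Polynomial.map_mul, Polynomial.map_pow, Polynomial.map_X, map_ofNat,
    Polynomial.map_ofNat]
  ring
end

section
/- Let f(x) ∈ ℚ[x] be monic and irreducible over ℚ with splitting field K over ℚ, let G = Gal(K/ℚ), let α ∈ K be a root of f, and let H = {σ ∈ G : σ(α) = α} be the stabilizer of α. Let p be a prime, let 𝔓 be a maximal ideal of the ring of integers O_K of K lying over p, and let D = {σ ∈ G : σ(𝔓) = 𝔓} be the decomposition group of 𝔓. Then f is irreducible over ℚ_p if and only if the set product D·H = {dh : d ∈ D, h ∈ H} equals G. -/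
open Polynomial NumberField

/-- Elements integral over `ℤ` have norm at most one in an ultrametric normed field. -/
theorem norm_le_one_of_isIntegral_int {L : Type*} [NormedField L] [IsUltrametricDist L] {x : L}
    (hx : IsIntegral ℤ x) : ‖x‖ ≤ 1 := by
  have hx' : IsIntegral (NormedField.valuation (K := L)).integer x := hx.tower_top
  exact (Valuation.integer.integers (NormedField.valuation (K := L))).mem_of_integral hx'

theorem norm_map_ringOfIntegers_le_one {K L : Type*} [Field K] [NumberField K] [NormedField L]
    [IsUltrametricDist L] [Algebra ℚ L] (φ : K →ₐ[ℚ] L) (x : 𝓞 K) : ‖φ x‖ ≤ 1 :=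
  norm_le_one_of_isIntegral_int ((RingOfIntegers.isIntegral_coe x).map (φ.restrictScalars ℤ))

/-- Every maximal ideal over `p` is cut out by the norm along some embedding of `K`. -/
theorem exists_algHom_mem_iff {K L : Type*} [Field K] [NumberField K] [IsGalois ℚ K]
    [NormedField L] [IsUltrametricDist L] [Algebra ℚ L] [IsAlgClosed L]
    (p : ℕ) [Fact p.Prime] (hp : ‖(p : L)‖ < 1)
    (P : Ideal (𝓞 K)) (hP : P.IsMaximal)
    (hPp : P.comap (algebraMap ℤ (𝓞 K)) = Ideal.span {(p : ℤ)}) :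
    ∃ φ : K →ₐ[ℚ] L, ∀ x : 𝓞 K, x ∈ P ↔ ‖φ x‖ < 1 := by
  let φ : K →ₐ[ℚ] L := IsAlgClosed.lift
  have hφ := norm_map_ringOfIntegers_le_one φ
  let Q : Ideal (𝓞 K) :=
    { carrier := {x | ‖φ x‖ < 1}
      zero_mem' := by simp
      add_mem' := fun {a b} ha hb ↦ by
        simp only [Set.mem_ofPred_eq, map_add] at *
        exact (IsUltrametricDist.norm_add_le_max _ _).trans_lt (max_lt ha hb)
      smul_mem' := fun c x hx ↦ by
        simp only [Set.mem_ofPred_eq, smul_eq_mul, map_mul, norm_mul] at *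
        exact mul_lt_one_of_nonneg_of_lt_one_right (hφ c) (norm_nonneg _) hx }
  have hQ (x : 𝓞 K) : x ∈ Q ↔ ‖φ x‖ < 1 := Iff.rfl
  have hQprime : Q.IsPrime := by
    refine ⟨(Ideal.ne_top_iff_one _).2 (by simp [hQ]), fun {x y} hxy ↦ ?_⟩
    by_contra! h
    simp only [hQ, not_lt, map_mul, norm_mul] at h hxy
    nlinarith
  have hpmax : (Ideal.span {(p : ℤ)}).IsMaximal :=
    PrincipalIdealRing.isMaximal_of_irreducible (Nat.prime_iff_prime_int.1 Fact.out).irreducible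
  have hQp : Q.comap (algebraMap ℤ (𝓞 K)) = Ideal.span {(p : ℤ)} :=
    (hpmax.eq_of_le (hQprime.comap _).ne_top (by
      rw [Ideal.span_singleton_le_iff_mem, Ideal.mem_comap, hQ]; simpa using hp)).symm
  obtain ⟨σ, hσ⟩ := Algebra.IsInvariant.exists_smul_of_under_eq ℤ (𝓞 K) Gal(K/ℚ) P Q
    (hPp.trans hQp.symm)
  refine ⟨φ.comp σ.toAlgHom, fun x ↦ ?_⟩
  rw [← Ideal.smul_mem_pointwise_smul_iff (a := σ), ← hσ, hQ]
  rfl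

/-- An automorphism of `K` preserving `P` preserves the open unit ball at `P`. -/
theorem norm_map_lt_one {K L : Type*} [Field K] [NumberField K] [NormedField L]
    [IsUltrametricDist L] [Algebra ℚ L] {P : Ideal (𝓞 K)} (hP : P.IsMaximal) (hP0 : P ≠ ⊥)
    {φ : K →ₐ[ℚ] L} (hφ : ∀ x : 𝓞 K, x ∈ P ↔ ‖φ x‖ < 1) {σ : Gal(K/ℚ)}
    (hσ : σ '' (algebraMap (𝓞 K) K '' (P : Set (𝓞 K))) = algebraMap (𝓞 K) K '' (P : Set (𝓞 K)))
    {y : K} (hy : ‖φ y‖ < 1) : ‖φ (σ y)‖ < 1 := by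
  have hle := norm_map_ringOfIntegers_le_one φ
  have hnotMem (d : 𝓞 K) (hd : d ∉ P) : ‖φ d‖ = 1 :=
    le_antisymm (hle d) (not_lt.1 fun h ↦ hd ((hφ d).2 h))
  have hmem (d : 𝓞 K) : d ∈ P ↔ σ • d ∈ P := by
    have h1 (x : 𝓞 K) : (x : K) ∈ algebraMap (𝓞 K) K '' (P : Set (𝓞 K)) ↔ x ∈ P :=
      (RingOfIntegers.coe_injective.mem_set_image)
    rw [← h1, ← h1 (σ • d)]
    nth_rw 2 [← hσ]
    exact (σ.injective.mem_set_image).symm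
  obtain ⟨n, ⟨d, hd⟩, h⟩ :=
    IsDedekindDomain.HeightOneSpectrum.exists_primeCompl_mul_eq_or_mul_eq ⟨P, hP.isPrime, hP0⟩ y
  have hd : d ∉ P := hd
  rcases h with h | h
  · have hn : n ∈ P := by
      rw [hφ, show (n : K) = y * d from h.symm, map_mul, norm_mul]
      simpa [hnotMem d hd] using hy
    have h' : σ y * (σ • d : 𝓞 K) = (σ • n : 𝓞 K) := by
      rw [show ((σ • d : 𝓞 K) : K) = σ d from rfl, ← map_mul]
      exact congrArg σ h
    have h2 := (hφ _).1 ((hmem n).1 hn)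
    rwa [← h', map_mul, norm_mul, hnotMem _ (mt (hmem d).2 hd), mul_one] at h2
  · have h2 := hnotMem d hd
    rw [show (d : K) = y * n from h.symm, map_mul, norm_mul] at h2
    have := hle n
    nlinarith [norm_nonneg (φ y), norm_nonneg (φ n)]

/-- Automorphisms of an extension of `K` restrict along an embedding of a Galois extension `K`. -/
theorem exists_restrict {K F Ω : Type*} [Field K] [NumberField K] [IsGalois ℚ K] [Field F]
    [Field Ω] [CharZero Ω] [Algebra F Ω] (φ : K →ₐ[ℚ] Ω) :
    ∃ res : Gal(Ω/F) →* Gal(K/ℚ), ∀ τ x, φ (res τ x) = τ (φ x) := by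
  let : Algebra K Ω := φ.toAlgebra
  exact ⟨(AlgEquiv.restrictNormalHom K).comp (MulSemiringAction.toAlgAut Gal(Ω/F) ℚ Ω),
    fun τ x ↦ AlgEquiv.restrictNormal_commutes (MulSemiringAction.toAlgAut Gal(Ω/F) ℚ Ω τ) K x⟩

open PadicAlgCl in
/-- The decomposition group is the set of restrictions of automorphisms of `PadicAlgCl p`. -/
theorem image_eq_iff_exists_algEquiv {K : Type*} [Field K] [NumberField K] [IsGalois ℚ K]
    {p : ℕ} [Fact p.Prime] {P : Ideal (𝓞 K)} (hP : P.IsMaximal) (hP0 : P ≠ ⊥)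
    {φ : K →ₐ[ℚ] PadicAlgCl p} (hφ : ∀ x : 𝓞 K, x ∈ P ↔ ‖φ x‖ < 1) (σ : Gal(K/ℚ)) :
    σ '' (algebraMap (𝓞 K) K '' (P : Set (𝓞 K))) = algebraMap (𝓞 K) K '' (P : Set (𝓞 K)) ↔
      ∃ τ : Gal(PadicAlgCl p/ℚ_[p]), ∀ x, φ (σ x) = τ (φ x) := by
  constructor
  · intro hσ
    obtain ⟨res, hres⟩ := exists_restrict (F := ℚ_[p]) φ
    suffices σ ∈ res.range by
      obtain ⟨τ, rfl⟩ := this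
      exact ⟨τ, hres τ⟩
    rw [← IntermediateField.fixingSubgroup_fixedField res.range,
      IntermediateField.mem_fixingSubgroup_iff]
    intro e he
    rw [IntermediateField.mem_fixedField_iff] at he
    obtain ⟨z, hz⟩ : φ e ∈ Set.range (algebraMap ℚ_[p] (PadicAlgCl p)) := by
      refine (InfiniteGalois.mem_range_algebraMap_iff_fixed (φ e)).2 fun τ ↦ ?_
      rw [← hres, he _ ⟨τ, rfl⟩]
    apply φ.injective
    rw [← sub_eq_zero, ← norm_eq_zero]
    refine le_antisymm (le_of_forall_pos_le_add fun ε hε ↦ ?_) (norm_nonneg _)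
    obtain ⟨k, hk⟩ := exists_pow_lt_of_lt_one hε (Padic.norm_p_lt_one (p := p))
    have hp0 : (0 : ℝ) < ‖(p : ℚ_[p])‖ := by simpa using (Fact.out : p.Prime).pos
    obtain ⟨q, hq⟩ := Padic.rat_dense p z (pow_pos hp0 k)
    have hnp : ‖φ (p : K)‖ = ‖(p : ℚ_[p])‖ := by
      simpa using norm_algebraMap' (PadicAlgCl p) (p : ℚ_[p])
    have h1 : ‖φ (e - (q : K))‖ < ‖(p : ℚ_[p])‖ ^ k := by
      rwa [map_sub, ← hz, map_ratCast, ← map_ratCast (algebraMap ℚ_[p] (PadicAlgCl p)), ← map_sub,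
        norm_algebraMap']
    have h2 : ‖φ (σ (e - (q : K)))‖ < ‖(p : ℚ_[p])‖ ^ k := by
      have := norm_map_lt_one hP hP0 hφ hσ (y := (e - (q : K)) / (p : K) ^ k) (by
        rwa [map_div₀, map_pow, norm_div, norm_pow, hnp, div_lt_one (pow_pos hp0 k)])
      rwa [map_div₀, map_div₀, map_pow, map_pow, map_natCast, norm_div, norm_pow, hnp,
        div_lt_one (pow_pos hp0 k)] at this
    have h3 : φ (σ e) - φ e = φ (σ (e - (q : K))) - φ (e - (q : K)) := by simp
    rw [zero_add]
    rw [← norm_neg (φ (e - (q : K)))] at h1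
    exact (congrArg norm (h3.trans (sub_eq_add_neg _ _))).trans_le <|
      (IsUltrametricDist.norm_add_le_max _ _).trans ((max_lt h2 h1).trans hk).le
  · rintro ⟨τ, hτ⟩
    have hnorm (x : K) : ‖φ (σ x)‖ = ‖φ x‖ := by
      rw [hτ, ← spectralNorm_eq, ← spectralNorm_eq, ← spectralNorm_eq_of_equiv]
    ext y
    constructor
    · rintro ⟨_, ⟨x, hx, rfl⟩, rfl⟩
      refine ⟨σ • x, ?_, rfl⟩
      rw [SetLike.mem_coe, hφ] at hx ⊢
      exact (hnorm x).trans_lt hx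
    · rintro ⟨x, hx, rfl⟩
      refine ⟨σ.symm x, ⟨σ⁻¹ • x, ?_, rfl⟩, σ.apply_symm_apply _⟩
      rw [SetLike.mem_coe, hφ] at hx ⊢
      rw [← hnorm]
      exact (congrArg (fun z ↦ ‖φ z‖) (σ.apply_symm_apply (x : K))).trans_lt hx

/-- A separable polynomial over `F` is irreducible if and only if the automorphisms of an
algebraic closure act transitively on its roots. -/
theorem Polynomial.Separable.irreducible_iff_forall_exists_algEquiv {F Ω : Type*} [Field F] [Field Ω]
    [Algebra F Ω] [IsAlgClosed Ω] [Normal F Ω] {g : F[X]} (hg : g.Separable) {a : Ω}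
    (ha : aeval a g = 0) :
    Irreducible g ↔ ∀ b : Ω, aeval b g = 0 → ∃ τ : Gal(Ω/F), τ a = b := by
  have hint : IsIntegral F a := Normal.isIntegral ‹_› a
  constructor
  · intro h b hb
    rw [← isConjRoot_iff_exists_algEquiv, isConjRoot_def,
      ← minpoly.eq_of_irreducible h ha, ← minpoly.eq_of_irreducible h hb]
  · intro h
    refine ((associated_of_dvd_dvd (minpoly.dvd F a ha) ?_).irreducible_iff).1
      (minpoly.irreducible hint)
    rw [← map_dvd_map' (algebraMap F Ω), IsAlgClosed.dvd_iff_roots_le_roots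
      (map_ne_zero hg.ne_zero) (map_ne_zero (minpoly.ne_zero hint)),
      Multiset.le_iff_subset (nodup_roots hg.map)]
    intro b hb
    rw [mem_roots_map hg.ne_zero, ← aeval_def] at hb
    obtain ⟨τ, rfl⟩ := h b hb
    rw [mem_roots_map (minpoly.ne_zero hint), ← aeval_def, aeval_algHom_apply τ, minpoly.aeval,
      map_zero]

open Pointwise

/-- Let `f ∈ ℚ[x]` be monic irreducible with splitting field `K`, `α ∈ K` a root of `f`,
`H` the stabilizer of `α` in `G = Gal(K/ℚ)`, `p` a prime, `𝔓` a maximal ideal of `O_K`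
over `p`, and `D` the decomposition group of `𝔓`.  Then `f` is irreducible over `ℚ_p`
iff the set product `D·H` equals `G`. -/
theorem stmt_8 (f : Polynomial ℚ) (hf : f.Monic) (hirr : Irreducible f)
    (K : Type*) [Field K] [Algebra ℚ K] [FiniteDimensional ℚ K]
    [Polynomial.IsSplittingField ℚ K f]
    (α : K) (hα : Polynomial.aeval α f = 0)
    (p : ℕ) [Fact p.Prime]
    (𝔓 : Ideal (NumberField.RingOfIntegers K)) (h𝔓 : 𝔓.IsMaximal)
    (h𝔓p : Ideal.comap (algebraMap ℤ (NumberField.RingOfIntegers K)) 𝔓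
      = Ideal.span {(p : ℤ)}) :
    Irreducible (f.map (algebraMap ℚ ℚ_[p])) ↔
      {σ : K ≃ₐ[ℚ] K |
          σ '' (algebraMap (NumberField.RingOfIntegers K) K ''
              (𝔓 : Set (NumberField.RingOfIntegers K)))
            = algebraMap (NumberField.RingOfIntegers K) K ''
              (𝔓 : Set (NumberField.RingOfIntegers K))} *
        {σ : K ≃ₐ[ℚ] K | σ α = α} = (Set.univ : Set (K ≃ₐ[ℚ] K)) := by
  have : CharZero K := algebraRat.charZero K
  obtain rfl := Subsingleton.elim ‹Algebra ℚ K› DivisionRing.toRatAlgebra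
  have : NumberField K := ⟨⟩
  have : IsGalois ℚ K := .of_separable_splitting_field (p := f) hirr.separable
  have hp0 : p ≠ 0 := (Fact.out : p.Prime).ne_zero
  have hP0 : 𝔓 ≠ ⊥ := by
    rintro rfl
    have : (p : ℤ) ∈ Ideal.span {(p : ℤ)} := Ideal.mem_span_singleton_self _
    rw [← h𝔓p] at this
    simp [hp0] at this
  have hp : ‖(p : PadicAlgCl p)‖ < 1 := by
    rw [← map_natCast (algebraMap ℚ_[p] (PadicAlgCl p)), norm_algebraMap']
    exact Padic.norm_p_lt_one
  obtain ⟨φ, hφ⟩ := exists_algHom_mem_iff (L := PadicAlgCl p) p hp 𝔓 h𝔓 h𝔓p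
  have haeval (b : PadicAlgCl p) :
      Polynomial.aeval b (f.map (algebraMap ℚ ℚ_[p])) = Polynomial.aeval b f :=
    Polynomial.aeval_map_algebraMap _ b f
  have hroot (x : K) (hx : Polynomial.aeval x f = 0) :
      Polynomial.aeval (φ x) (f.map (algebraMap ℚ ℚ_[p])) = 0 := by
    rw [haeval, Polynomial.aeval_algHom_apply, hx, map_zero]
  rw [hirr.separable.map.irreducible_iff_forall_exists_algEquiv (hroot α hα)]
  simp only [image_eq_iff_exists_algEquiv h𝔓 hP0 hφ, Set.eq_univ_iff_forall, Set.mem_mul]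
  constructor
  · intro h g
    obtain ⟨τ, hτ⟩ := h (φ (g α)) (hroot _ (by rw [Polynomial.aeval_algHom_apply g, hα, map_zero]))
    obtain ⟨res, hr⟩ := exists_restrict (F := ℚ_[p]) φ
    refine ⟨res τ, ⟨τ, hr τ⟩, (res τ)⁻¹ * g, ?_, by group⟩
    exact (AlgEquiv.symm_apply_eq _).2 (φ.injective (hτ.symm.trans (hr τ α).symm))
  · intro h b hb
    have hb' : b ∈ f.rootSet (PadicAlgCl p) :=
      Polynomial.mem_rootSet.2 ⟨hf.ne_zero, (haeval b).symm.trans hb⟩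
    rw [← (Polynomial.IsSplittingField.splits K f).image_rootSet φ] at hb'
    obtain ⟨x, hx, rfl⟩ := hb'
    obtain ⟨g, rfl⟩ : ∃ g : K ≃ₐ[ℚ] K, g α = x := by
      rw [← isConjRoot_iff_exists_algEquiv, isConjRoot_def,
        ← minpoly.eq_of_irreducible hirr hα,
        ← minpoly.eq_of_irreducible hirr (Polynomial.mem_rootSet.1 hx).2]
    obtain ⟨d, ⟨τ, hτ⟩, r, hr, rfl⟩ := h g
    have hr : r α = α := hr
    exact ⟨τ, by rw [AlgEquiv.mul_apply, hr, hτ]⟩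
end

section
/- Let K/ℚ be a finite Galois extension with G = Gal(K/ℚ), let H be a subgroup of G of index n whose conjugates intersect trivially, let θ be a primitive element of the fixed field K^H (so K^H = ℚ(θ)), and let f ∈ ℚ[x] be the minimal polynomial of θ over ℚ (of degree n). Suppose that for every prime p and every maximal ideal 𝔓 of the ring of integers O_K of K lying over p, the decomposition group D(𝔓) = {σ ∈ G : σ(𝔓) = 𝔓} satisfies D(𝔓)·H ≠ G (set product). Then f is reducible over ℚ_p for every prime p. -/
open Pointwise

open NumberField Polynomial

section DecompositionIdeal

variable {K : Type*} [Field K] (p : ℕ) [Fact p.Prime]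

theorem PadicAlgCl.valuation_le_one_of_isIntegral {x : PadicAlgCl p} (hx : IsIntegral ℤ x) :
    Valued.v x ≤ 1 :=
  (Valuation.integer.integers (Valued.v (R := PadicAlgCl p))).mem_of_integral
    (hx.tower_top (A := (Valued.v (R := PadicAlgCl p)).integer))

/-- The map induced by an embedding `K → PadicAlgCl p` from the ring of integers of `K` to the
valuation ring of `PadicAlgCl p`. -/
noncomputable def ringOfIntegersToPadicIntegers (i : K →+* PadicAlgCl p) :
    𝓞 K →+* (Valued.v (R := PadicAlgCl p)).valuationSubring :=
  (i.comp (algebraMap (𝓞 K) K)).codRestrict _ fun x =>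
    PadicAlgCl.valuation_le_one_of_isIntegral p
      ((RingOfIntegers.isIntegral_coe x).map i.toIntAlgHom)

/-- The prime ideal of the ring of integers of `K` induced by an embedding
`K → PadicAlgCl p`. -/
noncomputable def inducedPrime (i : K →+* PadicAlgCl p) : Ideal (𝓞 K) :=
  (IsLocalRing.maximalIdeal _).comap (ringOfIntegersToPadicIntegers p i)

theorem mem_inducedPrime {i : K →+* PadicAlgCl p} {x : 𝓞 K} :
    x ∈ inducedPrime p i ↔ ‖i x‖ < 1 :=
  (Valuation.mem_maximalIdeal_iff _ (Valued.v (R := PadicAlgCl p))).trans Iff.rfl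

instance (i : K →+* PadicAlgCl p) : (inducedPrime p i).IsPrime :=
  Ideal.comap_isPrime _ _

theorem natCast_mem_inducedPrime (i : K →+* PadicAlgCl p) : (p : 𝓞 K) ∈ inducedPrime p i := by
  have h : ‖(p : PadicAlgCl p)‖ < 1 := by
    rw [← map_natCast (algebraMap ℚ_[p] (PadicAlgCl p)), norm_algebraMap']
    exact Padic.norm_p_lt_one
  rw [mem_inducedPrime]
  simpa using h

theorem inducedPrime_isMaximal [NumberField K] (i : K →+* PadicAlgCl p) :
    (inducedPrime p i).IsMaximal := by
  refine Ideal.IsPrime.isMaximal inferInstance fun h => ?_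
  have := natCast_mem_inducedPrime p i
  rw [h, Ideal.mem_bot] at this
  exact (Fact.out : p.Prime).ne_zero (by exact_mod_cast this)

theorem comap_inducedPrime (i : K →+* PadicAlgCl p) :
    (inducedPrime p i).comap (algebraMap ℤ (𝓞 K)) = Ideal.span {(p : ℤ)} := by
  have hmax : (Ideal.span {(p : ℤ)}).IsMaximal :=
    PrincipalIdealRing.isMaximal_of_irreducible
      (Nat.prime_iff_prime_int.mp Fact.out).irreducible
  refine (hmax.eq_of_le (Ideal.IsPrime.ne_top inferInstance) ?_).symm
  rw [Ideal.span_singleton_le_iff_mem, Ideal.mem_comap]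
  simpa using natCast_mem_inducedPrime p i

theorem image_inducedPrime_eq [Algebra ℚ K] (i : K →+* PadicAlgCl p) (d : K ≃ₐ[ℚ] K)
    (hd : ∀ x, ‖i (d x)‖ = ‖i x‖) :
    d '' (algebraMap (𝓞 K) K '' (inducedPrime p i : Set (𝓞 K))) =
      algebraMap (𝓞 K) K '' (inducedPrime p i : Set (𝓞 K)) := by
  have key : ∀ e : K ≃ₐ[ℚ] K, (∀ x, ‖i (e x)‖ = ‖i x‖) → ∀ x ∈ inducedPrime p i,
      e (algebraMap (𝓞 K) K x) ∈ algebraMap (𝓞 K) K '' (inducedPrime p i : Set (𝓞 K)) := by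
    intro e he x hx
    refine ⟨⟨e x, (RingOfIntegers.isIntegral_coe x).map (e : K →+* K).toIntAlgHom⟩, ?_, rfl⟩
    exact (mem_inducedPrime p).mpr ((he x).trans_lt ((mem_inducedPrime p).mp hx))
  apply Set.Subset.antisymm
  · rintro _ ⟨_, ⟨x, hx, rfl⟩, rfl⟩
    exact key d hd x hx
  · rintro _ ⟨x, hx, rfl⟩
    refine ⟨d.symm x, key d.symm (fun y => ?_) x hx, d.apply_symm_apply _⟩
    rw [← hd, d.apply_symm_apply]

/-- If `minpoly ℚ θ` stays irreducible over `ℚ_[p]`, then each conjugate of `θ` is reached by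
an automorphism that is isometric for the norm induced by a given embedding of `K`. -/
theorem exists_isometric_algEquiv_of_irreducible [Algebra ℚ K] [IsGalois ℚ K]
    (i : K →+* PadicAlgCl p) {θ : K}
    (hirr : Irreducible ((minpoly ℚ θ).map (algebraMap ℚ ℚ_[p]))) (σ : K ≃ₐ[ℚ] K) :
    ∃ d : K ≃ₐ[ℚ] K, d θ = σ θ ∧ ∀ x, ‖i (d x)‖ = ‖i x‖ := by
  let _ : Algebra K (PadicAlgCl p) := i.toAlgebra
  have hint : IsIntegral ℚ θ := Algebra.IsIntegral.isIntegral θ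
  have hroot : ∀ y : K, aeval y (minpoly ℚ θ) = 0 →
      aeval (i y) ((minpoly ℚ θ).map (algebraMap ℚ ℚ_[p])) = 0 := by
    intro y hy
    rw [aeval_map_algebraMap]
    exact (aeval_algebraMap_apply (PadicAlgCl p) y (minpoly ℚ θ)).trans (by rw [hy, map_zero])
  have hmin := minpoly.eq_of_irreducible_of_monic hirr (hroot θ (minpoly.aeval _ _))
    ((minpoly.monic hint).map _)
  obtain ⟨τ, hτ⟩ : ∃ τ : PadicAlgCl p ≃ₐ[ℚ_[p]] PadicAlgCl p, τ (i θ) = i (σ θ) := by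
    refine minpoly.exists_algEquiv_of_root' (Algebra.IsAlgebraic.isAlgebraic _) ?_
    rw [← hmin]
    refine hroot _ ?_
    rw [← minpoly.algEquiv_eq σ θ, minpoly.aeval]
  have hcomm : ∀ x, i ((τ.restrictScalars ℚ).restrictNormal K x) = τ (i x) :=
    (τ.restrictScalars ℚ).restrictNormal_commutes K
  refine ⟨(τ.restrictScalars ℚ).restrictNormal K, i.injective ((hcomm θ).trans hτ), fun x => ?_⟩
  rw [hcomm]
  exact (spectralNorm_eq_of_equiv τ (i x)).symm

end DecompositionIdeal

/-- Let `K/ℚ` be finite Galois with group `G`, `H ≤ G` of index `n` with trivial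
normal core, `θ` a primitive element of the fixed field of `H`, and `f` the minimal
polynomial of `θ` over `ℚ` (of degree `n`).  If for every prime `p` and every maximal
ideal `𝔓` of `O_K` over `p` the decomposition group `D(𝔓)` satisfies `D(𝔓)·H ≠ G`,
then `f` is reducible over `ℚ_p` for every prime `p`. -/
theorem stmt_9 (K : Type*) [Field K] [Algebra ℚ K] [FiniteDimensional ℚ K]
    [IsGalois ℚ K]
    (n : ℕ) (H : Subgroup (K ≃ₐ[ℚ] K)) (hidx : H.index = n)
    (hcore : H.normalCore = ⊥)
    (θ : K) (hθ : IntermediateField.fixedField H = IntermediateField.adjoin ℚ {θ})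
    (hdeg : (minpoly ℚ θ).natDegree = n)
    (hD : ∀ (p : ℕ), p.Prime →
      ∀ 𝔓 : Ideal (NumberField.RingOfIntegers K), 𝔓.IsMaximal →
        Ideal.comap (algebraMap ℤ (NumberField.RingOfIntegers K)) 𝔓
          = Ideal.span {(p : ℤ)} →
        {σ : K ≃ₐ[ℚ] K |
            σ '' (algebraMap (NumberField.RingOfIntegers K) K ''
                (𝔓 : Set (NumberField.RingOfIntegers K)))
              = algebraMap (NumberField.RingOfIntegers K) K ''
                (𝔓 : Set (NumberField.RingOfIntegers K))} * (H : Set (K ≃ₐ[ℚ] K))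
          ≠ (Set.univ : Set (K ≃ₐ[ℚ] K))) :
    ∀ (p : ℕ) [Fact p.Prime],
      ¬ Irreducible ((minpoly ℚ θ).map (algebraMap ℚ ℚ_[p])) := by
  intro p _ hirr
  have := algebraRat.charZero K
  have : NumberField K :=
    { to_charZero := inferInstance
      to_finiteDimensional := by
        rwa [Subsingleton.elim (DivisionRing.toRatAlgebra : Algebra ℚ K) ‹Algebra ℚ K›] }
  let i : K →+* PadicAlgCl p := (IsAlgClosed.lift : K →ₐ[ℚ] PadicAlgCl p)
  refine hD p Fact.out (inducedPrime p i) (inducedPrime_isMaximal p i) (comap_inducedPrime p i)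
    (Set.eq_univ_of_forall fun σ => ?_)
  obtain ⟨d, hdθ, hd⟩ := exists_isometric_algEquiv_of_irreducible p i hirr σ
  refine Set.mem_mul.mpr ⟨d, image_inducedPrime_eq p i d hd, d⁻¹ * σ, ?_, by group⟩
  rw [← IntermediateField.fixingSubgroup_fixedField H, hθ, SetLike.mem_coe,
    IntermediateField.mem_fixingSubgroup_iff]
  refine (IntermediateField.forall_mem_adjoin_smul_eq_self_iff ℚ (d⁻¹ * σ)).mpr ?_
  rintro _ rfl
  rw [mul_smul, AlgEquiv.smul_def, AlgEquiv.smul_def, ← hdθ]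
  exact d.symm_apply_apply _
end

section
/- Let q be a prime and m > 1 an integer coprime to q. Let V be a finite abelian group in which every element has order dividing q, let C be a cyclic group of order m, and let φ : C → Aut(V) be an injective homomorphism such that the only element of V fixed by φ(c) for all c ∈ C is the identity. Then the semidirect product G = V ⋊_φ C contains no element of order q·m. -/
/-- A commuting pair `g`, `inl v` in `V ⋊[φ] C` with `V` abelian: `g.right` fixes `v`. -/
theorem SemidirectProduct.apply_right_eq_of_commute_inl {V C : Type*} [CommGroup V] [Group C]
    {φ : C →* MulAut V} {g : V ⋊[φ] C} {v : V} (h : Commute g (inl v)) :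
    φ g.right v = v := by
  have h' := congrArg SemidirectProduct.left h.eq
  simp only [mul_left, left_inl, right_inl, map_one, MulAut.one_apply] at h'
  rw [mul_comm v] at h'
  exact mul_left_cancel h'

/-- An element of `V ⋊[φ] C` with trivial `C`-component comes from `V`. -/
theorem SemidirectProduct.exists_inl_eq_of_right_eq_one {V C : Type*} [Group V] [Group C]
    {φ : C →* MulAut V} {g : V ⋊[φ] C} (h : g.right = 1) : ∃ v : V, inl v = g :=
  ⟨g.left, SemidirectProduct.ext rfl h.symm⟩

/-- Let `q` be a prime and `m > 1` coprime to `q`.  Let `V` be a finite abelian group of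
exponent dividing `q`, `C` a cyclic group of order `m`, and `φ : C → Aut(V)` injective such
that only the identity of `V` is fixed by all of `C`.  Then `V ⋊_φ C` has no element of
order `q·m`. -/
theorem stmt_11 (q : ℕ) (hq : q.Prime) (m : ℕ) (hm : 1 < m) (hcop : Nat.Coprime m q)
    (V : Type*) [CommGroup V] [Finite V] (hV : ∀ v : V, v ^ q = 1)
    (C : Type*) [Group C] [IsCyclic C] (hC : Nat.card C = m)
    (φ : C →* MulAut V) (hinj : Function.Injective φ)
    (hfix : ∀ v : V, (∀ c : C, φ c v = v) → v = 1) :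
    ∀ g : V ⋊[φ] C, orderOf g ≠ q * m := by
  intro g hg
  have hpow (n : ℕ) (hn : g.right ^ n = 1) : ∃ v : V, SemidirectProduct.inl v = g ^ n :=
    SemidirectProduct.exists_inl_eq_of_right_eq_one
      ((map_pow SemidirectProduct.rightHom g n).trans hn)
  have hdvd : m ∣ orderOf g.right := by
    obtain ⟨v, hv⟩ := hpow _ (pow_orderOf_eq_one g.right)
    have hone : g ^ (orderOf g.right * q) = 1 := by
      rw [pow_mul, ← hv, ← map_pow, hV, map_one]
    have := orderOf_dvd_of_pow_eq_one hone
    rw [hg, mul_comm q m] at this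
    exact Nat.dvd_of_mul_dvd_mul_right hq.pos this
  have hfin : Finite C := Nat.finite_of_card_ne_zero (by omega)
  have htop : Subgroup.zpowers g.right = ⊤ := by
    rw [← Subgroup.card_eq_iff_eq_top, Nat.card_zpowers, hC]
    exact Nat.dvd_antisymm (hC ▸ orderOf_dvd_natCard g.right) hdvd
  obtain ⟨v, hv⟩ := hpow m (hC ▸ pow_card_eq_one')
  have hgv : φ g.right v = v :=
    SemidirectProduct.apply_right_eq_of_commute_inl (hv ▸ Commute.self_pow g m)
  have hle : Subgroup.zpowers g.right ≤ (MulAction.stabilizer (MulAut V) v).comap φ :=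
    Subgroup.zpowers_le.mpr hgv
  have hv1 : v = 1 := hfix v fun c => hle (htop ▸ Subgroup.mem_top c)
  rw [hv1, map_one] at hv
  have hgm := Nat.le_of_dvd (by omega) (orderOf_dvd_of_pow_eq_one hv.symm)
  rw [hg] at hgm
  nlinarith [hq.two_le]
end

section
/- Let q be a prime and m > 1 an integer coprime to q, let t be the multiplicative order of q modulo m, and assume t > 1. Let V be the additive group of the finite field 𝔽_{q^t}, let ζ ∈ 𝔽_{q^t}^× be an element of multiplicative order m, and let the cyclic group C of order m act on V with a generator acting as multiplication by ζ; set G = V ⋊ C. Let H be an 𝔽_q-subspace of V of index q (a hyperplane), viewed as a subgroup of G. Then for every subgroup M of G that possesses a cyclic normal subgroup N with M/N cyclic (i.e., every metacyclic subgroup M), the set product M·H = {mh : m ∈ M, h ∈ H} is not equal to G. -/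
open Pointwise

open scoped IntermediateField in
/-- If `q` has order `t` modulo the order of `ζ`, then `ζ` generates a field of size `q ^ t`
over its prime field. -/
theorem adjoin_eq_top_of_card_eq_pow_orderOf {q : ℕ} [Fact q.Prime] {F : Type*} [Field F]
    [Finite F] [Algebra (ZMod q) F] (ζ : Fˣ)
    (hcard : Nat.card F = q ^ orderOf (q : ZMod (orderOf ζ))) :
    Algebra.adjoin (ZMod q) {(ζ : F)} = ⊤ := by
  have hint : IsAlgebraic (ZMod q) (ζ : F) := .of_finite _ _
  rw [← IntermediateField.adjoin_simple_toSubalgebra_of_isAlgebraic hint]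
  set K := (ZMod q)⟮(ζ : F)⟯ with hK
  have hcardK : Nat.card K = q ^ Module.finrank (ZMod q) K := by
    rw [Module.natCard_eq_pow_finrank (K := ZMod q), Nat.card_zmod]
  set z : K := ⟨ζ, IntermediateField.mem_adjoin_simple_self _ _⟩ with hz
  have hz0 : z ≠ 0 := fun h => ζ.ne_zero (congrArg Subtype.val h)
  have hpow : z ^ (Nat.card K - 1) = 1 := by
    have := Fintype.ofFinite K
    rw [Nat.card_eq_fintype_card, FiniteField.pow_card_sub_one_eq_one z hz0]
  have hζpow : ζ ^ (Nat.card K - 1) = 1 := by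
    ext
    simpa [hz] using congrArg Subtype.val hpow
  have hdvd : orderOf ζ ∣ q ^ Module.finrank (ZMod q) K - 1 :=
    hcardK ▸ orderOf_dvd_of_pow_eq_one hζpow
  have hone : (q : ZMod (orderOf ζ)) ^ Module.finrank (ZMod q) K = 1 := by
    have h := (ZMod.natCast_eq_zero_iff _ _).2 hdvd
    rw [Nat.cast_sub (Nat.one_le_pow _ _ (Fact.out : q.Prime).pos)] at h
    simpa [sub_eq_zero] using h
  have hle : Nat.card F ≤ Nat.card K := by
    rw [hcard, hcardK]
    exact Nat.pow_le_pow_right (Fact.out : q.Prime).pos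
      (Nat.le_of_dvd Module.finrank_pos (orderOf_dvd_of_pow_eq_one hone))
  have hset : (K : Set F) = Set.univ := by
    refine Set.eq_of_subset_of_ncard_le (Set.subset_univ _) ?_ (Set.toFinite _)
    rw [Set.ncard_univ]
    exact hle
  ext x
  simpa using (hset ▸ Set.mem_univ x : x ∈ (K : Set F))

/-- An additive subgroup stable under a ring generator of the field is trivial or everything. -/
theorem AddSubgroup.eq_bot_or_eq_top_of_mul_mem {q : ℕ} {F : Type*} [Field F]
    [Algebra (ZMod q) F] {ζ : F} (hζ : Algebra.adjoin (ZMod q) {ζ} = ⊤) (W : AddSubgroup F)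
    (hW : ∀ w ∈ W, ζ * w ∈ W) : W = ⊥ ∨ W = ⊤ := by
  have hmul : ∀ a w : F, w ∈ W → a * w ∈ W := by
    intro a
    have ha : a ∈ Algebra.adjoin (ZMod q) {ζ} := hζ ▸ Algebra.mem_top
    induction ha using Algebra.adjoin_induction with
    | mem x hx => exact (Set.mem_singleton_iff.1 hx) ▸ hW
    | algebraMap r =>
      intro w hw
      obtain ⟨n, rfl⟩ := ZMod.intCast_surjective r
      simpa using W.zsmul_mem hw n
    | add x y _ _ hx hy =>
      intro w hw
      rw [add_mul]
      exact W.add_mem (hx w hw) (hy w hw)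
    | mul x y _ _ hx hy =>
      intro w hw
      rw [mul_assoc]
      exact hx _ (hy w hw)
  obtain hbot | ⟨w, hw, hw0⟩ := W.bot_or_exists_ne_zero
  · exact .inl hbot
  right
  refine (AddSubgroup.eq_top_iff' W).2 fun x => ?_
  simpa [hw0] using hmul (x * (w : F)⁻¹) w hw

/-- Let `q` be prime, `m > 1` coprime to `q`, and let `t > 1` be the multiplicative order
of `q` mod `m`.  Let `V` be the additive group of `𝔽_{q^t}`, let `ζ` have multiplicative
order `m`, and let the cyclic group `C = ℤ/m` act on `V` by multiplication by `ζ`;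
set `G = V ⋊ C`.  If `H` is an `𝔽_q`-hyperplane of `V` (index `q`), viewed as a subgroup
of `G`, then for every metacyclic subgroup `M` of `G`, the set product `M·H ≠ G`. -/
theorem stmt_12 (q : ℕ) [hq : Fact q.Prime] (m : ℕ) (hm : 1 < m)
    (hcop : Nat.Coprime q m)
    (t : ℕ) (ht : t = orderOf (q : ZMod m)) (ht1 : 1 < t)
    (ζ : (GaloisField q t)ˣ) (hζ : orderOf ζ = m)
    (φ : Multiplicative (ZMod m) →* MulAut (Multiplicative (GaloisField q t)))
    (hφ : ∀ (c : ZMod m) (x : GaloisField q t),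
      φ (Multiplicative.ofAdd c) (Multiplicative.ofAdd x)
        = Multiplicative.ofAdd (((ζ : GaloisField q t) ^ c.val) * x))
    (H : Submodule (ZMod q) (GaloisField q t))
    (hH : H.toAddSubgroup.index = q)
    (Hsub : Subgroup (Multiplicative (GaloisField q t) ⋊[φ] Multiplicative (ZMod m)))
    (hHsub : Hsub = Subgroup.map SemidirectProduct.inl
      (AddSubgroup.toSubgroup H.toAddSubgroup))
    (M : Subgroup (Multiplicative (GaloisField q t) ⋊[φ] Multiplicative (ZMod m)))
    (hM : ∃ N : Subgroup M, ∃ hN : N.Normal, IsCyclic N ∧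
      (letI := hN; IsCyclic (M ⧸ N))) :
    (M : Set (Multiplicative (GaloisField q t) ⋊[φ] Multiplicative (ZMod m))) *
        (Hsub : Set (Multiplicative (GaloisField q t) ⋊[φ] Multiplicative (ZMod m)))
      ≠ Set.univ := by
  have hq1 : 1 < q := hq.out.one_lt
  have hcard : Nat.card (GaloisField q t) = q ^ t := GaloisField.card q t (by lia)
  have : Finite (GaloisField q t) := Nat.finite_of_card_ne_zero (by rw [hcard]; positivity)
  have hgen : Algebra.adjoin (ZMod q) {(ζ : GaloisField q t)} = ⊤ :=
    adjoin_eq_top_of_card_eq_pow_orderOf ζ (by rw [hcard, hζ, ← ht])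
  have hact : ∀ x : GaloisField q t, φ (Multiplicative.ofAdd 1) (Multiplicative.ofAdd x) =
      Multiplicative.ofAdd ((ζ : GaloisField q t) * x) := by
    intro x
    have : Fact (1 < m) := ⟨hm⟩
    rw [hφ, ZMod.val_one, pow_one]
  intro huniv
  have hdecomp : ∀ g, ∃ h ∈ H, g * SemidirectProduct.inl (Multiplicative.ofAdd h) ∈ M := by
    intro g
    obtain ⟨a, ha, b, hb, rfl⟩ := Set.mem_mul.1 (huniv ▸ Set.mem_univ g)
    rw [hHsub] at hb
    obtain ⟨h, hh, rfl⟩ := hb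
    refine ⟨-h.toAdd, H.neg_mem hh, ?_⟩
    have : Multiplicative.ofAdd (-h.toAdd) = h⁻¹ := rfl
    rw [this, map_inv, mul_inv_cancel_right]
    exact ha
  obtain ⟨h₀, -, hg⟩ := hdecomp (SemidirectProduct.inr (Multiplicative.ofAdd 1))
  set g := SemidirectProduct.inr (φ := φ) (Multiplicative.ofAdd (1 : ZMod m)) *
    SemidirectProduct.inl (Multiplicative.ofAdd h₀) with hgdef
  have hconj : ∀ x : GaloisField q t,
      g * SemidirectProduct.inl (Multiplicative.ofAdd x) * g⁻¹ =
        SemidirectProduct.inl (Multiplicative.ofAdd ((ζ : GaloisField q t) * x)) := by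
    intro x
    rw [← hact, SemidirectProduct.inl_aut, hgdef, mul_inv_rev, map_inv]
    have hcomm : SemidirectProduct.inl (φ := φ) (Multiplicative.ofAdd h₀) *
        SemidirectProduct.inl (Multiplicative.ofAdd x) =
        SemidirectProduct.inl (Multiplicative.ofAdd x) *
        SemidirectProduct.inl (Multiplicative.ofAdd h₀) := by
      rw [← map_mul, mul_comm, map_mul]
    simp only [mul_assoc]
    rw [← mul_assoc (SemidirectProduct.inl _), hcomm]
    simp only [mul_assoc, mul_inv_cancel_left]
  let W : AddSubgroup (GaloisField q t) :=
    Subgroup.toAddSubgroup' (M.comap SemidirectProduct.inl)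
  have hmemW : ∀ x, x ∈ W ↔ SemidirectProduct.inl (Multiplicative.ofAdd x) ∈ M :=
    fun x => Iff.rfl
  have hWtop : W = ⊤ := by
    refine (W.eq_bot_or_eq_top_of_mul_mem hgen fun w hw => ?_).resolve_left fun hbot => ?_
    · rw [hmemW, ← hconj]
      exact M.mul_mem (M.mul_mem hg hw) (M.inv_mem hg)
    · have hHtop : H.toAddSubgroup = ⊤ := by
        refine (AddSubgroup.eq_top_iff' _).2 fun x => ?_
        obtain ⟨h, hh, hx⟩ := hdecomp (SemidirectProduct.inl (Multiplicative.ofAdd x))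
        rw [← map_mul, ← ofAdd_add, ← hmemW, hbot, AddSubgroup.mem_bot] at hx
        rw [eq_neg_of_add_eq_zero_left hx]
        exact H.neg_mem hh
      rw [hHtop, AddSubgroup.index_top] at hH
      lia
  have hM' : ∀ x : GaloisField q t, SemidirectProduct.inl (Multiplicative.ofAdd x) ∈ M :=
    fun x => (hmemW x).1 (hWtop ▸ AddSubgroup.mem_top x)
  obtain ⟨N, hN, hNcyc, hQcyc⟩ := hM
  have hζ1 : (ζ : GaloisField q t) - 1 ≠ 0 := by
    intro h
    have : ζ = 1 := Units.ext (sub_eq_zero.1 h)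
    rw [this, orderOf_one] at hζ
    lia
  have hNmem : ∀ x : GaloisField q t,
      (⟨SemidirectProduct.inl (Multiplicative.ofAdd x), hM' x⟩ : M) ∈ N := by
    intro x
    set y := x / ((ζ : GaloisField q t) - 1) with hy
    have hx : (ζ : GaloisField q t) * y - y = x := by
      rw [hy]; field_simp
    let a : M := ⟨g, hg⟩
    let b : M := ⟨SemidirectProduct.inl (Multiplicative.ofAdd y), hM' y⟩
    have hab : (⟨SemidirectProduct.inl (Multiplicative.ofAdd x), hM' x⟩ : M) =
        a * b * a⁻¹ * b⁻¹ := by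
      apply Subtype.ext
      change _ = g * SemidirectProduct.inl (Multiplicative.ofAdd y) * g⁻¹ *
        (SemidirectProduct.inl (Multiplicative.ofAdd y))⁻¹
      rw [hconj, ← map_inv, ← map_mul, ← hx, sub_eq_add_neg]
      rfl
    rw [hab, ← QuotientGroup.eq_one_iff]
    have hcomm : (a : M ⧸ N) * b = b * a := IsCyclic.commGroup.mul_comm _ _
    simp only [QuotientGroup.mk_mul, QuotientGroup.mk_inv]
    rw [hcomm, mul_inv_cancel_right, mul_inv_cancel]
  let f : GaloisField q t → N := fun x => ⟨⟨_, hM' x⟩, hNmem x⟩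
  have hf : Function.Injective f := fun x y h =>
    Multiplicative.ofAdd.injective (SemidirectProduct.inl_injective
      (congrArg (fun n : N => (n : M).1) h))
  have hfpow : ∀ x, f x ^ q = 1 := by
    intro x
    apply Subtype.ext
    apply Subtype.ext
    change SemidirectProduct.inl (Multiplicative.ofAdd x) ^ q = 1
    rw [← map_pow, ← ofAdd_nsmul, nsmul_eq_mul, CharP.cast_eq_zero, zero_mul, ofAdd_zero,
      map_one]
  have : NeZero m := ⟨by lia⟩
  have : Finite (Multiplicative (GaloisField q t) ⋊[φ] Multiplicative (ZMod m)) :=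
    .of_equiv _ SemidirectProduct.equivProd.symm
  classical
  have := Fintype.ofFinite N
  have := Fintype.ofFinite (GaloisField q t)
  have hle := IsCyclic.card_pow_eq_one_le (α := N) hq.out.pos
  have hge : q ^ t ≤ q := by
    rw [← hcard, Nat.card_eq_fintype_card, ← Finset.card_univ]
    exact (Finset.card_le_card_of_injOn f (fun x _ => by simp [hfpow x]) hf.injOn).trans hle
  exact absurd (Nat.pow_lt_pow_right hq1 ht1) (by rw [pow_one]; lia)
end

section
/- Let q and ℓ be primes with ℓ ≡ 1 (mod q). Then there exist infinitely many primes r such that: r ≡ 1 (mod q); r is a q-th power residue modulo ℓ (i.e., there is an integer y with y^q ≡ r (mod ℓ)); and ℓ is a q-th power residue modulo r (i.e., there is an integer z with z^q ≡ ℓ (mod r)). -/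
open Polynomial in
/-- A nonconstant integer polynomial has, among the prime divisors of its values, primes coprime to
any prescribed nonzero integer. -/
theorem exists_prime_dvd_eval_not_dvd (f : ℤ[X]) (hf : f.natDegree ≠ 0) (M : ℤ) (hM : M ≠ 0) :
    ∃ (r : ℕ) (n : ℤ), r.Prime ∧ ¬ (r : ℤ) ∣ M ∧ (r : ℤ) ∣ f.eval n := by
  by_cases hc : f.eval 0 = 0
  · obtain ⟨r, hr, hrp⟩ := Nat.exists_infinite_primes (M.natAbs + 1)
    refine ⟨r, 0, hrp, fun h => ?_, by simp [hc]⟩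
    have := Nat.le_of_dvd (Int.natAbs_pos.mpr hM) (Int.natCast_dvd.mp h)
    omega
  set c := f.eval 0 with hcdef
  set g : ℤ[X] := f.comp (C (c * M) * X) with hg
  have hgdeg : g.natDegree ≠ 0 := by
    rw [hg, natDegree_comp, natDegree_C_mul_X _ (mul_ne_zero hc hM), mul_one]
    exact hf
  have hsub : ∀ a : ℤ, g - C a ≠ 0 := fun a h => by
    rw [sub_eq_zero] at h
    exact hgdeg (by rw [h, natDegree_C])
  obtain ⟨x, hx⟩ := Set.Infinite.nonempty
    ((finite_setOfPred_isRoot (mul_ne_zero (hsub c) (hsub (-c)))).infinite_compl)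
  obtain ⟨h, hh⟩ : c * M * x - 0 ∣ f.eval (c * M * x) - f.eval 0 := sub_dvd_eval_sub _ _ f
  set v := 1 + M * x * h with hv
  have hval : f.eval (c * M * x) = c * v := by
    rw [hv]; linear_combination hh + hcdef
  have hgx : g.eval x = c * v := by simpa [hg] using hval
  have hunit : v.natAbs ≠ 1 := by
    intro h1
    apply hx
    rcases Int.natAbs_eq_iff.mp h1 with h2 | h2 <;>
      simp [IsRoot.def, hgx, h2]
  obtain ⟨r, hrp, hrv⟩ := Nat.exists_prime_and_dvd hunit
  have hrv' : (r : ℤ) ∣ v := Int.natCast_dvd.mpr hrv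
  refine ⟨r, c * M * x, hrp, fun hrM => ?_, hval ▸ hrv'.mul_left c⟩
  have h1 : (r : ℤ) ∣ 1 := by
    have := dvd_sub hrv' ((hrM.mul_right x).mul_right h)
    simpa [hv] using this
  exact hrp.one_lt.ne' (by exact_mod_cast Int.eq_one_of_dvd_one (by positivity) h1)

open Polynomial in
/-- For a number field `K` there is an integer polynomial such that, for every prime `r` dividing
one of its values (outside a finite set depending on `x`), the integral relations satisfied by
`x : K` are also satisfied by some element of `ZMod r`. -/
theorem exists_polynomial_forall_zmod_root (K : Type*) [Field K] [CharZero K]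
    [FiniteDimensional ℚ K] :
    ∃ f : ℤ[X], f.natDegree ≠ 0 ∧ ∀ x : K, ∃ d : ℤ, d ≠ 0 ∧
      ∀ (r : ℕ) (n : ℤ), r.Prime → (r : ℤ) ∣ f.eval n → ¬ (r : ℤ) ∣ d →
        ∃ u : ZMod r, ∀ P : ℤ[X], aeval x P = 0 → aeval u P = 0 := by
  obtain ⟨α, hα⟩ := Field.exists_primitive_element ℚ K
  obtain ⟨m, hm, hint⟩ := ((IsFractionRing.isAlgebraic_iff ℤ ℚ K).mpr
    (Algebra.IsAlgebraic.isAlgebraic (R := ℚ) α)).exists_integral_multiple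
  refine ⟨minpoly ℤ (m • α), (minpoly.natDegree_pos hint).ne', fun x => ?_⟩
  have hx : x ∈ Algebra.adjoin ℚ {α} := by
    rw [← IntermediateField.adjoin_simple_toSubalgebra_of_isAlgebraic
      (Algebra.IsAlgebraic.isAlgebraic α), hα]
    exact Algebra.mem_top
  obtain ⟨g, hg⟩ := Algebra.adjoin_mem_exists_aeval ℚ α hx
  have hmK : (m : K) ≠ 0 := Int.cast_ne_zero.mpr hm
  set g' : ℚ[X] := g.comp (C (m : ℚ)⁻¹ * X) with hg'
  have hgx : aeval (m • α) g' = x := by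
    rw [hg', aeval_comp, ← hg]
    congr 1
    simp [hmK]
  obtain ⟨d, hd0, hd⟩ := IsLocalization.integerNormalization_spec (nonZeroDivisors ℤ) g'
  set G := IsLocalization.integerNormalization (nonZeroDivisors ℤ) g'
  have hG : aeval (m • α) G = d * x := by
    rw [← aeval_map_algebraMap ℚ, hd, map_zsmul, hgx, zsmul_eq_mul]
  refine ⟨d, nonZeroDivisors.ne_zero hd0, fun r n hr hrn hrd => ?_⟩
  have : Fact r.Prime := ⟨hr⟩
  have hdr : (d : ZMod r) ≠ 0 := fun h => hrd ((ZMod.intCast_zmod_eq_zero_iff_dvd _ _).mp h)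
  have hroot : aeval (n : ZMod r) (minpoly ℤ (m • α)) = 0 := by
    rw [← eq_intCast (algebraMap ℤ (ZMod r)) n, aeval_algebraMap_apply, eq_intCast]
    exact (ZMod.intCast_zmod_eq_zero_iff_dvd _ _).mpr (by simpa using hrn)
  refine ⟨aeval (n : ZMod r) G / d, fun P hP => ?_⟩
  have hzero : aeval (m • α) ((P.scaleRoots d).comp G) = 0 := by
    rw [aeval_comp, hG]
    have := scaleRoots_aeval_eq_zero (r := d) hP
    simpa using this
  have hdvd := minpoly.isIntegrallyClosed_dvd hint hzero
  have h0 : aeval (n : ZMod r) ((P.scaleRoots d).comp G) = 0 := by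
    obtain ⟨Q, hQ⟩ := hdvd
    rw [hQ, map_mul, hroot, zero_mul]
  rw [aeval_comp] at h0
  have h1 := scaleRoots_eval₂_mul (p := P) (algebraMap ℤ (ZMod r))
    (aeval (n : ZMod r) G / d) d
  rw [eq_intCast, mul_div_cancel₀ _ hdr, ← aeval_def, h0, ← aeval_def] at h1
  exact (mul_eq_zero.mp h1.symm).resolve_left (pow_ne_zero _ hdr)

open Polynomial in
/-- If a number field contains a primitive `N`-th root of unity and a finite extension of it
contains a `q`-th root of `a`, then there are arbitrarily large primes `r ≡ 1 (mod N)`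
modulo which `a` is a `q`-th power. -/
theorem exists_prime_gt_dvd_sub_one_and_pow_eq_of_numberField (K : Type*) [Field K] [CharZero K]
    [FiniteDimensional ℚ K] (L : Type*) [Field L] [Algebra K L] [FiniteDimensional K L]
    (N q a : ℕ) (hN : N ≠ 0) (ζ : K) (β : L)
    (hζ : IsPrimitiveRoot ζ N) (hβ : β ^ q = algebraMap K L a) (B : ℕ) :
    ∃ r : ℕ, B < r ∧ r.Prime ∧ N ∣ r - 1 ∧ ∃ z : ZMod r, z ^ q = a := by
  have hζ' : aeval ζ (cyclotomic N ℤ) = 0 := by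
    rw [aeval_def, ← eval_map, map_cyclotomic]
    exact hζ.isRoot_cyclotomic (Nat.pos_of_ne_zero hN)
  have hβ' : aeval β (X ^ q - C (a : ℤ)) = 0 := by simp [hβ]
  have : CharZero L := charZero_of_injective_algebraMap (algebraMap K L).injective
  have : FiniteDimensional ℚ L := Module.Finite.trans K L
  obtain ⟨f, hf, H⟩ := exists_polynomial_forall_zmod_root L
  obtain ⟨d₁, hd₁, H₁⟩ := H (algebraMap K L ζ)
  obtain ⟨d₂, hd₂, H₂⟩ := H β
  obtain ⟨r, n, hr, hrM, hrn⟩ := exists_prime_dvd_eval_not_dvd f hf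
    (d₁ * d₂ * N * B.factorial) (by positivity)
  have : Fact r.Prime := ⟨hr⟩
  obtain ⟨u, hu⟩ := H₁ r n hr hrn
    fun h => hrM (((h.mul_right _).mul_right _).mul_right _)
  obtain ⟨z, hz⟩ := H₂ r n hr hrn
    fun h => hrM (((h.mul_left _).mul_right _).mul_right _)
  refine ⟨r, ?_, hr, ?_, z, ?_⟩
  · by_contra! h
    exact hrM ((Int.natCast_dvd_natCast.mpr (hr.dvd_factorial.mpr h)).mul_left _)
  · have : NeZero (N : ZMod r) := ⟨fun h => hrM
      (((Int.natCast_dvd_natCast.mpr ((ZMod.natCast_eq_zero_iff _ _).mp h)).mul_left _).mul_right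
        _)⟩
    have hroot : (cyclotomic N (ZMod r)).IsRoot u := by
      have := hu _ (by rw [aeval_algebraMap_apply, hζ', map_zero])
      rwa [aeval_def, ← eval_map, map_cyclotomic] at this
    have hprim := isRoot_cyclotomic_iff.mp hroot
    exact hprim.dvd_of_pow_eq_one _ (ZMod.pow_card_sub_one_eq_one (hprim.ne_zero hN))
  · simpa [sub_eq_zero] using hz _ hβ'

open Polynomial in
/-- There are arbitrarily large primes `r ≡ 1 (mod N)` modulo which `a` is a `q`-th power. -/
theorem exists_prime_gt_dvd_sub_one_and_pow_eq (N q a : ℕ) (hN : N ≠ 0) (hq : q ≠ 0) (B : ℕ) :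
    ∃ r : ℕ, B < r ∧ r.Prime ∧ N ∣ r - 1 ∧ ∃ z : ZMod r, z ^ q = a := by
  have : NeZero N := ⟨hN⟩
  obtain ⟨ζ, hζ⟩ : ∃ ζ : CyclotomicField N ℚ, IsPrimitiveRoot ζ N :=
    (CyclotomicField.isCyclotomicExtension N ℚ).exists_isPrimitiveRoot rfl hN
  obtain ⟨β, hβ⟩ :=
    (SplittingField.splits (X ^ q - C (a : CyclotomicField N ℚ))).exists_eval_eq_zero (by
      rw [degree_map, degree_X_pow_sub_C (Nat.pos_of_ne_zero hq)]
      exact_mod_cast hq)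
  refine exists_prime_gt_dvd_sub_one_and_pow_eq_of_numberField (CyclotomicField N ℚ)
    (X ^ q - C (a : CyclotomicField N ℚ)).SplittingField N q a hN ζ β hζ ?_ B
  simpa [-map_natCast, sub_eq_zero] using hβ

/-- Let `q` and `ℓ` be primes with `ℓ ≡ 1 (mod q)`.  Then there are infinitely many
primes `r` with `r ≡ 1 (mod q)`, `r` a `q`-th power residue mod `ℓ`, and `ℓ` a `q`-th
power residue mod `r`. -/
theorem stmt_13 (q ℓ : ℕ) (hq : q.Prime) (hl : ℓ.Prime) (hcong : ℓ % q = 1) :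
    {r : ℕ | r.Prime ∧ r % q = 1 ∧
      (∃ y : ℤ, y ^ q ≡ (r : ℤ) [ZMOD ℓ]) ∧
      (∃ z : ℤ, z ^ q ≡ (ℓ : ℤ) [ZMOD r])}.Infinite := by
  refine Set.infinite_of_not_bddAbove fun ⟨B, hB⟩ => ?_
  obtain ⟨r, hBr, hr, hdvd, z, hz⟩ :=
    exists_prime_gt_dvd_sub_one_and_pow_eq (q * ℓ) q ℓ (mul_ne_zero hq.ne_zero hl.ne_zero)
      hq.ne_zero B
  have hmod : 1 ≡ r [MOD q * ℓ] := (Nat.modEq_iff_dvd' hr.one_lt.le).mpr hdvd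
  refine hBr.not_ge (hB ⟨hr, ?_, ⟨1, ?_⟩, ?_⟩)
  · have h := hmod.of_mul_right ℓ
    rw [Nat.ModEq, Nat.mod_eq_of_lt hq.one_lt] at h
    exact h.symm
  · rw [one_pow]
    exact_mod_cast Int.natCast_modEq_iff.mpr (hmod.of_mul_left q)
  · obtain ⟨w, rfl⟩ := ZMod.intCast_surjective z
    exact ⟨w, (ZMod.intCast_eq_intCast_iff _ _ _).mp (by exact_mod_cast hz)⟩
end

section
/- For every prime q there exists a finite Galois extension K/ℚ with Gal(K/ℚ) isomorphic to ℤ/q × ℤ/q such that for every prime p and every maximal ideal 𝔓 of the ring of integers O_K of K lying over p, the decomposition group D(𝔓) = {σ ∈ Gal(K/ℚ) : σ(𝔓) = 𝔓} has order at most q. -/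
open Polynomial NumberField
open scoped Nat Pointwise

/-- A nonconstant integer polynomial has arbitrarily large prime divisors of its values. -/
theorem exists_prime_gt_dvd_eval {f : ℤ[X]} (hf : 0 < f.natDegree) (N : ℕ) :
    ∃ p : ℕ, p.Prime ∧ N < p ∧ ∃ n : ℤ, (p : ℤ) ∣ f.eval n := by
  by_cases h0 : f.eval 0 = 0
  · obtain ⟨p, hp, hpp⟩ := Nat.exists_infinite_primes (N + 1)
    exact ⟨p, hpp, hp, 0, by simp [h0]⟩
  set c := f.eval 0 with hc
  have hfin : {x : ℤ | f.eval x = c ∨ f.eval x = -c}.Finite := by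
    have key : ∀ a : ℤ, {x : ℤ | f.eval x = a}.Finite := fun a ↦ by
      have hne : f - C a ≠ 0 := fun h ↦ by
        rw [sub_eq_zero.mp h, natDegree_C] at hf
        exact hf.false
      refine (f - C a).roots.toFinset.finite_toSet.subset fun x hx ↦ ?_
      have hx : f.eval x = a := hx
      rw [Finset.mem_coe, Multiset.mem_toFinset, mem_roots hne]
      simp [hx]
    exact (key c).union (key (-c))
  have hM : c * (N ! : ℤ) ≠ 0 := mul_ne_zero h0 (mod_cast N.factorial_ne_zero)
  have hinj : Function.Injective fun t : ℤ ↦ c * (N ! : ℤ) * t := mul_right_injective₀ hM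
  obtain ⟨t, ht⟩ := (hfin.preimage hinj.injOn).infinite_compl.nonempty
  have hdvd : c * (N ! : ℤ) * t ∣ f.eval (c * (N ! : ℤ) * t) - c := by
    simpa [hc] using f.sub_dvd_eval_sub (c * (N ! : ℤ) * t) 0
  obtain ⟨s, hs⟩ := hdvd
  have hval : f.eval (c * (N ! : ℤ) * t) = c * (1 + (N ! : ℤ) * (t * s)) := by
    linear_combination hs
  have hunit : (1 + (N ! : ℤ) * (t * s)).natAbs ≠ 1 := fun h ↦ by
    apply ht
    rcases Int.natAbs_eq_natAbs_iff.mp (h.trans Int.natAbs_one.symm) with h | h <;>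
      simp [hval, h]
  obtain ⟨p, hp, hpd⟩ := Nat.exists_prime_and_dvd hunit
  have hpd : (p : ℤ) ∣ 1 + (N ! : ℤ) * (t * s) := Int.natCast_dvd.mpr hpd
  refine ⟨p, hp, ?_, _, hval ▸ hpd.mul_left c⟩
  by_contra! hle
  have hpN : (p : ℤ) ∣ (N ! : ℤ) * (t * s) :=
    (Int.natCast_dvd_natCast.mpr (hp.dvd_factorial.mpr hle)).mul_right _
  exact hp.one_lt.ne' (by simpa using Int.natAbs_dvd_natAbs.mpr ((dvd_add_left hpN).mp hpd))

/-- The ring of integers contains an order `ℤ[θ]` of finite index. -/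
theorem NumberField.exists_exponent_ne_zero (L : Type*) [Field L] [NumberField L] :
    ∃ θ : 𝓞 L, RingOfIntegers.exponent θ ≠ 0 := by
  obtain ⟨α, hα⟩ := Field.exists_primitive_element ℚ L
  obtain ⟨d, hd, hint⟩ := IsAlgebraic.exists_integral_multiple
    ((IsFractionRing.isAlgebraic_iff ℤ ℚ L).mpr (Algebra.IsAlgebraic.isAlgebraic α))
  let θ : 𝓞 L := ⟨d • α, hint⟩
  have hgen : Algebra.adjoin ℚ {(θ : L)} = ⊤ := by
    have hα' : Algebra.adjoin ℚ {α} = ⊤ := by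
      rw [← IntermediateField.adjoin_simple_toSubalgebra_of_isAlgebraic
        (Algebra.IsAlgebraic.isAlgebraic α), hα, IntermediateField.top_toSubalgebra]
    refine top_le_iff.mp (hα' ▸ Algebra.adjoin_le (Set.singleton_subset_iff.mpr ?_))
    have : α = (d : ℚ)⁻¹ • (θ : L) := by
      simp [θ, Algebra.smul_def, hd]
    rw [this]
    exact Subalgebra.smul_mem _ (Algebra.self_mem_adjoin_singleton _ _) _
  let B := PowerBasis.ofAdjoinEqTop (Algebra.IsIntegral.isIntegral (θ : L)) hgen
  have hB : B.gen = θ := PowerBasis.ofAdjoinEqTop_gen _ _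
  have hBint : IsIntegral ℤ B.gen := hB ▸ θ.isIntegral_coe
  obtain ⟨D, hD⟩ := IsIntegrallyClosed.isIntegral_iff.mp
    (Algebra.discr_isIntegral ℚ fun i ↦ by
      rw [B.basis_eq_pow]
      exact hBint.pow _ : IsIntegral ℤ (Algebra.discr ℚ B.basis))
  have hD0 : D ≠ 0 := by
    rintro rfl
    exact Algebra.discr_not_zero_of_basis ℚ B.basis (by simpa using hD.symm)
  have hcond : (algebraMap ℤ (𝓞 L) D) ∈ conductor ℤ θ := fun b ↦ by
    have := Algebra.discr_mul_isIntegral_mem_adjoin (R := ℤ) ℚ hBint b.isIntegral_coe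
    have hmap : (Algebra.adjoin ℤ {θ}).map (Algebra.algHom ℤ (𝓞 L) L) =
        Algebra.adjoin ℤ {(θ : L)} := by
      rw [AlgHom.map_adjoin_singleton]
      rfl
    rw [hB, ← hmap] at this
    obtain ⟨y, hy, hyb⟩ := this
    have hDb : algebraMap ℤ (𝓞 L) D * b = y := by
      ext
      have hyb : (y : L) = Algebra.discr ℚ B.basis • (b : L) := hyb
      rw [hyb, ← hD]
      simp [Algebra.smul_def]
    exact hDb ▸ hy
  refine ⟨θ, fun h ↦ hD0 ?_⟩
  have h : (conductor ℤ θ).under ℤ = ⊥ := Ideal.absNorm_eq_zero_iff.mp h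
  exact (Ideal.mem_bot (R := ℤ)).mp (h ▸ hcond)

/-- A number field has infinitely many primes of residue degree one. -/
theorem NumberField.exists_prime_gt_nonempty_ringHom (L : Type*) [Field L] [NumberField L]
    (N : ℕ) : ∃ p : ℕ, p.Prime ∧ N < p ∧ Nonempty (𝓞 L →+* ZMod p) := by
  obtain ⟨θ, hθ⟩ := exists_exponent_ne_zero L
  obtain ⟨p, hp, hpN, n, hn⟩ := exists_prime_gt_dvd_eval (minpoly.natDegree_pos θ.isIntegral)
    (max N (RingOfIntegers.exponent θ))
  have : Fact p.Prime := ⟨hp⟩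
  have hpθ : ¬ p ∣ RingOfIntegers.exponent θ := fun h ↦
    (Nat.le_of_dvd (Nat.pos_of_ne_zero hθ) h).not_gt ((le_max_right _ _).trans_lt hpN)
  refine ⟨p, hp, (le_max_left _ _).trans_lt hpN, ⟨?_⟩⟩
  refine ((Ideal.Quotient.lift _ (evalRingHom (n : ZMod p)) fun a ha ↦ ?_).comp
    (RingOfIntegers.ZModXQuotSpanEquivQuotSpan hpθ).symm.toRingHom).comp (Ideal.Quotient.mk _)
  obtain ⟨b, rfl⟩ := Ideal.mem_span_singleton.mp ha
  have : ((minpoly ℤ θ).map (Int.castRingHom (ZMod p))).eval (n : ZMod p) = 0 := by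
    rw [← eq_intCast (Int.castRingHom (ZMod p)) n, eval_map_apply, eq_intCast]
    exact (ZMod.intCast_zmod_eq_zero_iff_dvd _ _).mpr hn
  simp [this]

/-- There are distinct primes congruent to `1` modulo `q`, each a `q`-th power modulo the other. -/
theorem exists_prime_pair {q : ℕ} (hq : q.Prime) :
    ∃ p₁ p₂ : ℕ, p₁.Prime ∧ p₂.Prime ∧ p₁ ≠ p₂ ∧ q ∣ p₁ - 1 ∧ q ∣ p₂ - 1 ∧
      (∃ y : ZMod p₂, y ^ q = p₁) ∧ (∃ y : ZMod p₁, y ^ q = p₂) := by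
  obtain ⟨p₁, hp₁, -, h₁⟩ := Nat.exists_prime_gt_modEq_one (k := q) 0 hq.ne_zero
  have hm : q * p₁ ≠ 0 := mul_ne_zero hq.ne_zero hp₁.ne_zero
  let F : ℚ[X] := (cyclotomic (q * p₁) ℚ) * (X ^ q - C (p₁ : ℚ))
  let L := F.SplittingField
  have : NumberField L := {}
  have hF : F ≠ 0 := mul_ne_zero (cyclotomic_ne_zero _ _) (monic_X_pow_sub_C _ hq.ne_zero).ne_zero
  have exists_root : ∀ g : ℚ[X], g ∣ F → 0 < g.degree →
      ∃ x : L, (g.map (algebraMap ℚ L)).eval x = 0 :=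
    fun g hg hdeg ↦ ((SplittingField.splits F).of_dvd (map_ne_zero hF)
      (Polynomial.map_dvd _ hg)).exists_eval_eq_zero (by rw [degree_map]; exact hdeg.ne')
  obtain ⟨ζ, hζ⟩ := exists_root _ (dvd_mul_right _ _)
    (degree_cyclotomic_pos _ _ (Nat.pos_of_ne_zero hm))
  obtain ⟨r, hr⟩ := exists_root _ (dvd_mul_left _ _)
    (by rw [degree_X_pow_sub_C hq.pos]; exact mod_cast hq.pos)
  have hr : r ^ q = p₁ := by simpa [sub_eq_zero] using hr
  have hζ : IsPrimitiveRoot ζ (q * p₁) := by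
    have : NeZero ((q * p₁ : ℕ) : L) := ⟨Nat.cast_ne_zero.mpr hm⟩
    rwa [← isRoot_cyclotomic_iff, ← map_cyclotomic (q * p₁) (algebraMap ℚ L)]
  let r' : 𝓞 L := ⟨r, IsIntegral.of_pow hq.pos (hr ▸ isIntegral_natCast p₁)⟩
  have : NeZero (q * p₁) := ⟨hm⟩
  obtain ⟨p₂, hp₂, hlt, ⟨ψ⟩⟩ := NumberField.exists_prime_gt_nonempty_ringHom L (q * p₁)
  have := Fact.mk hp₂
  have hroot : IsPrimitiveRoot (ψ hζ.toInteger) (q * p₁) := by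
    have : NeZero ((q * p₁ : ℕ) : ZMod p₂) := .of_not_dvd _ fun h ↦
      hlt.not_ge (Nat.le_of_dvd (Nat.pos_of_ne_zero hm) h)
    rw [← isRoot_cyclotomic_iff, ← map_cyclotomic (q * p₁) ψ]
    refine IsRoot.map (hζ.toInteger_isPrimitiveRoot.isRoot_cyclotomic (Nat.pos_of_ne_zero hm))
  have hdvd : q * p₁ ∣ p₂ - 1 := by
    rw [hroot.eq_orderOf]
    exact ZMod.orderOf_dvd_card_sub_one (hroot.ne_zero hm)
  refine ⟨p₁, p₂, hp₁, hp₂, ?_, ?_, (dvd_mul_right _ _).trans hdvd, ⟨ψ r', ?_⟩, 1, ?_⟩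
  · rintro rfl
    exact hlt.not_ge (Nat.le_mul_of_pos_left _ hq.pos)
  · exact (Nat.modEq_iff_dvd' hp₁.one_le).mp h₁.symm
  · have : r' ^ q = (p₁ : 𝓞 L) :=
      FaithfulSMul.algebraMap_injective (𝓞 L) L (by rw [map_pow, map_natCast]; exact hr)
    rw [← map_pow, this, map_natCast]
  · rw [one_pow, eq_comm, ← Nat.cast_one, ZMod.natCast_eq_natCast_iff]
    exact ((Nat.modEq_iff_dvd' hp₂.one_le).mpr ((dvd_mul_left _ _).trans hdvd)).symm

section
attribute [local instance] Ideal.Quotient.field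

open IsCyclotomicExtension.Rat MulAction Ideal in
theorem IsCyclotomicExtension.Rat.unitsMap_galEquivZMod_mem_zpowers_of_mem_stabilizer
    (n : ℕ) [NeZero n] (L : Type*) [Field L] [NumberField L] [IsCyclotomicExtension {n} ℚ L]
    {d : ℕ} (hd : d ∣ n) (p : ℕ) [Fact p.Prime] (P : Ideal (𝓞 L)) [P.IsMaximal]
    [P.LiesOver (Ideal.span {(p : ℤ)})] (hp : p.Coprime d)
    {σ : Gal(L/ℚ)} (hσ : σ ∈ MulAction.stabilizer Gal(L/ℚ) P) :
    ZMod.unitsMap hd (galEquivZMod n L σ) ∈ Subgroup.zpowers (ZMod.unitOfCoprime p hp) := by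
  have : NeZero d := ⟨ne_zero_of_dvd_ne_zero (NeZero.ne n) hd⟩
  obtain ⟨c, hc⟩ := hd
  have hζ : IsPrimitiveRoot ((IsCyclotomicExtension.zeta_spec n ℚ L).toInteger ^ c) d :=
    (IsCyclotomicExtension.zeta_spec n ℚ L).toInteger_isPrimitiveRoot.pow (NeZero.pos n)
      (hc.trans (mul_comm _ _))
  set ζ := (IsCyclotomicExtension.zeta_spec n ℚ L).toInteger ^ c
  let τ := IsFractionRing.stabilizerHom Gal(L/ℚ) (Ideal.span {(p : ℤ)}) P
     (ℤ ⧸ span {(p : ℤ)}) (𝓞 L ⧸ P) ⟨σ, hσ⟩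
  have : CharP (ℤ ⧸ span {(p : ℤ)}) p := ringChar.of_eq <| Int.ringChar_idealQuot p
  have : Finite (𝓞 L ⧸ P) := Ring.HasFiniteQuotients.finiteQuotient (NeZero.ne P)
  obtain ⟨i, hi⟩ := FiniteField.exists_forall_apply_eq_pow (ℤ ⧸ span {(p : ℤ)}) p (𝓞 L ⧸ P) τ
  refine ⟨i, ?_⟩
  have h₀ : IsPrimitiveRoot (Ideal.Quotient.mk P ζ) d := by
    refine hζ.idealQuotient_mk (by simpa using IsMaximal.ne_top inferInstance) ?_
    rw [← pow_inertiaDeg p]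
    exact Nat.Coprime.pow_left _ hp
  have h₁ := IsFractionRing.stabilizerHom_apply_apply_mk Gal(L/ℚ) (Ideal.span {(p : ℤ)}) P
      (ℤ ⧸ span {(p : ℤ)}) (𝓞 L ⧸ P) ⟨σ, hσ⟩ ζ
  simp only [Algebra.algebraMap_self, RingHomCompTriple.comp_apply] at h₁
  specialize hi (Ideal.Quotient.mk P ζ)
  rw [h₁, Int.card_ideal_quot, galEquivZMod_smul_of_pow_eq n _ _
    (by rw [hc, pow_mul, hζ.pow_eq_one, one_pow]), map_pow,
    (h₀.isOfFinOrder (NeZero.ne _)).pow_inj_mod, ← h₀.eq_orderOf, ← ZMod.natCast_eq_natCast_iff',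
    Nat.cast_pow, ← ZMod.coe_unitOfCoprime p hp, ← Units.val_pow_eq_pow_val, ZMod.natCast_val] at hi
  ext
  simpa [ZMod.unitsMap_val] using hi.symm

end

theorem exists_mem_stabilizer_forall_algebraMap_eq (K L : Type*) [Field K] [NumberField K]
    [Field L] [NumberField L] [Algebra K L] [IsGalois ℚ K] [IsGalois ℚ L]
    (P : Ideal (𝓞 K)) (Q : Ideal (𝓞 L)) [Q.IsPrime] [Q.LiesOver P] {σ : Gal(K/ℚ)}
    (hσ : σ ∈ MulAction.stabilizer Gal(K/ℚ) P) :
    ∃ τ ∈ MulAction.stabilizer Gal(L/ℚ) Q, ∀ x, τ (algebraMap K L x) = algebraMap K L (σ x) := by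
  obtain ⟨ρ, rfl⟩ := AlgEquiv.restrictNormalHom_surjective (F := ℚ) (K₁ := K) L σ
  have hρ (x : 𝓞 K) : ρ⁻¹ • algebraMap (𝓞 K) (𝓞 L) x =
      algebraMap (𝓞 K) (𝓞 L) ((AlgEquiv.restrictNormalHom K ρ)⁻¹ • x) := by
    rw [← map_inv]
    exact RingOfIntegers.ext (AlgEquiv.restrictNormal_commutes ρ⁻¹ K x).symm
  have : IsGalois K L := IsGalois.tower_top_of_isGalois ℚ K L
  have hunder : (ρ • Q).under (𝓞 K) = Q.under (𝓞 K) := by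
    rw [← Ideal.over_def Q P]
    ext x
    rw [Ideal.under_def, Ideal.mem_comap, Ideal.mem_pointwise_smul_iff_inv_smul_mem, hρ,
      ← Ideal.mem_comap, ← Ideal.under_def, ← Ideal.over_def Q P,
      ← Ideal.mem_pointwise_smul_iff_inv_smul_mem, MulAction.mem_stabilizer_iff.mp hσ]
  obtain ⟨g, hg⟩ := Algebra.IsInvariant.exists_smul_of_under_eq (𝓞 K) (𝓞 L) Gal(L/K) _ _ hunder
  refine ⟨g.restrictScalars ℚ * ρ, ?_, fun x ↦ ?_⟩
  · rw [MulAction.mem_stabilizer_iff, mul_smul]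
    exact hg.symm
  · exact (congrArg g (AlgEquiv.restrictNormal_commutes ρ K x).symm).trans (g.commutes _)

theorem exists_intermediateField_algebraicClosure_mulEquiv {F L M : Type*} [Field F] [Field L]
    [Algebra F L] [FiniteDimensional F L] [IsGalois F L] [Group M] {ψ : Gal(L/F) →* M}
    (hψ : Function.Surjective ψ) :
    ∃ (K : IntermediateField F (AlgebraicClosure F)) (i : K →ₐ[F] L) (e : Gal(K/F) ≃* M),
      FiniteDimensional F K ∧ IsGalois F K ∧
        ∀ (σ : Gal(L/F)) (ρ : Gal(K/F)), (∀ x, σ (i x) = i (ρ x)) → e ρ = ψ σ := by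
  let E := IntermediateField.fixedField ψ.ker
  have : IsGalois F E := inferInstance
  let j : E ≃ₐ[F] E.map (IsAlgClosed.lift : L →ₐ[F] AlgebraicClosure F) := E.equivMap _
  let e : Gal(E/F) ≃* M := (IsGalois.normalAutEquivQuotient ψ.ker).symm.trans
    (QuotientGroup.quotientKerEquivOfSurjective ψ hψ)
  have he (σ : Gal(L/F)) : e (AlgEquiv.restrictNormalHom E σ) = ψ σ := by
    have : AlgEquiv.restrictNormalHom E σ = IsGalois.normalAutEquivQuotient ψ.ker σ := rfl
    simp only [e, MulEquiv.trans_apply, this, MulEquiv.symm_apply_apply]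
    rfl
  refine ⟨_, E.val.comp j.symm.toAlgHom, (AlgEquiv.autCongr j.symm).trans e,
    j.toLinearEquiv.finiteDimensional, IsGalois.of_algEquiv j, fun σ ρ h ↦ ?_⟩
  rw [MulEquiv.trans_apply, ← he]
  congr 1
  ext x
  have := h (j x)
  have h' : algebraMap E L (AlgEquiv.restrictNormalHom E σ x) = σ x :=
    AlgEquiv.restrictNormal_commutes σ E x
  rw [← IntermediateField.algebraMap_apply, ← IntermediateField.algebraMap_apply, h']
  simpa using this.symm

theorem exists_surjective_units_zmod {p q : ℕ} [Fact p.Prime] (h : q ∣ p - 1) :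
    ∃ χ : (ZMod p)ˣ →* Multiplicative (ZMod q), Function.Surjective χ := by
  have hc : Nat.card (ZMod p)ˣ = p - 1 := by rw [Nat.card_eq_fintype_card, ZMod.card_units]
  let e := zmodCyclicMulEquiv (inferInstance : IsCyclic (ZMod p)ˣ)
  refine ⟨(AddMonoidHom.toMultiplicative
    (ZMod.castHom (hc ▸ h) (ZMod q)).toAddMonoidHom).comp e.symm.toMonoidHom, ?_⟩
  exact (ZMod.castHom_surjective (hc ▸ h)).comp e.symm.surjective

theorem Nat.Coprime.unitsMap_prod_surjective {m n : ℕ} (h : m.Coprime n) :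
    Function.Surjective ((ZMod.unitsMap (Nat.dvd_mul_right m n)).prod
      (ZMod.unitsMap (Nat.dvd_mul_left n m))) := by
  rintro ⟨a, b⟩
  obtain ⟨c, hc⟩ := ((Units.mapEquiv (ZMod.chineseRemainder h).toMulEquiv).trans
    MulEquiv.prodUnits).surjective (a, b)
  refine ⟨c, hc ▸ Prod.ext (Units.ext ?_) (Units.ext ?_)⟩
  · exact RingHom.congr_fun (RingHom.ext_zmod (ZMod.castHom (Nat.dvd_mul_right m n) (ZMod m))
      ((RingHom.fst _ _).comp (ZMod.chineseRemainder h).toRingHom)) c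
  · exact RingHom.congr_fun (RingHom.ext_zmod (ZMod.castHom (Nat.dvd_mul_left n m) (ZMod n))
      ((RingHom.snd _ _).comp (ZMod.chineseRemainder h).toRingHom)) c

theorem Multiplicative.pow_zmod_eq_one {q : ℕ} (x : Multiplicative (ZMod q)) : x ^ q = 1 := by
  rw [← ofAdd_toAdd x, ← ofAdd_nsmul]
  simp

theorem MonoidHom.eq_one_of_pow_eq {p q : ℕ} [Fact p.Prime] (hq : q ≠ 0)
    (χ : (ZMod p)ˣ →* Multiplicative (ZMod q)) {u : (ZMod p)ˣ}
    (h : ∃ y : ZMod p, y ^ q = u) : χ u = 1 := by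
  obtain ⟨y, hy⟩ := h
  have hy0 : IsUnit y := (isUnit_pow_iff hq).mp (hy ▸ u.isUnit)
  obtain ⟨v, rfl⟩ := hy0
  have : v ^ q = u := Units.ext hy
  rw [← this, map_pow, Multiplicative.pow_zmod_eq_one]

theorem NumberField.image_algebraMap_eq_iff_mem_stabilizer {K : Type*} [Field K] [Algebra ℚ K]
    {P : Ideal (𝓞 K)} {σ : Gal(K/ℚ)} :
    σ '' (algebraMap (𝓞 K) K '' (P : Set (𝓞 K))) = algebraMap (𝓞 K) K '' (P : Set (𝓞 K)) ↔
      σ ∈ MulAction.stabilizer Gal(K/ℚ) P := by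
  have h : σ '' (algebraMap (𝓞 K) K '' (P : Set (𝓞 K))) =
      algebraMap (𝓞 K) K '' ((σ • P : Ideal (𝓞 K)) : Set (𝓞 K)) := by
    ext x
    simp only [Set.mem_image, SetLike.mem_coe, exists_exists_and_eq_and]
    constructor
    · rintro ⟨a, ha, rfl⟩
      exact ⟨σ • a, Ideal.smul_mem_pointwise_smul σ a P ha, rfl⟩
    · rintro ⟨a, ha, rfl⟩
      refine ⟨σ⁻¹ • a, Ideal.mem_pointwise_smul_iff_inv_smul_mem.mp ha, ?_⟩
      exact congrArg (algebraMap (𝓞 K) K) (smul_inv_smul σ a)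
  rw [h, (RingOfIntegers.coe_injective.image_injective).eq_iff, SetLike.coe_set_eq,
    MulAction.mem_stabilizer_iff]

theorem Subgroup.card_le_of_map_mem_zpowers {G M : Type*} [Group G] [Group M] {e : G →* M}
    (he : Function.Injective e) {D : Subgroup G} {m : M} {q : ℕ} (hq : 0 < q) (hm : m ^ q = 1)
    (h : ∀ σ ∈ D, e σ ∈ Subgroup.zpowers m) : Nat.card D ≤ q := by
  have hfin : IsOfFinOrder m := isOfFinOrder_iff_pow_eq_one.mpr ⟨q, hq, hm⟩
  have : Finite (Subgroup.zpowers m) := finite_zpowers.mpr hfin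
  refine (Nat.card_le_card_of_injective (fun σ : D ↦ (⟨e σ, h σ σ.2⟩ : Subgroup.zpowers m))
    fun σ τ hστ ↦ Subtype.ext (he (congrArg Subtype.val hστ))).trans ?_
  rw [Nat.card_zpowers]
  exact orderOf_le_of_pow_eq_one hq hm

/-- Let `p₁`, `p₂` be distinct primes, each a `q`-th power modulo the other, and let `K` be a
subfield of `ℚ(ζ_{p₁p₂})` whose Galois group is cut out by characters `χ₁`, `χ₂` of order `q`
modulo `p₁` and `p₂`. Then all decomposition groups of `K` have order at most `q`. -/
theorem card_stabilizer_le {q p₁ p₂ : ℕ} (hq : 0 < q) [Fact p₁.Prime] [Fact p₂.Prime]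
    (hne : p₁ ≠ p₂) (h₁₂ : ∃ y : ZMod p₂, y ^ q = p₁) (h₂₁ : ∃ y : ZMod p₁, y ^ q = p₂)
    (χ₁ : (ZMod p₁)ˣ →* Multiplicative (ZMod q)) (χ₂ : (ZMod p₂)ˣ →* Multiplicative (ZMod q))
    (K L : Type*) [Field K] [NumberField K] [a : Algebra ℚ K] [IsGalois ℚ K]
    [Field L] [NumberField L] [IsCyclotomicExtension {p₁ * p₂} ℚ L] [Algebra K L]
    (e : Gal(K/ℚ) ≃* Multiplicative (ZMod q) × Multiplicative (ZMod q))
    (he : ∀ (σ : Gal(L/ℚ)) (ρ : Gal(K/ℚ)), (∀ x, σ (algebraMap K L x) = algebraMap K L (ρ x)) →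
      e ρ = (χ₁ (ZMod.unitsMap (Nat.dvd_mul_right p₁ p₂)
          (IsCyclotomicExtension.Rat.galEquivZMod (p₁ * p₂) L σ)),
        χ₂ (ZMod.unitsMap (Nat.dvd_mul_left p₂ p₁)
          (IsCyclotomicExtension.Rat.galEquivZMod (p₁ * p₂) L σ))))
    (p : ℕ) [Fact p.Prime] (P : Ideal (𝓞 K)) [P.IsMaximal] [P.LiesOver (Ideal.span {(p : ℤ)})] :
    Nat.card (MulAction.stabilizer Gal(K/ℚ) P) ≤ q := by
  obtain rfl : a = DivisionRing.toRatAlgebra := Subsingleton.elim _ _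
  have : NeZero q := ⟨hq.ne'⟩
  have hn : p₁.Coprime p₂ := (Nat.coprime_primes Fact.out Fact.out).mpr hne
  have : IsGalois ℚ L := IsCyclotomicExtension.isGalois {p₁ * p₂} ℚ L
  obtain ⟨Q, _, _⟩ := Ideal.exists_maximal_ideal_liesOver_of_isIntegral P (S := 𝓞 L)
  have : Q.LiesOver (Ideal.span {(p : ℤ)}) := Ideal.LiesOver.trans Q P _
  have key {σ : Gal(K/ℚ)} (hσ : σ ∈ MulAction.stabilizer Gal(K/ℚ) P) :=
    exists_mem_stabilizer_forall_algebraMap_eq K L P Q hσ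
  have hcard : Nat.card (Multiplicative (ZMod q)) = q := Nat.card_zmod q
  by_cases hp₁ : p = p₁
  · subst hp₁
    have hsnd {σ : Gal(K/ℚ)} (hσ : σ ∈ MulAction.stabilizer Gal(K/ℚ) P) : (e σ).2 = 1 := by
      obtain ⟨τ, hτ, h⟩ := key hσ
      obtain ⟨k, hk⟩ := IsCyclotomicExtension.Rat.unitsMap_galEquivZMod_mem_zpowers_of_mem_stabilizer
        (p * p₂) L (Nat.dvd_mul_left p₂ p) p Q hn hτ
      rw [he τ σ h, ← hk]
      simp [MonoidHom.eq_one_of_pow_eq hq.ne' χ₂ (u := ZMod.unitOfCoprime p hn) (by simpa using h₁₂)]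
    refine (Nat.card_le_card_of_injective (fun σ : MulAction.stabilizer Gal(K/ℚ) P ↦ (e σ).1)
      fun σ τ h ↦ Subtype.ext (e.injective (Prod.ext h ?_))).trans_eq hcard
    rw [hsnd σ.2, hsnd τ.2]
  by_cases hp₂ : p = p₂
  · subst hp₂
    have hfst {σ : Gal(K/ℚ)} (hσ : σ ∈ MulAction.stabilizer Gal(K/ℚ) P) : (e σ).1 = 1 := by
      obtain ⟨τ, hτ, h⟩ := key hσ
      obtain ⟨k, hk⟩ := IsCyclotomicExtension.Rat.unitsMap_galEquivZMod_mem_zpowers_of_mem_stabilizer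
        (p₁ * p) L (Nat.dvd_mul_right p₁ p) p Q hn.symm hτ
      rw [he τ σ h, ← hk]
      simp [MonoidHom.eq_one_of_pow_eq hq.ne' χ₁ (u := ZMod.unitOfCoprime p hn.symm)
        (by simpa using h₂₁)]
    refine (Nat.card_le_card_of_injective (fun σ : MulAction.stabilizer Gal(K/ℚ) P ↦ (e σ).2)
      fun σ τ h ↦ Subtype.ext (e.injective (Prod.ext ?_ h))).trans_eq hcard
    rw [hfst σ.2, hfst τ.2]
  have hp : p.Coprime (p₁ * p₂) := Nat.Coprime.mul_right
    ((Nat.coprime_primes Fact.out Fact.out).mpr hp₁) ((Nat.coprime_primes Fact.out Fact.out).mpr hp₂)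
  let χ := (χ₁.prodMap χ₂).comp ((ZMod.unitsMap (Nat.dvd_mul_right p₁ p₂)).prod
    (ZMod.unitsMap (Nat.dvd_mul_left p₂ p₁)))
  refine Subgroup.card_le_of_map_mem_zpowers (e := e.toMonoidHom) e.injective hq
    (m := χ (ZMod.unitOfCoprime p hp)) ?_ fun σ hσ ↦ ?_
  · exact Prod.ext (Multiplicative.pow_zmod_eq_one _) (Multiplicative.pow_zmod_eq_one _)
  · obtain ⟨τ, hτ, h⟩ := key hσ
    obtain ⟨k, hk⟩ :=
      IsCyclotomicExtension.Rat.mem_zpowers_galEquivZMod_of_mem_stabilizer (p₁ * p₂) L p Q hp hτ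
    refine ⟨k, (map_zpow χ _ _).symm.trans ?_⟩
    exact (congrArg χ hk).trans (he τ σ h).symm

/-- For every prime `q` there is a finite Galois extension `K/ℚ` with Galois group
`ℤ/q × ℤ/q` such that for every prime `p` and every maximal ideal `𝔓` of `O_K` over `p`,
the decomposition group of `𝔓` has order at most `q`. -/
theorem stmt_14 (q : ℕ) (hq : q.Prime) :
    ∃ K : IntermediateField ℚ (AlgebraicClosure ℚ),
      FiniteDimensional ℚ K ∧ IsGalois ℚ K ∧
      Nonempty ((↥K ≃ₐ[ℚ] ↥K) ≃* Multiplicative (ZMod q × ZMod q)) ∧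
      ∀ (p : ℕ), p.Prime →
        ∀ 𝔓 : Ideal (NumberField.RingOfIntegers K), 𝔓.IsMaximal →
          Ideal.comap (algebraMap ℤ (NumberField.RingOfIntegers K)) 𝔓
            = Ideal.span {(p : ℤ)} →
          Nat.card {σ : ↥K ≃ₐ[ℚ] ↥K |
              σ '' (algebraMap (NumberField.RingOfIntegers K) K ''
                  (𝔓 : Set (NumberField.RingOfIntegers K)))
                = algebraMap (NumberField.RingOfIntegers K) K ''
                  (𝔓 : Set (NumberField.RingOfIntegers K))} ≤ q := by
  obtain ⟨p₁, p₂, hp₁, hp₂, hne, hd₁, hd₂, h₁₂, h₂₁⟩ := exists_prime_pair hq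
  have := Fact.mk hp₁
  have := Fact.mk hp₂
  obtain ⟨χ₁, hχ₁⟩ := exists_surjective_units_zmod hd₁
  obtain ⟨χ₂, hχ₂⟩ := exists_surjective_units_zmod hd₂
  let L := CyclotomicField (p₁ * p₂) ℚ
  have : IsCyclotomicExtension {p₁ * p₂} ℚ L := by
    rw [Subsingleton.elim DivisionRing.toRatAlgebra (CyclotomicField.algebra (p₁ * p₂) ℚ)]
    exact CyclotomicField.isCyclotomicExtension (p₁ * p₂) ℚ
  have : IsGalois ℚ L := IsCyclotomicExtension.isGalois {p₁ * p₂} ℚ L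
  let ψ := ((χ₁.prodMap χ₂).comp ((ZMod.unitsMap (Nat.dvd_mul_right p₁ p₂)).prod
    (ZMod.unitsMap (Nat.dvd_mul_left p₂ p₁)))).comp
      (IsCyclotomicExtension.Rat.galEquivZMod (p₁ * p₂) L).toMonoidHom
  have hψ : Function.Surjective ψ := ((hχ₁.prodMap hχ₂).comp
    ((Nat.coprime_primes hp₁ hp₂).mpr hne).unitsMap_prod_surjective).comp
      (IsCyclotomicExtension.Rat.galEquivZMod (p₁ * p₂) L).surjective
  obtain ⟨K, i, e, hfin, hgal, he⟩ := exists_intermediateField_algebraicClosure_mulEquiv hψ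
  refine ⟨K, hfin, hgal, ⟨e.trans (MulEquiv.prodMultiplicative _ _).symm⟩, fun p hp P hP hPp ↦ ?_⟩
  have := Fact.mk hp
  have : NumberField K := {}
  have : P.LiesOver (Ideal.span {(p : ℤ)}) := ⟨hPp.symm⟩
  let : Algebra K L := i.toRingHom.toAlgebra
  simp only [NumberField.image_algebraMap_eq_iff_mem_stabilizer]
  exact card_stabilizer_le hq.pos hne h₁₂ h₂₁ χ₁ χ₂ K L e he p P
end

section
/- Let f(x) ∈ ℤ[x] be a monic polynomial of degree n ≥ 2, irreducible over ℚ, whose Galois group over ℚ (the Galois group of its splitting field) is isomorphic to the full symmetric group S_n. Then there exist infinitely many primes p such that the reduction of f modulo p is irreducible in 𝔽_p[x]. -/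
open Filter Topology in
theorem exists_abs_tsum_primes_add_log_le {a : ℕ → ℝ} (ha : ∀ n, 0 ≤ a n) (ha1 : a 1 = 1)
    (hmul : ∀ {m n : ℕ}, m.Coprime n → a (m * n) = a m * a n) {N : ℕ}
    (hpow : ∀ p k : ℕ, p.Prime → a (p ^ k) ≤ (k + 1) ^ N)
    (hsum : ∀ s : ℝ, 1 < s → Summable fun n : ℕ ↦ a n * (n : ℝ) ^ (-s)) {ρ : ℝ} (hρ : 0 < ρ)
    (hlim : Tendsto (fun s : ℝ ↦ (s - 1) * ∑' n : ℕ, a n * (n : ℝ) ^ (-s)) (𝓝[>] 1) (𝓝 ρ)) :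
    ∃ B : ℝ, ∀ᶠ s : ℝ in 𝓝[>] 1,
      |(∑' p : Nat.Primes, a p * (p : ℝ) ^ (-s)) + Real.log (s - 1)| ≤ B := by
  have hgeom : Summable fun e : ℕ ↦ ((e : ℝ) + 3) ^ N * (1 / 2 : ℝ) ^ e := by
    have h := (summable_nat_add_iff 3).mpr
      (summable_pow_mul_geometric_of_norm_lt_one N (r := (1 / 2 : ℝ)) (by norm_num))
    refine (h.mul_left 8).congr fun e ↦ ?_
    push_cast
    ring
  set C : ℝ := ∑' e : ℕ, ((e : ℝ) + 3) ^ N * (1 / 2 : ℝ) ^ e with hC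
  have hC0 : 0 ≤ C := tsum_nonneg fun e ↦ by positivity
  set D : ℝ := 2 ^ N + C with hD
  have hsq : Summable fun p : Nat.Primes ↦ (C + D ^ 2) * ((p : ℝ) ^ 2)⁻¹ :=
    ((Real.summable_nat_pow_inv.mpr one_lt_two).comp_injective Subtype.val_injective).mul_left _
  have key (s : ℝ) (hs : 1 < s) : 0 < (∑' n : ℕ, a n * (n : ℝ) ^ (-s)) ∧
      |(∑' p : Nat.Primes, a p * (p : ℝ) ^ (-s)) - Real.log (∑' n : ℕ, a n * (n : ℝ) ^ (-s))| ≤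
        ∑' p : Nat.Primes, (C + D ^ 2) * ((p : ℝ) ^ 2)⁻¹ := by
    set f : ℕ → ℝ := fun n ↦ a n * (n : ℝ) ^ (-s) with hf
    have hf0 : f 0 = 0 := by simp [hf, Real.zero_rpow (by linarith : -s ≠ 0)]
    have hf1 : f 1 = 1 := by simp [hf, ha1]
    have hfnn (n : ℕ) : 0 ≤ f n := mul_nonneg (ha n) (by positivity)
    have hfmul {m n : ℕ} (h : m.Coprime n) : f (m * n) = f m * f n := by
      simp only [hf, hmul h, Nat.cast_mul]
      rw [Real.mul_rpow (by positivity) (by positivity)]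
      ring
    have hfs : Summable f := hsum s hs
    have hprod := EulerProduct.eulerProduct_hasProd hf1 hfmul hfs.norm hf0
    have hpsum (p : Nat.Primes) : Summable fun e ↦ f ((p : ℕ) ^ e) :=
      hfs.comp_injective (Nat.pow_right_injective p.2.two_le)
    have hfle (p : Nat.Primes) (e : ℕ) : f ((p : ℕ) ^ e) ≤ (e + 1) ^ N * ((p : ℝ) ^ e)⁻¹ := by
      have h1 : (1 : ℝ) ≤ (p : ℝ) ^ e := one_le_pow₀ (by exact_mod_cast p.2.one_lt.le)
      simp only [hf]
      push_cast
      rw [← Real.rpow_neg_one]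
      exact mul_le_mul (hpow p e p.2) (Real.rpow_le_rpow_of_exponent_le h1 (by linarith))
        (by positivity) (by positivity)
    have hp2 (p : Nat.Primes) : (2 : ℝ) ≤ (p : ℝ) := by exact_mod_cast p.2.two_le
    have hsplit (p : Nat.Primes) :
        ∑' e, f ((p : ℕ) ^ e) = 1 + (f p + ∑' e, f ((p : ℕ) ^ (e + 2))) := by
      rw [← (hpsum p).sum_add_tsum_nat_add 2]
      simp [Finset.sum_range_succ, hf1, add_assoc]
    have hRnn (p : Nat.Primes) : 0 ≤ ∑' e, f ((p : ℕ) ^ (e + 2)) := tsum_nonneg fun e ↦ hfnn _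
    have hR (p : Nat.Primes) : ∑' e, f ((p : ℕ) ^ (e + 2)) ≤ C * ((p : ℝ) ^ 2)⁻¹ := by
      rw [hC, ← tsum_mul_right]
      refine ((summable_nat_add_iff 2).mpr (hpsum p)).tsum_le_tsum (fun e ↦ ?_)
        (hgeom.mul_right _)
      refine (hfle p (e + 2)).trans ?_
      have : ((p : ℝ) ^ e)⁻¹ ≤ (1 / 2) ^ e := by
        rw [← inv_pow]
        have := hp2 p
        gcongr
        rw [one_div]
        gcongr
      calc (((e + 2 : ℕ) : ℝ) + 1) ^ N * ((p : ℝ) ^ (e + 2))⁻¹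
          = ((e : ℝ) + 3) ^ N * ((p : ℝ) ^ e)⁻¹ * ((p : ℝ) ^ 2)⁻¹ := by
            rw [pow_add, mul_inv]
            push_cast
            ring
        _ ≤ _ := by gcongr
    have hx (p : Nat.Primes) : f p + ∑' e, f ((p : ℕ) ^ (e + 2)) ≤ D * (p : ℝ)⁻¹ := by
      have h1 := hfle p 1
      have h2 : ((p : ℝ) ^ 2)⁻¹ ≤ (p : ℝ)⁻¹ := by
        have := hp2 p
        gcongr
        nlinarith
      have h3 := hR p
      norm_num at h1
      rw [hD, add_mul]
      have := mul_le_mul_of_nonneg_left h2 hC0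
      linarith
    have hlog (p : Nat.Primes) :
        |f p - Real.log (∑' e, f ((p : ℕ) ^ e))| ≤ (C + D ^ 2) * ((p : ℝ) ^ 2)⁻¹ := by
      rw [hsplit]
      set R := ∑' e, f ((p : ℕ) ^ (e + 2)) with hRdef
      set x := f p + R with hxdef
      have hx0 : 0 ≤ x := add_nonneg (hfnn _) (hRnn p)
      have hup : Real.log (1 + x) ≤ x := by
        have := Real.log_le_sub_one_of_pos (by linarith : 0 < 1 + x)
        linarith
      have hlow : x - x ^ 2 ≤ Real.log (1 + x) := by
        refine le_trans ?_ (Real.one_sub_inv_le_log_of_pos (by linarith : 0 < 1 + x))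
        have h : 1 - (1 + x)⁻¹ = x / (1 + x) := by
          have : 1 + x ≠ 0 := by linarith
          field_simp
          ring
        rw [h, le_div_iff₀ (by linarith)]
        nlinarith [pow_nonneg hx0 3]
      have hx2 : x ^ 2 ≤ D ^ 2 * ((p : ℝ) ^ 2)⁻¹ := by
        rw [← inv_pow, ← mul_pow]
        exact pow_le_pow_left₀ hx0 (hx p) 2
      have hR1 := hR p
      have hR0 := hRnn p
      rw [abs_le, add_mul]
      constructor <;> nlinarith [sq_nonneg x]
    have hFpos (p : Nat.Primes) : 0 < ∑' e, f ((p : ℕ) ^ e) := by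
      rw [hsplit]
      have := hfnn p
      have := hRnn p
      linarith
    have hZpos : 0 < ∑' n, f n := hfs.tsum_pos hfnn 1 (by simp [hf1])
    have hlogsum : HasSum (fun p : Nat.Primes ↦ Real.log (∑' e, f ((p : ℕ) ^ e)))
        (Real.log (∑' n, f n)) := by
      have h := ((Real.continuousAt_log hZpos.ne').tendsto.comp hprod)
      refine h.congr fun t ↦ ?_
      simp only [Function.comp_apply]
      exact Real.log_prod fun p _ ↦ (hFpos p).ne'
    have hps : Summable fun p : Nat.Primes ↦ f p := hfs.comp_injective Subtype.val_injective
    refine ⟨hZpos, ?_⟩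
    rw [← hlogsum.tsum_eq, ← hps.tsum_sub hlogsum.summable]
    have habs : Summable fun p : Nat.Primes ↦ |f p - Real.log (∑' e, f ((p : ℕ) ^ e))| :=
      hsq.of_nonneg_of_le (fun p ↦ abs_nonneg _) hlog
    calc _ ≤ ∑' p : Nat.Primes, |f p - Real.log (∑' e, f ((p : ℕ) ^ e))| := by
          simpa [Real.norm_eq_abs] using norm_tsum_le_tsum_norm (f := fun p : Nat.Primes ↦
            f p - Real.log (∑' e, f ((p : ℕ) ^ e))) (by simpa [Real.norm_eq_abs] using habs)
      _ ≤ _ := habs.tsum_le_tsum hlog hsq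
  refine ⟨(∑' p : Nat.Primes, (C + D ^ 2) * ((p : ℝ) ^ 2)⁻¹) + (|Real.log ρ| + 1), ?_⟩
  have hlim' := ((Real.continuousAt_log hρ.ne').tendsto.comp hlim).abs
  filter_upwards [self_mem_nhdsWithin, hlim'.eventually_lt_const (lt_add_one _)] with s hs hs'
  obtain ⟨hpos, hle⟩ := key s hs
  have hs1 : s - 1 ≠ 0 := sub_ne_zero.mpr (ne_of_gt hs)
  simp only [Function.comp_apply] at hs'
  rw [Real.log_mul hs1 hpos.ne'] at hs'
  calc _ = |((∑' p : Nat.Primes, a p * (p : ℝ) ^ (-s)) -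
            Real.log (∑' n : ℕ, a n * (n : ℝ) ^ (-s))) +
            (Real.log (s - 1) + Real.log (∑' n : ℕ, a n * (n : ℝ) ^ (-s)))| := by
          congr 1
          ring
    _ ≤ _ := (abs_add_le _ _).trans (add_le_add hle hs'.le)

section Auxiliary

open NumberField Filter Topology Ideal

/-- The number of ideals of norm `n` in the ring of integers of `K`. -/
noncomputable def idealCount (K : Type*) [Field K] [NumberField K] (n : ℕ) : ℕ :=
  Nat.card {I : Ideal (𝓞 K) // absNorm I = n}

section idealCount

variable (K : Type*) [Field K] [NumberField K]

theorem tendsto_sum_idealCount_div :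
    Tendsto (fun n : ℕ ↦ (∑ k ∈ Finset.Icc 1 n, (idealCount K k : ℝ)) / (n : ℝ)) atTop
      (𝓝 (dedekindZeta_residue K)) := by
  refine ((Ideal.tendsto_norm_le_div_atTop₀ K).comp tendsto_natCast_atTop_atTop).congr fun n ↦ ?_
  simp only [Function.comp_apply, Nat.cast_le, ← Nat.cast_sum, idealCount]
  congr
  rw [← add_left_inj 1, ← card_norm_le_eq_card_norm_le_add_one,
    show Finset.Icc 1 n = Finset.Ioc 0 n from Finset.Icc_succ_left_eq_Ioc _ _,
    show 1 = Nat.card {I : Ideal (𝓞 K) // absNorm I = 0} by simp [Ideal.absNorm_eq_zero_iff],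
    Finset.sum_Ioc_add_eq_sum_Icc (n.zero_le),
    ← Finset.card_preimage_eq_sum_card_image_eq (fun k _ ↦ finite_setOfPred_absNorm_eq k)]
  simp [Set.coe_eq_subtype]

theorem term_idealCount {s : ℝ} (hs : 1 < s) (n : ℕ) :
    LSeries.term (fun n ↦ ((idealCount K n : ℝ) : ℂ)) s n =
      ((idealCount K n * (n : ℝ) ^ (-s) : ℝ) : ℂ) := by
  rcases eq_or_ne n 0 with rfl | hn
  · simp [Real.zero_rpow (by linarith : -s ≠ 0)]
  · rw [LSeries.term_of_ne_zero hn, Real.rpow_neg (by positivity), div_eq_mul_inv]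
    push_cast
    rw [Complex.ofReal_cpow (by positivity)]
    simp

theorem summable_idealCount {s : ℝ} (hs : 1 < s) :
    Summable fun n : ℕ ↦ idealCount K n * (n : ℝ) ^ (-s) := by
  have h : LSeriesSummable (fun n ↦ ((idealCount K n : ℝ) : ℂ)) s :=
    LSeriesSummable_of_sum_norm_bigO_and_nonneg (r := 1)
      (Asymptotics.isBigO_atTop_natCast_rpow_of_tendsto_div_rpow
        (by simpa using! tendsto_sum_idealCount_div K)) (fun _ ↦ Nat.cast_nonneg _) zero_le_one
      (by simpa using hs)
  rw [← Complex.summable_ofReal]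
  exact Summable.congr h fun n ↦ term_idealCount K hs n

theorem tendsto_sub_one_mul_tsum_idealCount :
    Tendsto (fun s : ℝ ↦ (s - 1) * ∑' n : ℕ, idealCount K n * (n : ℝ) ^ (-s)) (𝓝[>] 1)
      (𝓝 (dedekindZeta_residue K)) := by
  have h := LSeries_tendsto_sub_mul_nhds_one_of_tendsto_sum_div_and_nonneg _
    (tendsto_sum_idealCount_div K) (fun _ ↦ Nat.cast_nonneg _)
  have h' := (Complex.continuous_re.tendsto _).comp h
  refine h'.congr' ?_
  filter_upwards [self_mem_nhdsWithin] with s hs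
  simp only [Function.comp_apply, LSeries, term_idealCount K hs, ← Complex.ofReal_tsum]
  rw [← Complex.ofReal_one, ← Complex.ofReal_sub, ← Complex.ofReal_mul, Complex.ofReal_re]

theorem idealCount_one : idealCount K 1 = 1 := by
  simp [idealCount, Ideal.absNorm_eq_one_iff]

variable {K}

theorem isCoprime_of_coprime_absNorm {I J : Ideal (𝓞 K)} (h : (absNorm I).Coprime (absNorm J)) :
    IsCoprime I J := by
  rw [Ideal.isCoprime_iff_add, Ideal.add_eq_sup, Ideal.one_eq_top, Ideal.eq_top_iff_one]
  have h1 : IsCoprime ((absNorm I : ℤ)) (absNorm J : ℤ) := Nat.isCoprime_iff_coprime.mpr h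
  obtain ⟨u, v, huv⟩ := h1
  have : (1 : 𝓞 K) = u * (absNorm I : 𝓞 K) + v * (absNorm J : 𝓞 K) := by
    exact_mod_cast congrArg (Int.cast (R := 𝓞 K)) huv.symm
  rw [this]
  exact Ideal.add_mem _ (Ideal.mul_mem_left _ _ (Ideal.mem_sup_left (Ideal.absNorm_mem I)))
    (Ideal.mul_mem_left _ _ (Ideal.mem_sup_right (Ideal.absNorm_mem J)))

variable (K)

theorem idealCount_mul_of_coprime {m n : ℕ} (h : m.Coprime n) :
    idealCount K (m * n) = idealCount K m * idealCount K n := by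
  rw [idealCount, idealCount, idealCount, ← Nat.card_prod]
  symm
  refine Nat.card_eq_of_bijective
    (fun x ↦ ⟨x.1.1 * x.2.1, by rw [map_mul, x.1.2, x.2.2]⟩) ⟨?_, ?_⟩
  · rintro ⟨⟨I₁, h₁⟩, ⟨I₂, h₂⟩⟩ ⟨⟨J₁, k₁⟩, ⟨J₂, k₂⟩⟩ hIJ
    have hIJ : I₁ * I₂ = J₁ * J₂ := congrArg Subtype.val hIJ
    have c {I J : Ideal (𝓞 K)} (hI : absNorm I = m) (hJ : absNorm J = n) : IsCoprime I J :=
      isCoprime_of_coprime_absNorm (by rwa [hI, hJ])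
    have d1 : I₁ = J₁ := dvd_antisymm
      ((c h₁ k₂).dvd_of_dvd_mul_right (Dvd.intro _ hIJ))
      ((c k₁ h₂).dvd_of_dvd_mul_right (Dvd.intro _ hIJ.symm))
    have d2 : I₂ = J₂ := dvd_antisymm
      ((c k₁ h₂).symm.dvd_of_dvd_mul_left (Dvd.intro_left _ hIJ))
      ((c h₁ k₂).symm.dvd_of_dvd_mul_left (Dvd.intro_left _ hIJ.symm))
    subst d1 d2
    rfl
  · rintro ⟨I, hI⟩
    have hdvd : I ∣ span {(m : 𝓞 K)} * span {(n : 𝓞 K)} := by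
      rw [span_singleton_mul_span_singleton, Ideal.dvd_iff_le, span_singleton_le_iff_mem,
        ← Nat.cast_mul, ← hI]
      exact absNorm_mem I
    obtain ⟨I₁, I₂, h₁, h₂, rfl⟩ := exists_dvd_and_dvd_of_dvd_mul hdvd
    have c {a b : ℕ} {J : Ideal (𝓞 K)} (hJ : J ∣ span {(a : 𝓞 K)}) (hab : a.Coprime b) :
        (absNorm J).Coprime b := by
      have := map_dvd (absNorm (S := 𝓞 K)) hJ
      rw [absNorm_span_natCast] at this
      exact Nat.Coprime.coprime_dvd_left this (hab.pow_left _)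
    have c₁ := c h₁ h
    have c₂ := c h₂ h.symm
    rw [map_mul] at hI
    have e₁ : absNorm I₁ = m := Nat.dvd_antisymm
      (c₁.dvd_of_dvd_mul_right (hI ▸ dvd_mul_right _ _))
      (c₂.symm.dvd_of_dvd_mul_right (hI ▸ dvd_mul_right _ _))
    have e₂ : absNorm I₂ = n := Nat.dvd_antisymm
      (c₂.dvd_of_dvd_mul_left (hI ▸ dvd_mul_left _ _))
      (c₁.symm.dvd_of_dvd_mul_left (hI ▸ dvd_mul_left _ _))
    exact ⟨(⟨I₁, e₁⟩, ⟨I₂, e₂⟩), rfl⟩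

end idealCount

section primePowers

variable (K : Type*) [Field K] [NumberField K]

theorem isMaximal_span_prime {p : ℕ} (hp : p.Prime) : (span {(p : ℤ)}).IsMaximal :=
  have := Fact.mk hp
  Int.ideal_span_isMaximal_of_prime p

theorem card_primesOver_le {p : ℕ} (hp : p.Prime) :
    Nat.card (primesOver (span {(p : ℤ)}) (𝓞 K)) ≤ Module.finrank ℚ K := by
  have := isMaximal_span_prime hp
  rw [Nat.card_eq_fintype_card, ← RingOfIntegers.rank K,
    ← sum_ramification_inertia_eq_finrank (span {(p : ℤ)}) (𝓞 K), Fintype.card_eq_sum_ones]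
  refine Finset.sum_le_sum fun q _ ↦ ?_
  have := q.2.1
  exact Nat.mul_pos (ramificationIdx_pos _ _) (inertiaDeg_pos _ _)

variable {K}

omit [NumberField K] in
theorem mem_primesOver_of_natCast_mem {p : ℕ} (hp : p.Prime) {P : Ideal (𝓞 K)} (hP : P.IsPrime)
    (hmem : (p : 𝓞 K) ∈ P) : P ∈ primesOver (span {(p : ℤ)}) (𝓞 K) := by
  refine ⟨hP, ⟨IsMaximal.eq_of_le (isMaximal_span_prime hp) (IsPrime.under ℤ P).ne_top ?_⟩⟩
  rw [span_singleton_le_iff_mem, under_def, Ideal.mem_comap]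
  simpa using hmem

theorem mem_primesOver_of_mem_normalizedFactors {p k : ℕ} (hp : p.Prime) {I P : Ideal (𝓞 K)}
    (hI : absNorm I = p ^ k) (hP : P ∈ UniqueFactorizationMonoid.normalizedFactors I) :
    P ∈ primesOver (span {(p : ℤ)}) (𝓞 K) := by
  have hP' := isPrime_of_prime (UniqueFactorizationMonoid.prime_of_normalized_factor P hP)
  refine mem_primesOver_of_natCast_mem hp hP' (hP'.mem_of_pow_mem k ?_)
  have := le_of_dvd (UniqueFactorizationMonoid.dvd_of_mem_normalizedFactors hP) (absNorm_mem I)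
  rwa [hI, Nat.cast_pow] at this

theorem ne_bot_of_absNorm_eq_prime_pow {p k : ℕ} (hp : p.Prime) {I : Ideal (𝓞 K)}
    (hI : absNorm I = p ^ k) : I ≠ ⊥ := by
  rintro rfl
  rw [absNorm_bot] at hI
  exact pow_ne_zero k hp.ne_zero hI.symm

theorem count_normalizedFactors_le {p k : ℕ} (hp : p.Prime) {I P : Ideal (𝓞 K)}
    (hI : absNorm I = p ^ k) (hP : P ∈ primesOver (span {(p : ℤ)}) (𝓞 K)) :
    (UniqueFactorizationMonoid.normalizedFactors I).count P ≤ k := by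
  have := isMaximal_span_prime hp
  have := hP.1
  have := hP.2
  have hdvd : P ^ (UniqueFactorizationMonoid.normalizedFactors I).count P ∣ I := by
    conv_rhs =>
      rw [← Ideal.prod_normalizedFactors_eq_self (ne_bot_of_absNorm_eq_prime_pow hp hI)]
    rw [← Multiset.prod_replicate]
    exact Multiset.prod_dvd_prod_of_le (Multiset.le_count_iff_replicate_le.mp le_rfl)
  have h := map_dvd (absNorm (S := 𝓞 K)) hdvd
  rw [map_pow, hI, ← pow_inertiaDeg p P, ← pow_mul, Nat.pow_dvd_pow_iff_le_right hp.one_lt] at h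
  exact (Nat.le_mul_of_pos_left _ (inertiaDeg_pos _ _)).trans h

variable (K)

theorem idealCount_prime_pow_le {p : ℕ} (hp : p.Prime) (k : ℕ) :
    idealCount K (p ^ k) ≤ (k + 1) ^ Module.finrank ℚ K := by
  have hmax := isMaximal_span_prime hp
  have hfin := Set.Finite.to_subtype (IsDedekindDomain.primesOver_finite (span {(p : ℤ)}) (𝓞 K))
  refine le_trans ?_ (Nat.pow_le_pow_right k.succ_pos (card_primesOver_le K hp))
  have : Nat.card (primesOver (span {(p : ℤ)}) (𝓞 K) → Fin (k + 1)) =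
      (k + 1) ^ Nat.card (primesOver (span {(p : ℤ)}) (𝓞 K)) := by
    simp
  rw [← this]
  refine Nat.card_le_card_of_injective (fun I P ↦
    ⟨(UniqueFactorizationMonoid.normalizedFactors I.1).count P.1,
      Nat.lt_succ_of_le (count_normalizedFactors_le hp I.2 P.2)⟩) ?_
  rintro ⟨I, hI⟩ ⟨J, hJ⟩ hIJ
  rw [Subtype.mk.injEq, ← Ideal.prod_normalizedFactors_eq_self (ne_bot_of_absNorm_eq_prime_pow hp hI),
    ← Ideal.prod_normalizedFactors_eq_self (ne_bot_of_absNorm_eq_prime_pow hp hJ)]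
  congr 1
  ext P
  by_cases hP : P ∈ primesOver (span {(p : ℤ)}) (𝓞 K)
  · exact Fin.mk.inj_iff.mp (congrFun hIJ ⟨P, hP⟩)
  · rw [Multiset.count_eq_zero_of_notMem
      fun h ↦ hP (mem_primesOver_of_mem_normalizedFactors hp hI h),
      Multiset.count_eq_zero_of_notMem
      fun h ↦ hP (mem_primesOver_of_mem_normalizedFactors hp hJ h)]

end primePowers

section linear

theorem exists_abs_tsum_primes_idealCount_add_log_le (K : Type*) [Field K] [NumberField K] :
    ∃ B : ℝ, ∀ᶠ s : ℝ in 𝓝[>] 1,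
      |(∑' p : Nat.Primes, idealCount K p * (p : ℝ) ^ (-s)) + Real.log (s - 1)| ≤ B :=
  exists_abs_tsum_primes_add_log_le (a := fun n ↦ idealCount K n) (fun _ ↦ Nat.cast_nonneg _)
    (by simp [idealCount_one]) (fun h ↦ by simp [idealCount_mul_of_coprime K h])
    (fun p k hp ↦ mod_cast idealCount_prime_pow_le K hp k)
    (fun s hs ↦ summable_idealCount K hs) (dedekindZeta_residue_pos K)
    (tendsto_sub_one_mul_tsum_idealCount K)

theorem abs_tsum_primes_mul_rpow_le {c : Nat.Primes → ℝ} (hc : {p | c p ≠ 0}.Finite) {s : ℝ}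
    (hs : 0 ≤ s) : |∑' p : Nat.Primes, c p * (p : ℝ) ^ (-s)| ≤ ∑ p ∈ hc.toFinset, |c p| := by
  rw [tsum_eq_sum (s := hc.toFinset) fun p hp ↦ by simp_all]
  refine (Finset.abs_sum_le_sum_abs _ _).trans (Finset.sum_le_sum fun p _ ↦ ?_)
  have h1 : (1 : ℝ) ≤ p := mod_cast p.2.one_lt.le
  rw [abs_mul, abs_of_nonneg (a := (p : ℝ) ^ (-s)) (by positivity)]
  exact mul_le_of_le_one_right (abs_nonneg _) (Real.rpow_le_one_of_one_le_of_nonpos h1 (by linarith))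

/-- If a linear combination of the ideal counting functions of finitely many number fields vanishes
at almost all primes, then its coefficients sum to zero. -/
theorem sum_eq_zero_of_sum_mul_idealCount_eq_zero {ι : Type*} (T : Finset ι) (K : ι → Type*)
    [∀ i, Field (K i)] [∀ i, NumberField (K i)] (w : ι → ℝ)
    (h : {p : Nat.Primes | ∑ i ∈ T, w i * idealCount (K i) p ≠ 0}.Finite) :
    ∑ i ∈ T, w i = 0 := by
  choose B hB using fun i ↦ exists_abs_tsum_primes_idealCount_add_log_le (K i)
  set M : ℝ := ∑ p ∈ h.toFinset, |∑ i ∈ T, w i * idealCount (K i) p|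
  have hB' : ∀ᶠ s : ℝ in 𝓝[>] 1, ∀ i ∈ T,
      |(∑' p : Nat.Primes, idealCount (K i) p * (p : ℝ) ^ (-s)) + Real.log (s - 1)| ≤ B i :=
    (Filter.eventually_all_finset T).mpr fun i _ ↦ hB i
  have hbound : ∀ᶠ s : ℝ in 𝓝[>] 1,
      |(∑ i ∈ T, w i) * Real.log (s - 1)| ≤ M + ∑ i ∈ T, |w i| * B i := by
    filter_upwards [hB', self_mem_nhdsWithin] with s hBs (hs : 1 < s)
    have hsum (i : ι) : Summable fun p : Nat.Primes ↦ idealCount (K i) p * (p : ℝ) ^ (-s) :=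
      (summable_idealCount (K i) hs).comp_injective Nat.Primes.coe_nat_injective
    have h1 : ∑ i ∈ T, w i * ∑' p : Nat.Primes, idealCount (K i) p * (p : ℝ) ^ (-s) =
        ∑' p : Nat.Primes, (∑ i ∈ T, w i * idealCount (K i) p) * (p : ℝ) ^ (-s) := by
      simp_rw [← tsum_mul_left, Finset.sum_mul, mul_assoc]
      exact (Summable.tsum_finsetSum fun i _ ↦ (hsum i).mul_left _).symm
    have h2 : (∑ i ∈ T, w i) * Real.log (s - 1) = ∑ i ∈ T, w i *
        ((∑' p : Nat.Primes, idealCount (K i) p * (p : ℝ) ^ (-s)) + Real.log (s - 1)) -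
        ∑' p : Nat.Primes, (∑ i ∈ T, w i * idealCount (K i) p) * (p : ℝ) ^ (-s) := by
      rw [← h1, ← Finset.sum_sub_distrib, Finset.sum_mul]
      exact Finset.sum_congr rfl fun i _ ↦ by ring
    rw [h2, add_comm]
    refine (abs_sub _ _).trans (add_le_add ?_ (abs_tsum_primes_mul_rpow_le h (by linarith)))
    refine (Finset.abs_sum_le_sum_abs _ _).trans (Finset.sum_le_sum fun i hi ↦ ?_)
    rw [abs_mul]
    exact mul_le_mul_of_nonneg_left (hBs i hi) (abs_nonneg _)
  by_contra hw
  have hlog : Tendsto (fun s : ℝ ↦ |(∑ i ∈ T, w i) * Real.log (s - 1)|) (𝓝[>] 1) atTop := by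
    simp_rw [abs_mul]
    refine (tendsto_abs_atBot_atTop.comp ?_).const_mul_atTop (abs_pos.mpr hw)
    refine Real.tendsto_log_nhdsGT_zero.comp ?_
    refine tendsto_nhdsWithin_iff.mpr ⟨?_, ?_⟩
    · exact ((continuous_id.sub continuous_const).tendsto' (1 : ℝ) 0 (by simp)).mono_left
        nhdsWithin_le_nhds
    · filter_upwards [self_mem_nhdsWithin] with s (hs : 1 < s)
      simpa using hs
  obtain ⟨s, hs1, hs2⟩ :=
    (hbound.and (hlog.eventually_gt_atTop (M + ∑ i ∈ T, |w i| * B i))).exists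
  linarith

end linear

section Galois

open scoped Pointwise

theorem card_subgroupOf_eq_card_iff {G : Type*} [Group G] [Finite G] {D H : Subgroup G} :
    Nat.card (H.subgroupOf D) = Nat.card H ↔ H ≤ D := by
  rw [← Subgroup.card_map_of_injective D.subtype_injective, Subgroup.subgroupOf_map_subtype,
    ← inf_eq_left]
  exact ⟨fun h ↦ Subgroup.eq_of_le_of_card_ge inf_le_left h.ge, fun h ↦ by rw [h]⟩

theorem inertia_subgroup_eq_bot {G R : Type*} [Group G] [CommRing R] [MulSemiringAction G R]
    (D : Subgroup G) {Q : Ideal R} (hQ : Ideal.inertia G Q = ⊥) : Ideal.inertia D Q = ⊥ := by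
  refine (Subgroup.eq_bot_iff_forall _).mpr fun d hd ↦ ?_
  have : (d : G) ∈ Ideal.inertia G Q := fun x ↦ hd x
  rw [hQ, Subgroup.mem_bot] at this
  exact_mod_cast this

variable {G L : Type*} [Group G] [Finite G] [Field L] [MulSemiringAction G (𝓞 L)]

theorem inertiaDeg_eq_card_stabilizer {E : Type*} [Field E] [NumberField E] [Algebra E L]
    [IsGaloisGroup G (𝓞 E) (𝓞 L)] {Q : Ideal (𝓞 L)} [Q.IsPrime]
    (hQ : Ideal.inertia G Q = ⊥) :
    Q.inertiaDeg (𝓞 E) = Nat.card (MulAction.stabilizer G Q) := by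
  rw [Ideal.card_stabilizer_eq_card_inertia_mul_finrank (Q.under (𝓞 E)) Q, hQ,
    Subgroup.card_bot, one_mul]

theorem inertiaDeg_eq_card_subgroupOf (D : Subgroup G) (E : Type*) [Field E] [NumberField E]
    [Algebra E L] [IsGaloisGroup D (𝓞 E) (𝓞 L)] {Q : Ideal (𝓞 L)} [Q.IsPrime]
    (hQ : Ideal.inertia G Q = ⊥) :
    Q.inertiaDeg (𝓞 E) = Nat.card ((MulAction.stabilizer G Q).subgroupOf D) :=
  inertiaDeg_eq_card_stabilizer (G := D) (inertia_subgroup_eq_bot D hQ)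

variable [NumberField L]

theorem absNorm_under_eq_iff [IsGaloisGroup G ℤ (𝓞 L)] (D : Subgroup G) (E : Type*) [Field E]
    [NumberField E] [Algebra E L] [IsGaloisGroup D (𝓞 E) (𝓞 L)] {p : ℕ} (hp : p.Prime)
    {Q : Ideal (𝓞 L)} (hQp : Q ∈ primesOver (span {(p : ℤ)}) (𝓞 L))
    (hQ : Ideal.inertia G Q = ⊥) :
    absNorm (Q.under (𝓞 E)) = p ↔ MulAction.stabilizer G Q ≤ D := by
  have := hQp.1
  have := hQp.2
  have := isMaximal_span_prime hp
  have : (Q.under (𝓞 E)).LiesOver (span {(p : ℤ)}) := by infer_instance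
  have h1 := inertiaDeg_eq_card_subgroupOf D E hQ
  have h2 : Q.inertiaDeg ℤ = Nat.card (MulAction.stabilizer G Q) := by
    rw [Ideal.card_stabilizer_eq_card_inertia_mul_finrank (span {(p : ℤ)}) Q, hQ]
    simp
  have h4 := Ideal.inertiaDeg_tower (R := ℤ) (Q.under (𝓞 E)) Q
  have h5 := inertiaDeg_pos (R := 𝓞 E) Q
  rw [← pow_inertiaDeg p, ← card_subgroupOf_eq_card_iff, ← h1, ← h2, h4]
  nth_rw 2 [← pow_one p]
  rw [Nat.pow_right_injective hp.two_le |>.eq_iff]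
  exact ⟨fun h ↦ by rw [h, one_mul],
    fun h ↦ Nat.eq_of_mul_eq_mul_right h5 (by rw [one_mul, ← h])⟩

open scoped Classical in
/-- For a prime `p` unramified in the Galois extension `L/ℚ` with group `G`, and `E` the fixed field
of `D ≤ G`, the ideals of norm `p` of `E` are counted by the primes of `L` above `p` whose
decomposition group is contained in `D`. -/
theorem idealCount_mul_card [IsGaloisGroup G ℤ (𝓞 L)] (D : Subgroup G) (E : Type*) [Field E]
    [NumberField E] [Algebra E L] [IsGaloisGroup D (𝓞 E) (𝓞 L)] {p : ℕ} (hp : p.Prime)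
    {S : Finset (Ideal (𝓞 L))} (hS : ∀ Q, Q ∈ S ↔ Q ∈ primesOver (span {(p : ℤ)}) (𝓞 L))
    (hQ : ∀ Q ∈ S, Ideal.inertia G Q = ⊥) :
    idealCount E p * Nat.card D =
      ∑ Q ∈ S with MulAction.stabilizer G Q ≤ D, Nat.card (MulAction.stabilizer G Q) := by
  have hfin : {I : Ideal (𝓞 E) | absNorm I = p}.Finite := finite_setOfPred_absNorm_eq p
  have hcount : idealCount E p = hfin.toFinset.card := by
    rw [← Set.ncard_eq_toFinset_card _ hfin]
    rfl
  rw [← Finset.sum_fiberwise_of_maps_to (t := hfin.toFinset) (g := fun Q ↦ Q.under (𝓞 E)),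
    hcount, ← smul_eq_mul, ← Finset.sum_const]
  · refine Finset.sum_congr rfl fun I hI ↦ ?_
    have hI : absNorm I = p := by simpa using hI
    have hIp : I.IsPrime := isPrime_of_irreducible_absNorm (by rwa [hI])
    have hIo := (mem_primesOver_of_natCast_mem hp hIp (by simpa [hI] using absNorm_mem I)).2
    have hmem (Q : Ideal (𝓞 L)) : Q ∈ primesOver I (𝓞 L) ↔
        Q ∈ {Q ∈ {Q ∈ S | MulAction.stabilizer G Q ≤ D} | Q.under (𝓞 E) = I} := by
      simp only [Finset.mem_filter]
      constructor
      · rintro ⟨h1, h2⟩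
        have hQS : Q ∈ primesOver (span {(p : ℤ)}) (𝓞 L) := ⟨h1, LiesOver.trans Q I _⟩
        refine ⟨⟨(hS Q).mpr hQS, ?_⟩, h2.over.symm⟩
        rw [← absNorm_under_eq_iff D E hp hQS (hQ Q ((hS Q).mpr hQS)), ← h2.over, hI]
      · rintro ⟨⟨h1, -⟩, h2⟩
        exact ⟨((hS Q).mp h1).1, ⟨h2.symm⟩⟩
    have hcard : ∀ Q ∈ primesOver I (𝓞 L), (primesOver I (𝓞 L)).ncard *
        Nat.card (MulAction.stabilizer G Q) = Nat.card D := by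
      intro Q hQI
      have := hQI.1
      have := hQI.2
      have h1 := (hmem Q).mp hQI
      simp only [Finset.mem_filter] at h1
      have h2 := Ideal.ncard_primesOver_mul_card_inertia_mul_finrank (G := D) I Q
      have hQ' := hQ Q h1.1.1
      rwa [inertia_subgroup_eq_bot D hQ', inertiaDeg_eq_card_subgroupOf D E hQ',
        card_subgroupOf_eq_card_iff.mpr h1.1.2, Subgroup.card_bot, mul_one] at h2
    have hn : (primesOver I (𝓞 L)).ncard ≠ 0 :=
      have := hIp.isMaximal (by rintro rfl; exact hp.ne_zero (by simpa using hI.symm))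
      IsDedekindDomain.primesOver_ncard_ne_zero I (𝓞 L)
    have hset : primesOver I (𝓞 L) =
        ({Q ∈ {Q ∈ S | MulAction.stabilizer G Q ≤ D} | Q.under (𝓞 E) = I} : Finset _) := by
      ext Q
      rw [hmem, Finset.mem_coe]
    refine Nat.eq_of_mul_eq_mul_left (Nat.pos_of_ne_zero hn) ?_
    rw [Finset.mul_sum, Finset.sum_congr rfl fun Q hQ ↦ hcard Q ((hmem Q).mpr hQ),
      Finset.sum_const, hset, Set.ncard_coe_finset, smul_eq_mul]
  · intro Q hQS
    simp only [Finset.mem_filter] at hQS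
    simpa using (absNorm_under_eq_iff D E hp ((hS Q).mp hQS.1) (hQ Q hQS.1)).mpr hQS.2

end Galois

section Moebius

open ArithmeticFunction

open scoped ArithmeticFunction.Moebius

theorem zpowers_pow_le_zpowers_pow_iff {G : Type*} [Group G] (σ : G) {d k : ℕ}
    (hd : d ∣ orderOf σ) :
    Subgroup.zpowers (σ ^ k) ≤ Subgroup.zpowers (σ ^ d) ↔ d ∣ k := by
  rw [Subgroup.zpowers_le, Subgroup.mem_zpowers_iff]
  constructor
  · rintro ⟨z, hz⟩
    rw [← zpow_natCast, ← zpow_natCast, ← zpow_mul, zpow_eq_zpow_iff_modEq] at hz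
    have := hz.of_dvd (Int.natCast_dvd_natCast.mpr hd)
    exact Int.natCast_dvd_natCast.mp (this.dvd_iff.mp (dvd_mul_right _ _))
  · rintro ⟨c, rfl⟩
    exact ⟨c, by rw [pow_mul, zpow_natCast]⟩

open scoped Classical in
theorem sum_moebius_ite_le_zpowers_eq_zero {G : Type*} [Group G] [Finite G] {σ : G}
    {H : Subgroup G} (hH : H ≠ Subgroup.zpowers σ) :
    ∑ d ∈ (orderOf σ).divisors, (if H ≤ Subgroup.zpowers (σ ^ d) then μ d else 0) = 0 := by
  have hle (d : ℕ) : Subgroup.zpowers (σ ^ d) ≤ Subgroup.zpowers σ :=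
    Subgroup.zpowers_le.mpr (Subgroup.pow_mem _ (Subgroup.mem_zpowers σ) d)
  by_cases hHC : H ≤ Subgroup.zpowers σ
  swap
  · exact Finset.sum_eq_zero fun d _ ↦ if_neg fun h ↦ hHC (h.trans (hle d))
  obtain ⟨k, rfl⟩ : ∃ k : ℕ, H = Subgroup.zpowers (σ ^ k) := by
    have := isCyclic_of_injective (Subgroup.inclusion hHC) (Subgroup.inclusion_injective hHC)
    obtain ⟨g, rfl⟩ := (Subgroup.isCyclic_iff_exists_zpowers_eq_top H).mp this
    obtain ⟨k, hk⟩ := mem_powers_iff_mem_zpowers.mpr (Subgroup.zpowers_le.mp hHC)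
    exact ⟨k, by rw [← hk]⟩
  have hm : orderOf σ ≠ 0 := (orderOf_pos σ).ne'
  have hg : (orderOf σ).gcd k ≠ 1 := by
    intro h
    refine hH (Subgroup.eq_of_le_of_card_ge (hle k) ?_)
    rw [Nat.card_zpowers, Nat.card_zpowers, Nat.Coprime.orderOf_pow h]
  rw [← Finset.sum_filter]
  have : {d ∈ (orderOf σ).divisors | Subgroup.zpowers (σ ^ k) ≤ Subgroup.zpowers (σ ^ d)} =
      ((orderOf σ).gcd k).divisors := by
    ext d
    simp only [Finset.mem_filter, Nat.mem_divisors, Nat.dvd_gcd_iff]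
    constructor
    · rintro ⟨⟨h1, h2⟩, h3⟩
      exact ⟨⟨h1, (zpowers_pow_le_zpowers_pow_iff σ h1).mp h3⟩, by simp [hm]⟩
    · rintro ⟨⟨h1, h2⟩, -⟩
      exact ⟨⟨h1, hm⟩, (zpowers_pow_le_zpowers_pow_iff σ h1).mpr h2⟩
  rw [this, ← coe_mul_zeta_apply, moebius_mul_coe_zeta, one_apply_ne hg]

theorem sum_moebius_mul_div_ne_zero {m : ℕ} (hm : m ≠ 0) :
    ∑ d ∈ m.divisors, (μ d : ℝ) * (m / d : ℕ) ≠ 0 := by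
  have h := (sum_eq_iff_sum_mul_moebius_eq (R := ℝ) (f := fun n ↦ (n.totient : ℝ))
    (g := fun n ↦ (n : ℝ))).mp (fun n _ ↦ mod_cast n.sum_totient) m (Nat.pos_of_ne_zero hm)
  rw [Nat.sum_divisorsAntidiagonal (f := fun a b ↦ (μ a : ℝ) * (b : ℝ))] at h
  rw [h]
  simpa using hm

end Moebius

section Frobenius

open scoped Pointwise ArithmeticFunction.Moebius

variable {L : Type*} [Field L] [NumberField L]

theorem finite_setOf_prime_mem {x : 𝓞 L} (hx : x ≠ 0) :
    {p : ℕ | p.Prime ∧ ∃ Q ∈ primesOver (span {(p : ℤ)}) (𝓞 L), x ∈ Q}.Finite := by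
  refine (absNorm (span {x})).primeFactors.finite_toSet.subset ?_
  rintro p ⟨hp, Q, hQ, hxQ⟩
  have := hQ.1
  have := hQ.2
  have := isMaximal_span_prime hp
  refine Nat.mem_primeFactors.mpr ⟨hp, ?_, by simpa [absNorm_eq_zero_iff] using hx⟩
  refine dvd_trans ?_ (absNorm_dvd_absNorm_of_le ((span_singleton_le_iff_mem _).mpr hxQ))
  rw [← pow_inertiaDeg p Q]
  exact dvd_pow_self p (inertiaDeg_pos _ _).ne'

theorem finite_setOf_prime_inertia_ne_bot {G : Type*} [Group G] [Finite G]
    [MulSemiringAction G (𝓞 L)] [FaithfulSMul G (𝓞 L)] :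
    {p : ℕ | p.Prime ∧ ∃ Q ∈ primesOver (span {(p : ℤ)}) (𝓞 L),
      Ideal.inertia G Q ≠ ⊥}.Finite := by
  have h (g : G) : ∃ x : 𝓞 L, g ≠ 1 → g • x - x ≠ 0 := by
    by_contra! hx
    refine (hx 0).1 (FaithfulSMul.eq_of_smul_eq_smul fun y : 𝓞 L ↦ ?_)
    rw [one_smul, ← sub_eq_zero]
    exact (hx y).2
  choose x hx using h
  refine (Set.finite_iUnion fun g : {g : G // g ≠ 1} ↦
    finite_setOf_prime_mem (hx g.1 g.2)).subset ?_
  rintro p ⟨hp, Q, hQ, hQi⟩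
  obtain ⟨⟨g, hg⟩, hg1⟩ := Subgroup.ne_bot_iff_exists_ne_one.mp hQi
  replace hg1 : g ≠ 1 := fun h ↦ hg1 (Subtype.ext h)
  exact Set.mem_iUnion.mpr ⟨⟨g, hg1⟩, hp, Q, hQ, hg (x g)⟩

/-- A weak form of the Frobenius density theorem: each cyclic subgroup of the Galois group of `L/ℚ`
is the decomposition group of a prime of `L` over infinitely many rational primes. -/
theorem infinite_setOf_prime_stabilizer_eq_zpowers [IsGalois ℚ L] (σ : L ≃ₐ[ℚ] L) :
    {p : ℕ | p.Prime ∧ ∃ Q ∈ primesOver (span {(p : ℤ)}) (𝓞 L),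
      MulAction.stabilizer (L ≃ₐ[ℚ] L) Q = Subgroup.zpowers σ}.Infinite := by
  classical
  intro hfin
  have : IsGaloisGroup (L ≃ₐ[ℚ] L) ℤ (𝓞 L) := inferInstance
  have : FaithfulSMul (L ≃ₐ[ℚ] L) (𝓞 L) := IsGaloisGroup.faithful ℤ
  let D : ℕ → Subgroup (L ≃ₐ[ℚ] L) := fun d ↦ Subgroup.zpowers (σ ^ d)
  let E : ℕ → IntermediateField ℚ L := fun d ↦ FixedPoints.intermediateField (D d)
  have hE (d : ℕ) : IsGaloisGroup (D d) (𝓞 (E d)) (𝓞 L) :=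
    IsGaloisGroup.of_isFractionRing (D d) _ (𝓞 L) (E d) L
  have hm : orderOf σ ≠ 0 := (orderOf_pos σ).ne'
  refine sum_moebius_mul_div_ne_zero hm ?_
  refine sum_eq_zero_of_sum_mul_idealCount_eq_zero _ (fun d ↦ E d) _ ?_
  have hbad := hfin.union (finite_setOf_prime_inertia_ne_bot (L := L) (G := L ≃ₐ[ℚ] L))
  refine (hbad.preimage Nat.Primes.coe_nat_injective.injOn).subset fun p hp ↦ ?_
  by_contra hgood
  refine hp ?_
  simp only [Set.mem_preimage, Set.mem_union, Set.mem_ofPred_eq, p.2, true_and, not_or,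
    not_exists, not_and, not_not] at hgood
  have := isMaximal_span_prime p.2
  set S := (IsDedekindDomain.primesOver_finite (span {((p : ℕ) : ℤ)}) (𝓞 L)).toFinset with hS
  have hmemS (Q : Ideal (𝓞 L)) : Q ∈ S ↔ Q ∈ primesOver (span {((p : ℕ) : ℤ)}) (𝓞 L) := by
    simp [hS]
  have hcount (d : ℕ) (hd : d ∈ (orderOf σ).divisors) :
      (μ d : ℝ) * (orderOf σ / d : ℕ) * idealCount (E d) p =
        ∑ Q ∈ S, (Nat.card (MulAction.stabilizer (L ≃ₐ[ℚ] L) Q) : ℝ) *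
        ((if MulAction.stabilizer (L ≃ₐ[ℚ] L) Q ≤ D d then μ d else 0 : ℤ) : ℝ) := by
    have h1 := idealCount_mul_card (D d) (E d) p.2 hmemS fun Q hQ ↦ hgood.2 Q ((hmemS Q).mp hQ)
    have h2 : Nat.card (D d) = orderOf σ / d := by
      rw [Nat.card_zpowers, orderOf_pow_of_dvd (Nat.pos_of_mem_divisors hd).ne'
        (Nat.dvd_of_mem_divisors hd)]
    rw [h2] at h1
    rw [mul_assoc, mul_comm (_ : ℝ) (idealCount _ _ : ℝ), ← Nat.cast_mul, h1, Finset.sum_filter,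
      Nat.cast_sum, Finset.mul_sum]
    refine Finset.sum_congr rfl fun Q _ ↦ ?_
    split_ifs <;> simp [mul_comm]
  rw [Finset.sum_congr rfl hcount, Finset.sum_comm]
  refine Finset.sum_eq_zero fun Q hQ ↦ ?_
  rw [← Finset.mul_sum, ← Int.cast_sum,
    sum_moebius_ite_le_zpowers_eq_zero (hgood.1 Q ((hmemS Q).mp hQ)), Int.cast_zero, mul_zero]

end Frobenius

section Irreducible

open Polynomial

/-- If a ring endomorphism preserving the prime ideal `Q` above `p` permutes cyclically the roots
of a monic polynomial `f` and these roots are distinct modulo `Q`, then `f` is irreducible modulo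
`p`. -/
theorem irreducible_map_zmod_of_cyclic {R : Type*} [CommRing R] {Q : Ideal R} [Q.IsPrime] {p : ℕ}
    (hp : p.Prime) (hpQ : (p : R) ∈ Q) {m : ℕ} {f : ℤ[X]} (hf : f.Monic)
    (hdeg : f.natDegree = m + 1) {β : Fin (m + 1) → R} (hroot : ∀ i, aeval (β i) f = 0)
    (hβ : ∀ i j, i ≠ j → β i - β j ∉ Q) {φ : R →+* R} (hφ : ∀ x ∈ Q, φ x ∈ Q)
    (hφβ : ∀ i, φ (β i) = β (i + 1)) :
    Irreducible (f.map (Int.castRingHom (ZMod p))) := by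
  have := Fact.mk hp
  have : CharP (R ⧸ Q) p := (CharP.charP_iff_prime_eq_zero hp).mpr <| by
    rw [← map_natCast (Ideal.Quotient.mk Q), Ideal.Quotient.eq_zero_iff_mem]
    exact hpQ
  let ψ : ZMod p →+* R ⧸ Q := ZMod.castHom dvd_rfl _
  have heval (A : ℤ[X]) (x : R) :
      (A.map (Int.castRingHom (ZMod p))).eval₂ ψ (Ideal.Quotient.mk Q x) =
        Ideal.Quotient.mk Q (aeval x A) := by
    rw [eval₂_map, aeval_def, hom_eval₂]
    congr 1
    exact RingHom.ext_int _ _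
  have hsurj (a : (ZMod p)[X]) : ∃ A : ℤ[X], A.map (Int.castRingHom (ZMod p)) = a :=
    map_surjective _ ZMod.intCast_surjective a
  have hdegmap : (f.map (Int.castRingHom (ZMod p))).natDegree = m + 1 := by
    rw [hf.natDegree_map, hdeg]
  classical
  have hunit {a b : (ZMod p)[X]} (hab : f.map (Int.castRingHom (ZMod p)) = a * b)
      (ha : a.eval₂ ψ (Ideal.Quotient.mk Q (β 0)) = 0) : IsUnit b := by
    have hab0 : a * b ≠ 0 := hab ▸ (hf.map _).ne_zero
    have hall (i : Fin (m + 1)) : a.eval₂ ψ (Ideal.Quotient.mk Q (β i)) = 0 := by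
      obtain ⟨A, rfl⟩ := hsurj a
      simp only [heval, Ideal.Quotient.eq_zero_iff_mem] at ha ⊢
      induction i using Fin.induction with
      | zero => exact ha
      | succ i ih =>
        have := hφ _ ih
        rwa [aeval_def, hom_eval₂, hφβ, Fin.coeSucc_eq_succ,
          RingHom.ext_int (φ.comp _) (algebraMap ℤ R), ← aeval_def] at this
    have hinj : Function.Injective fun i ↦ Ideal.Quotient.mk Q (β i) := by
      intro i j hij
      by_contra hne
      exact hβ i j hne (Ideal.Quotient.eq.mp hij)
    have ha0 : a.map ψ ≠ 0 :=
      (Polynomial.map_ne_zero_iff ψ.injective).mpr (left_ne_zero_of_mul hab0)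
    have hcard : m + 1 ≤ a.natDegree := by
      rw [← natDegree_map_eq_of_injective ψ.injective a, ← Fintype.card_fin (m + 1),
        ← Finset.card_univ, ← Finset.card_image_of_injective _ hinj]
      refine card_le_degree_of_subset_roots fun x hx ↦ ?_
      obtain ⟨i, -, rfl⟩ := Finset.mem_image.mp (Finset.mem_val.mp hx)
      rw [mem_roots ha0, IsRoot, eval_map, hall i]
    have hsum := congrArg natDegree hab
    rw [natDegree_mul (left_ne_zero_of_mul hab0) (right_ne_zero_of_mul hab0), hdegmap] at hsum
    exact isUnit_iff_degree_eq_zero.mpr <| by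
      rw [degree_eq_natDegree (right_ne_zero_of_mul hab0)]
      exact_mod_cast (by omega : b.natDegree = 0)
  refine irreducible_iff.mpr ⟨fun h ↦ ?_, fun a b hab ↦ ?_⟩
  · have := natDegree_eq_zero_of_isUnit h
    omega
  · have h0 := heval f (β 0)
    rw [hroot, map_zero, hab, eval₂_mul] at h0
    rcases mul_eq_zero.mp h0 with h | h
    · exact Or.inr (hunit hab h)
    · exact Or.inl (hunit (hab.trans (mul_comm a b)) h)

/-- If the Galois group of a separable polynomial of degree `n` has order `n!`, then every
permutation of its roots is induced by an element of the Galois group. -/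
theorem exists_algEquiv_apply_rootSet_eq {F K : Type*} [Field F] [Field K] [Algebra F K]
    {g : F[X]} [g.IsSplittingField F K] (hg : g.Separable)
    (hcard : Nat.card (K ≃ₐ[F] K) = g.natDegree.factorial) (τ : Equiv.Perm (g.rootSet K)) :
    ∃ σ : K ≃ₐ[F] K, ∀ x : g.rootSet K, σ x = τ x := by
  have hmaps (σ : K ≃ₐ[F] K) (x : g.rootSet K) : σ x ∈ g.rootSet K := by
    have := x.2
    rw [mem_rootSet'] at this ⊢
    exact ⟨this.1, by rw [aeval_algHom_apply σ, this.2, map_zero]⟩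
  let Φ : (K ≃ₐ[F] K) → Equiv.Perm (g.rootSet K) := fun σ ↦
    { toFun := fun x ↦ ⟨σ x, hmaps σ x⟩
      invFun := fun x ↦ ⟨σ.symm x, hmaps σ.symm x⟩
      left_inv := fun x ↦ Subtype.ext (σ.symm_apply_apply x)
      right_inv := fun x ↦ Subtype.ext (σ.apply_symm_apply x) }
  have hinj : Function.Injective Φ := by
    intro σ τ h
    have : (σ : K →ₐ[F] K) = τ := by
      refine AlgHom.ext_of_adjoin_eq_top (IsSplittingField.adjoin_rootSet K g) fun x hx ↦ ?_
      exact congrArg Subtype.val (Equiv.ext_iff.mp h ⟨x, hx⟩)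
    exact AlgEquiv.coe_toAlgHom_injective this
  have hroots : Fintype.card (g.rootSet K) = g.natDegree :=
    card_rootSet_eq_natDegree hg (IsSplittingField.splits K g)
  have : Finite (K ≃ₐ[F] K) := Finite.of_injective Φ hinj
  have hbij : Function.Bijective Φ := (Nat.bijective_iff_injective_and_card Φ).mpr ⟨hinj, by
    classical
    rw [hcard, Nat.card_eq_fintype_card, Fintype.card_perm, hroots]⟩
  obtain ⟨σ, hσ⟩ := hbij.2 τ
  exact ⟨σ, fun x ↦ by rw [← hσ]; rfl⟩

open scoped Pointwise in
theorem infinite_setOf_prime_irreducible_map_zmod {m : ℕ} {f : ℤ[X]} (hf : f.Monic)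
    (hdeg : f.natDegree = m + 1) (hirr : Irreducible (f.map (Int.castRingHom ℚ)))
    (K : Type*) [Field K] [NumberField K] [(f.map (Int.castRingHom ℚ)).IsSplittingField ℚ K]
    (hcard : Nat.card (K ≃ₐ[ℚ] K) = (m + 1).factorial) :
    {p : ℕ | p.Prime ∧ Irreducible (f.map (Int.castRingHom (ZMod p)))}.Infinite := by
  set g := f.map (Int.castRingHom ℚ) with hg
  have hsep : g.Separable := hirr.separable
  have hgdeg : g.natDegree = m + 1 := by rw [hg, hf.natDegree_map, hdeg]
  have : IsGalois ℚ K := IsGalois.of_separable_splitting_field hsep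
  rw [← hgdeg] at hcard
  have hroots : Fintype.card (g.rootSet K) = m + 1 := by
    rw [card_rootSet_eq_natDegree hsep (IsSplittingField.splits K g), hgdeg]
  let α : Fin (m + 1) ≃ g.rootSet K := (Fintype.equivFinOfCardEq hroots).symm
  obtain ⟨σ, hσ⟩ := exists_algEquiv_apply_rootSet_eq hsep hcard
    ((α.symm.trans (finRotate (m + 1))).trans α)
  have hα (i : Fin (m + 1)) : aeval (α i : K) f = 0 := by
    have := (mem_rootSet.mp (α i).2).2
    exact (aeval_map_algebraMap ℚ (α i : K) f).symm.trans this
  let β : Fin (m + 1) → 𝓞 K := fun i ↦ ⟨α i, f, hf, hα i⟩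
  have hβinj : Function.Injective β := fun i j h ↦
    α.injective (Subtype.ext (congrArg (algebraMap (𝓞 K) K) h))
  have hβroot (i : Fin (m + 1)) : aeval (β i) f = 0 := by
    apply RingOfIntegers.coe_injective
    rw [← aeval_algebraMap_apply, map_zero]
    exact hα i
  have hσβ (i : Fin (m + 1)) : σ • β i = β (i + 1) := by
    apply RingOfIntegers.coe_injective
    refine (hσ (α i)).trans ?_
    simp only [Equiv.trans_apply, Equiv.symm_apply_apply, finRotate_apply]
    rfl
  have hbad : (⋃ x : {x : Fin (m + 1) × Fin (m + 1) // x.1 ≠ x.2},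
      {p : ℕ | p.Prime ∧ ∃ Q ∈ primesOver (span {(p : ℤ)}) (𝓞 K), β x.1.1 - β x.1.2 ∈ Q}).Finite :=
    Set.finite_iUnion fun x ↦ finite_setOf_prime_mem (sub_ne_zero.mpr (hβinj.ne x.2))
  refine ((infinite_setOf_prime_stabilizer_eq_zpowers σ).sdiff hbad).mono ?_
  rintro p ⟨⟨hp, Q, hQ, hstab⟩, hgood⟩
  have := hQ.1
  have := hQ.2
  have hσQ : σ • Q = Q := by
    rw [← MulAction.mem_stabilizer_iff, hstab]
    exact Subgroup.mem_zpowers σ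
  refine ⟨hp, irreducible_map_zmod_of_cyclic (Q := Q) hp ?_ hf hdeg hβroot (fun i j hij hQij ↦ ?_)
    (φ := MulSemiringAction.toRingHom _ _ σ) (fun x hx ↦ ?_) hσβ⟩
  · have h1 := (Ideal.mem_of_liesOver Q (span {(p : ℤ)}) (p : ℤ)).mp (mem_span_singleton_self _)
    simpa using h1
  · exact hgood (Set.mem_iUnion.mpr ⟨⟨(i, j), hij⟩, hp, Q, hQ, hQij⟩)
  · rw [← hσQ]
    exact Ideal.smul_mem_pointwise_smul σ x Q hx
end Irreducible

end Auxiliary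

/-- If `f ∈ ℤ[x]` is monic of degree `n ≥ 2`, irreducible over `ℚ`, with Galois group
isomorphic to the full symmetric group `S_n`, then there are infinitely many primes `p`
such that the reduction of `f` mod `p` is irreducible in `𝔽_p[x]`. -/
theorem stmt_15 (n : ℕ) (hn : 2 ≤ n) (f : Polynomial ℤ) (hf : f.Monic)
    (hdeg : f.natDegree = n)
    (hirr : Irreducible (f.map (Int.castRingHom ℚ)))
    (K : Type*) [Field K] [Algebra ℚ K]
    [Polynomial.IsSplittingField ℚ K (f.map (Int.castRingHom ℚ))]
    (e : (K ≃ₐ[ℚ] K) ≃* Equiv.Perm (Fin n)) :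
    {p : ℕ | p.Prime ∧ Irreducible (f.map (Int.castRingHom (ZMod p)))}.Infinite := by
  obtain ⟨m, rfl⟩ : ∃ m, n = m + 1 := ⟨n - 1, by omega⟩
  have : CharZero K := charZero_of_injective_algebraMap (algebraMap ℚ K).injective
  obtain rfl : ‹Algebra ℚ K› = DivisionRing.toRatAlgebra := Subsingleton.elim _ _
  have : FiniteDimensional ℚ K :=
    Polynomial.IsSplittingField.finiteDimensional K (f.map (Int.castRingHom ℚ))
  have : NumberField K := NumberField.mk
  refine infinite_setOf_prime_irreducible_map_zmod hf hdeg hirr K ?_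
  rw [Nat.card_congr e.toEquiv, Nat.card_eq_fintype_card, Fintype.card_perm, Fintype.card_fin]
end
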